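/- There exists an absolute constant c > 0 such that for every N and every set S of N points in the plane in general position, sc(S) ≤ c · 54.5430^N; that is, sc(N) = O(54.5430^N), where sc(N) is the maximum of sc(S) over all sets S of N points in general position. -/

import Mathlib

open scoped Classical

noncomputable section

/-- Points of the plane. -/
abbrev Pt : Type := ℝ × ℝ

/-- A finite point set is in general position if no three of its points are collinear. -/
def GenPos (S : Finset Pt) : Prop :=
  ∀ p ∈ S, ∀ q ∈ S, ∀ r ∈ S, p ≠ q → p ≠ r → q ≠ r →
    ¬ Collinear ℝ ({p, q, r} : Set Pt)

/-- The closed straight segment spanned by an unordered pair of points. -/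
def seg2 (e : Sym2 Pt) : Set Pt :=
  Sym2.lift ⟨fun p q => segment ℝ p q, fun p q => segment_symm ℝ p q⟩ e

/-- A crossing-free straight-edge graph (plane graph) on the point set `S`:
its edges are straight segments between points of `S`, any two of which
meet only at shared endpoints. -/
structure PlaneGraph (S : Finset Pt) where
  edges : Finset (Sym2 Pt)
  endpoint_mem : ∀ e ∈ edges, ∀ p, p ∈ e → p ∈ S
  not_isDiag : ∀ e ∈ edges, ¬ e.IsDiag
  noncrossing : ∀ e₁ ∈ edges, ∀ e₂ ∈ edges, e₁ ≠ e₂ →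
    ∀ x ∈ seg2 e₁ ∩ seg2 e₂, x ∈ e₁ ∧ x ∈ e₂

/-- A triangulation of `S` is a maximal plane graph on `S`. -/
def IsTriangulation {S : Finset Pt} (T : PlaneGraph S) : Prop :=
  ∀ G : PlaneGraph S, T.edges ⊆ G.edges → G.edges = T.edges

/-- `tr S`: the number of triangulations of `S`. -/
def triCount (S : Finset Pt) : ℕ :=
  Nat.card {T : PlaneGraph S // IsTriangulation T}

/-- A plane graph is a spanning cycle of `S` if its edges form a Hamiltonian
cycle on `S`. -/
def IsSpanningCycle {S : Finset Pt} (G : PlaneGraph S) : Prop :=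
  3 ≤ S.card ∧ ∃ f : Fin S.card ≃ {p : Pt // p ∈ S},
    G.edges =
      Finset.image (fun i : Fin S.card => s(((f i : Pt)), ((f (finRotate S.card i) : Pt)))) Finset.univ

/-- `sc S`: the number of crossing-free straight-edge spanning cycles of `S`. -/
def scCount (S : Finset Pt) : ℕ :=
  Nat.card {G : PlaneGraph S // IsSpanningCycle G}

/-- A plane graph is a perfect matching of `S` if every point of `S` is incident
to exactly one edge. -/
def IsPerfectMatching {S : Finset Pt} (G : PlaneGraph S) : Prop :=
  ∀ p ∈ S, ∃! e, e ∈ G.edges ∧ p ∈ e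

/-- `pm S`: the number of crossing-free straight-edge perfect matchings of `S`. -/
def pmCount (S : Finset Pt) : ℕ :=
  Nat.card {G : PlaneGraph S // IsPerfectMatching G}

/-- The support of a plane graph `G` on `S`: the number of triangulations of `S`
containing all edges of `G`. -/
def supp {S : Finset Pt} (G : PlaneGraph S) : ℕ :=
  Nat.card {T : PlaneGraph S // IsTriangulation T ∧ G.edges ⊆ T.edges}

/-- A finite set of points is in (strictly) convex position. -/
def InConvexPosition (Q : Finset Pt) : Prop :=
  ∀ p ∈ Q, p ∉ convexHull ℝ (↑(Q.erase p) : Set Pt)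

/-- `p q` is an edge of the convex hull boundary of `Q`. -/
def IsHullEdgeOf (Q : Finset Pt) (p q : Pt) : Prop :=
  p ∈ Q ∧ q ∈ Q ∧ p ≠ q ∧
    segment ℝ p q ⊆ frontier (convexHull ℝ (Q : Set Pt))

/-- `e` is a diagonal of the convex polygon with vertex set `Q`. -/
def IsDiagonalOf (Q : Finset Pt) (e : Sym2 Pt) : Prop :=
  ∃ p ∈ Q, ∃ q ∈ Q, e = s(p, q) ∧
    openSegment ℝ p q ⊆ interior (convexHull ℝ (Q : Set Pt))

/-- `F` is a set of ps-flippable (pseudo-simultaneously flippable) edges of the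
triangulation `T`: the edges of `F` are diagonals of pairwise interior-disjoint
(empty) convex polygons whose boundary edges all belong to `T`. -/
def IsPsFlippable {S : Finset Pt} (T : PlaneGraph S) (F : Finset (Sym2 Pt)) : Prop :=
  F ⊆ T.edges ∧
  ∃ 𝒬 : Finset (Finset Pt),
    (∀ Q ∈ 𝒬, ↑Q ⊆ (S : Set Pt) ∧ 3 ≤ Q.card ∧ InConvexPosition Q ∧
      (∀ p q, IsHullEdgeOf Q p q → s(p, q) ∈ T.edges) ∧
      (∀ p ∈ S, p ∉ interior (convexHull ℝ (Q : Set Pt)))) ∧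
    (∀ Q ∈ 𝒬, ∀ Q' ∈ 𝒬, Q ≠ Q' →
      interior (convexHull ℝ (Q : Set Pt)) ∩ interior (convexHull ℝ (Q' : Set Pt)) = ∅) ∧
    (∀ e ∈ F, ∃ Q ∈ 𝒬, IsDiagonalOf Q e)

/-- The drawing of a plane graph: the union of its (closed) edge segments and
its vertex set. -/
def drawing {S : Finset Pt} (G : PlaneGraph S) : Set Pt :=
  (⋃ e ∈ G.edges, seg2 e) ∪ (S : Set Pt)

/-- A convex decomposition of `S`: a plane graph containing all convex hull
boundary edges, whose bounded faces are all convex, and with no isolated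
vertices. -/
def IsConvexDecomposition {S : Finset Pt} (D : PlaneGraph S) : Prop :=
  (∀ p q, IsHullEdgeOf S p q → s(p, q) ∈ D.edges) ∧
  (∀ x ∉ drawing D, Bornology.IsBounded (connectedComponentIn (drawing D)ᶜ x) →
    Convex ℝ (connectedComponentIn (drawing D)ᶜ x)) ∧
  (∀ p ∈ S, ∃ e ∈ D.edges, p ∈ e)

/-- `p` is an interior vertex of `S` (not on the convex hull boundary). -/
def InteriorVtx (S : Finset Pt) (p : Pt) : Prop :=
  p ∈ S ∧ p ∉ frontier (convexHull ℝ (S : Set Pt))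

/-- `p` has a valid triple of edges in `G`. -/
def IsValidAt {S : Finset Pt} (G : PlaneGraph S) (p : Pt) : Prop :=
  ∃ a ∈ S, ∃ b ∈ S, ∃ c ∈ S,
    p ∈ convexHull ℝ ({a, b, c} : Set Pt) ∧
    s(p, a) ∈ G.edges ∧ s(p, b) ∈ G.edges ∧ s(p, c) ∈ G.edges

/-- The degree of a point in a plane graph. -/
def degree {S : Finset Pt} (G : PlaneGraph S) (p : Pt) : ℕ :=
  (G.edges.filter (fun e => p ∈ e)).card

/-- `a b c` span a triangular face of the triangulation `T`. -/
def IsTriFace {S : Finset Pt} (T : PlaneGraph S) (a b c : Pt) : Prop :=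
  a ∈ S ∧ b ∈ S ∧ c ∈ S ∧
  s(a, b) ∈ T.edges ∧ s(b, c) ∈ T.edges ∧ s(a, c) ∈ T.edges ∧
  ∀ p ∈ S, p ∉ interior (convexHull ℝ ({a, b, c} : Set Pt))

/-- An edge of a triangulation is flippable if its two incident triangles form
a convex quadrilateral. -/
def IsFlippable {S : Finset Pt} (T : PlaneGraph S) (e : Sym2 Pt) : Prop :=
  e ∈ T.edges ∧ ∃ a b c d : Pt, e = s(a, b) ∧ c ≠ d ∧
    IsTriFace T a b c ∧ IsTriFace T a b d ∧
    (openSegment ℝ a b ∩ openSegment ℝ c d).Nonempty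

/-- `flip T`: the number of flippable edges of `T`. -/
def flipCount {S : Finset Pt} (T : PlaneGraph S) : ℕ :=
  (T.edges.filter (fun e => IsFlippable T e)).card

/-- `v3 T`: the number of interior vertices of degree 3 in `T`. -/
def v3 {S : Finset Pt} (T : PlaneGraph S) : ℕ :=
  (S.filter (fun p => p ∉ frontier (convexHull ℝ (S : Set Pt)) ∧ degree T p = 3)).card

/-- The number of vertices of `S` on its convex hull boundary. -/
def hullVtxCount (S : Finset Pt) : ℕ :=
  (S.filter (fun p => p ∈ frontier (convexHull ℝ (S : Set Pt)))).card

namespace SC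

/-! ### Orientation -/

/-- Orientation determinant. -/
def o (a b c : Pt) : ℝ := (b.1 - a.1) * (c.2 - a.2) - (b.2 - a.2) * (c.1 - a.1)

theorem o_rot (a b c : Pt) : o b c a = o a b c := by unfold o; ring
theorem o_rot' (a b c : Pt) : o c a b = o a b c := by unfold o; ring
theorem o_swap (a b c : Pt) : o b a c = - o a b c := by unfold o; ring
theorem o_swap' (a b c : Pt) : o a c b = - o a b c := by unfold o; ring
theorem o_swap'' (a b c : Pt) : o c b a = - o a b c := by unfold o; ring
theorem o_self (a b : Pt) : o a a b = 0 := by unfold o; ring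
theorem o_self' (a b : Pt) : o a b b = 0 := by unfold o; ring
theorem o_self'' (a b : Pt) : o a b a = 0 := by unfold o; ring
theorem o_sum (q a b c : Pt) : o q a b + o q b c + o q c a = o a b c := by unfold o; ring
/-- Pluecker relation around `p`. -/
theorem o_pl (p x u v w : Pt) :
    o p x u * o p v w + o p x v * o p w u + o p x w * o p u v = 0 := by unfold o; ring

theorem ne_of_o_ne {a b c : Pt} (h : o a b c ≠ 0) : a ≠ b ∧ a ≠ c ∧ b ≠ c := by
  refine ⟨?_, ?_, ?_⟩ <;> rintro rfl <;> apply h <;> unfold o <;> ring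

theorem ne_of_o_pos {a b c : Pt} (h : 0 < o a b c) : a ≠ b ∧ a ≠ c ∧ b ≠ c := ne_of_o_ne (ne_of_gt h)

/-- Strictly inside the ccw triangle. -/
def inTri (q a b c : Pt) : Prop := 0 < o q a b ∧ 0 < o q b c ∧ 0 < o q c a

theorem inTri_rot {q a b c : Pt} (h : inTri q a b c) : inTri q b c a := ⟨h.2.1, h.2.2, h.1⟩

/-- signed distance to the line through `q` in direction `d` -/
def sd (d q x : Pt) : ℝ := d.1 * (x.2 - q.2) - d.2 * (x.1 - q.1)

/-- signed crossing number of the directed edge `xy` with the ray from `q` in direction `d` -/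
def cr (d q x y : Pt) : ℤ :=
  if sd d q x < 0 ∧ 0 ≤ sd d q y ∧ 0 < o q x y then 1
  else if sd d q y < 0 ∧ 0 ≤ sd d q x ∧ o q x y < 0 then -1 else 0

theorem cr_anti (d q x y : Pt) : cr d q y x = - cr d q x y := by
  have h : o q y x = - o q x y := by unfold o; ring
  unfold cr
  rw [h]
  by_cases h1 : sd d q x < 0 <;> by_cases h2 : sd d q y < 0 <;>
  by_cases h3 : 0 < o q x y <;> by_cases h4 : o q x y < 0 <;>
  simp [h1, h2, h3, h4, not_le.2, not_lt.1] <;> linarith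

theorem cr_zero_of_o {d q x y : Pt} (h : o q x y = 0) : cr d q x y = 0 := by
  unfold cr; simp [h]

theorem sd_pl (d q x y z : Pt) :
    sd d q x * o q y z + sd d q y * o q z x + sd d q z * o q x y = 0 := by
  unfold sd o; ring

theorem o_zero_of_sd {d q x y : Pt} (hd : d ≠ 0) (hx : sd d q x = 0) (hy : sd d q y = 0) :
    o q x y = 0 := by
  unfold sd at hx hy
  unfold o
  by_cases h1 : d.1 = 0
  · have h2 : d.2 ≠ 0 := fun h2 => hd (Prod.ext h1 h2)
    simp only [h1, zero_mul, zero_sub, neg_eq_zero, mul_eq_zero, h2, false_or] at hx hy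
    rw [hx, hy]; ring
  · have : d.1 * ((x.1 - q.1) * (y.2 - q.2) - (x.2 - q.2) * (y.1 - q.1)) = 0 := by
      linear_combination (x.1 - q.1) * hy - (y.1 - q.1) * hx
    simpa [h1] using this

/-- covering number of a triangle -/
def cov (d q : Pt) (t : Pt × Pt × Pt) : ℤ :=
  cr d q t.1 t.2.1 + cr d q t.2.1 t.2.2 + cr d q t.2.2 t.1

theorem cov_aux {d q x y z : Pt} (hs : 0 < o x y z)
    (h1 : o q x y ≠ 0) (h2 : o q y z ≠ 0) (h3 : o q z x ≠ 0)
    (sx : sd d q x < 0) (sy : 0 ≤ sd d q y) (sz : 0 ≤ sd d q z) :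
    cov d q (x, y, z) = if inTri q x y z then 1 else 0 := by
  have hsum := o_sum q x y z
  have hp := sd_pl d q x y z
  have e2 : cr d q y z = 0 := by unfold cr; simp [not_lt.2 sy, not_lt.2 sz]
  have e1 : cr d q x y = if 0 < o q x y then 1 else 0 := by
    unfold cr; simp [sx, sy, not_lt.2 sy]
  have e3 : cr d q z x = if o q z x < 0 then -1 else 0 := by
    unfold cr; simp [sx, sz, not_lt.2 sz]
  unfold cov
  simp only [e1, e2, e3]
  unfold inTri
  rcases lt_or_gt_of_ne h1 with a1 | a1 <;> rcases lt_or_gt_of_ne h3 with a3 | a3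
  · exfalso
    have : 0 ≤ sd d q x * o q y z := by nlinarith
    have : o q y z ≤ 0 := by
      by_contra hc; push Not at hc; nlinarith
    linarith
  · simp [a1, a3.not_gt, a1.not_gt]
  · simp [a1, a3, a3.not_gt]
  · have : sd d q x * o q y z ≤ 0 := by nlinarith
    have : 0 < o q y z := by
      refine lt_of_le_of_ne ?_ h2.symm
      by_contra hc; push Not at hc; nlinarith
    simp [a1, a3, a3.not_gt, this]

theorem cov_aux' {d q x y z : Pt} (hs : 0 < o x y z)
    (h1 : o q x y ≠ 0) (h2 : o q y z ≠ 0) (h3 : o q z x ≠ 0)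
    (sx : 0 ≤ sd d q x) (sy : sd d q y < 0) (sz : sd d q z < 0) :
    cov d q (x, y, z) = if inTri q x y z then 1 else 0 := by
  have hsum := o_sum q x y z
  have hp := sd_pl d q x y z
  have e2 : cr d q y z = 0 := by unfold cr; simp [not_le.2 sy, not_le.2 sz]
  have e1 : cr d q x y = if o q x y < 0 then -1 else 0 := by
    unfold cr; simp [sx, sy, not_lt.2 sx]
  have e3 : cr d q z x = if 0 < o q z x then 1 else 0 := by
    unfold cr; simp [sx, sz, not_lt.2 sx]
  unfold cov
  simp only [e1, e2, e3]
  unfold inTri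
  rcases lt_or_gt_of_ne h1 with a1 | a1 <;> rcases lt_or_gt_of_ne h3 with a3 | a3
  · exfalso
    have h4 : sd d q x * o q y z < 0 := by nlinarith
    have : o q y z < 0 := by
      by_contra hc; push Not at hc; nlinarith
    linarith
  · simp [a1, a3, a1.not_gt]
  · simp [a1.not_gt, a3.not_gt]
  · have h4 : 0 < sd d q x * o q y z := by nlinarith
    have : 0 < o q y z := by
      by_contra hc; push Not at hc; nlinarith
    simp [a1, a3, a1.not_gt, this]

theorem cov_rot (d q x y z : Pt) : cov d q (y, z, x) = cov d q (x, y, z) := by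
  unfold cov; simp only; ring

theorem inTri_rot_iff (q a b c : Pt) : inTri q b c a ↔ inTri q a b c := by
  unfold inTri; tauto

theorem cov_eq {d q x y z : Pt} (hd : d ≠ 0) (hs : 0 < o x y z)
    (h1 : o q x y ≠ 0) (h2 : o q y z ≠ 0) (h3 : o q z x ≠ 0) :
    cov d q (x, y, z) = if inTri q x y z then 1 else 0 := by
  have hs2 : 0 < o y z x := by rwa [o_rot]
  have hs3 : 0 < o z x y := by rwa [o_rot']
  have hp := sd_pl d q x y z
  rcases lt_or_ge (sd d q x) 0 with sx | sx <;> rcases lt_or_ge (sd d q y) 0 with sy | sy <;>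
    rcases lt_or_ge (sd d q z) 0 with sz | sz
  · have : ¬ inTri q x y z := by rintro ⟨a, b, c⟩; nlinarith
    simp [cov, cr, this, sx.not_ge, sy.not_ge, sz.not_ge]
  · have := cov_aux' hs3 h3 h1 h2 sz sx sy
    rwa [← cov_rot, cov_rot, ← cov_rot, inTri_rot_iff, ← inTri_rot_iff, ← inTri_rot_iff] at this
  · have := cov_aux' hs2 h2 h3 h1 sy sz sx
    rwa [cov_rot, inTri_rot_iff] at this
  · exact cov_aux hs h1 h2 h3 sx sy sz
  · exact cov_aux' hs h1 h2 h3 sx sy sz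
  · have := cov_aux hs2 h2 h3 h1 sy sz sx
    rwa [cov_rot, inTri_rot_iff] at this
  · have := cov_aux hs3 h3 h1 h2 sz sx sy
    rwa [← cov_rot, cov_rot, ← cov_rot, inTri_rot_iff, ← inTri_rot_iff, ← inTri_rot_iff] at this
  · have : ¬ inTri q x y z := by
      rintro ⟨a, b, c⟩
      have hx : sd d q x = 0 := by nlinarith [mul_nonneg sx b.le, mul_nonneg sy c.le, mul_nonneg sz a.le]
      have hy : sd d q y = 0 := by nlinarith [mul_nonneg sx b.le, mul_nonneg sy c.le, mul_nonneg sz a.le]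
      exact h1 (o_zero_of_sd hd hx hy)
    simp [cov, cr, this, sx.not_gt, sy.not_gt, sz.not_gt]

theorem cov_vertex {d x y z : Pt} (hs : 0 < o x y z) :
    cov d x (x, y, z) = if sd d x y < 0 ∧ 0 ≤ sd d x z then 1 else 0 := by
  unfold cov
  simp only
  rw [cr_zero_of_o (o_self x y), cr_zero_of_o (o_self'' x z)]
  unfold cr
  simp [hs, hs.not_gt]

/-! ### Triangulations -/

structure Cfg (P : Finset Pt) (A B C : Pt) : Prop where
  hA : A ∈ P
  hB : B ∈ P
  hC : C ∈ P
  abc : 0 < o A B C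
  gp : ∀ a ∈ P, ∀ b ∈ P, ∀ c ∈ P, a ≠ b → a ≠ c → b ≠ c → o a b c ≠ 0
  ins : ∀ q ∈ P, q ≠ A → q ≠ B → q ≠ C → inTri q A B C

structure Tri (P : Finset Pt) (A B C : Pt) (T : Finset (Pt × Pt × Pt)) : Prop where
  mem : ∀ a b c, (a, b, c) ∈ T → a ∈ P
  rot : ∀ a b c, (a, b, c) ∈ T → (b, c, a) ∈ T
  pos : ∀ a b c, (a, b, c) ∈ T → 0 < o a b c
  emp : ∀ a b c, (a, b, c) ∈ T → ∀ q ∈ P, ¬ inTri q a b c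
  bd : ∀ f : Pt → Pt → ℤ, (∀ x y, f y x = - f x y) →
    ∑ t ∈ T, f t.1 t.2.1 = f A B + f B C + f C A

variable {P : Finset Pt} {A B C : Pt} {T : Finset (Pt × Pt × Pt)}

theorem Tri.rot2 (h : Tri P A B C T) {a b c : Pt} (ht : (a, b, c) ∈ T) : (c, a, b) ∈ T :=
  h.rot _ _ _ (h.rot _ _ _ ht)
theorem Tri.mem2 (h : Tri P A B C T) {a b c : Pt} (ht : (a, b, c) ∈ T) : b ∈ P :=
  h.mem _ _ _ (h.rot _ _ _ ht)
theorem Tri.mem3 (h : Tri P A B C T) {a b c : Pt} (ht : (a, b, c) ∈ T) : c ∈ P :=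
  h.mem _ _ _ (h.rot2 ht)

theorem sum_rot {M : Type*} [AddCommMonoid M] (hrot : ∀ a b c, (a, b, c) ∈ T → (b, c, a) ∈ T)
    (F : Pt × Pt × Pt → M) :
    ∑ t ∈ T, F (t.2.1, t.2.2, t.1) = ∑ t ∈ T, F t := by
  refine Finset.sum_nbij' (fun t => (t.2.1, t.2.2, t.1)) (fun t => (t.2.2, t.1, t.2.1)) ?_ ?_ ?_ ?_ ?_
  · rintro ⟨a, b, c⟩ h; exact hrot _ _ _ h
  · rintro ⟨a, b, c⟩ h; exact hrot _ _ _ (hrot _ _ _ h)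
  · rintro ⟨a, b, c⟩ h; rfl
  · rintro ⟨a, b, c⟩ h; rfl
  · rintro ⟨a, b, c⟩ h; rfl

theorem Tri.sum_cyc (h : Tri P A B C T) (f : Pt → Pt → ℤ) (hf : ∀ x y, f y x = - f x y) :
    ∑ t ∈ T, (f t.1 t.2.1 + f t.2.1 t.2.2 + f t.2.2 t.1) = 3 * (f A B + f B C + f C A) := by
  rw [Finset.sum_add_distrib, Finset.sum_add_distrib]
  have h1 : ∑ t ∈ T, f t.2.1 t.2.2 = ∑ t ∈ T, f t.1 t.2.1 :=
    sum_rot h.rot (fun t => f t.1 t.2.1)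
  have h2 : ∑ t ∈ T, f t.2.2 t.1 = ∑ t ∈ T, f t.2.1 t.2.2 :=
    sum_rot h.rot (fun t => f t.2.1 t.2.2)
  rw [h2, h1, h.bd f hf]; ring

theorem Tri.sum_cov (h : Tri P A B C T) (d q : Pt) :
    ∑ t ∈ T, cov d q t = 3 * cov d q (A, B, C) :=
  h.sum_cyc (cr d q) (cr_anti d q)

/-- hull contribution at a vertex -/
def hc (d A B C q : Pt) : ℤ := cov d q (A, B, C)

theorem Tri.vc (hP : Cfg P A B C) (h : Tri P A B C T) {d q : Pt} (hd : d ≠ 0) (hq : q ∈ P) :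
    (((T.filter (fun t => t.1 = q ∧ sd d q t.2.1 < 0 ∧ 0 ≤ sd d q t.2.2)).card : ℕ) : ℤ)
      = hc d A B C q := by
  have key : ∀ t ∈ T, cov d q t =
      (if t.1 = q ∧ sd d q t.2.1 < 0 ∧ 0 ≤ sd d q t.2.2 then 1 else 0)
      + (if t.2.1 = q ∧ sd d q t.2.2 < 0 ∧ 0 ≤ sd d q t.1 then 1 else 0)
      + (if t.2.2 = q ∧ sd d q t.1 < 0 ∧ 0 ≤ sd d q t.2.1 then 1 else 0) := by
    rintro ⟨a, b, c⟩ ht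
    have hpos := h.pos _ _ _ ht
    obtain ⟨n1, n2, n3⟩ := ne_of_o_pos hpos
    have ma := h.mem _ _ _ ht
    have mb := h.mem2 ht
    have mc := h.mem3 ht
    by_cases ha : a = q
    · subst ha
      rw [cov_vertex hpos]; simp [n1.symm, n2.symm]
    by_cases hb : b = q
    · subst hb
      rw [← cov_rot, cov_vertex (by rwa [o_rot])]; simp [n1, n3.symm]
    by_cases hcq : c = q
    · subst hcq
      rw [← cov_rot, ← cov_rot, cov_vertex (by rwa [o_rot'])]; simp [n2, n3]
    · rw [cov_eq hd hpos (hP.gp _ hq _ ma _ mb (Ne.symm ha) (Ne.symm hb) n1)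
        (hP.gp _ hq _ mb _ mc (Ne.symm hb) (Ne.symm hcq) n3)
        (hP.gp _ hq _ mc _ ma (Ne.symm hcq) (Ne.symm ha) n2.symm), if_neg (h.emp _ _ _ ht q hq)]
      simp [ha, hb, hcq]
  have hs := h.sum_cov d q
  rw [Finset.sum_congr rfl key, Finset.sum_add_distrib, Finset.sum_add_distrib] at hs
  set F : Pt × Pt × Pt → ℤ := fun t => if t.1 = q ∧ sd d q t.2.1 < 0 ∧ 0 ≤ sd d q t.2.2 then 1 else 0
    with hF
  have h1 : ∑ t ∈ T, (if t.2.1 = q ∧ sd d q t.2.2 < 0 ∧ 0 ≤ sd d q t.1 then (1:ℤ) else 0)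
      = ∑ t ∈ T, F t := sum_rot h.rot F
  have h2 : ∑ t ∈ T, (if t.2.2 = q ∧ sd d q t.1 < 0 ∧ 0 ≤ sd d q t.2.1 then (1:ℤ) else 0)
      = ∑ t ∈ T, F t := by
    rw [← h1]
    exact sum_rot h.rot (fun t => F (t.2.1, t.2.2, t.1))
  rw [h1, h2] at hs
  have h3 : ((T.filter (fun t => t.1 = q ∧ sd d q t.2.1 < 0 ∧ 0 ≤ sd d q t.2.2)).card : ℤ)
      = ∑ t ∈ T, F t := by
    rw [hF, Finset.sum_boole]
  rw [h3]; unfold hc; linarith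

theorem hc_interior (hP : Cfg P A B C) {d q : Pt} (hd : d ≠ 0) (hq : q ∈ P)
    (h1 : q ≠ A) (h2 : q ≠ B) (h3 : q ≠ C) : hc d A B C q = 1 := by
  have hi := hP.ins q hq h1 h2 h3
  unfold hc
  rw [cov_eq hd hP.abc hi.1.ne' hi.2.1.ne' hi.2.2.ne', if_pos hi]

theorem hc_le (hP : Cfg P A B C) {d q : Pt} (hd : d ≠ 0) (hq : q ∈ P) : hc d A B C q ≤ 1 := by
  by_cases h1 : q = A
  · subst h1; unfold hc; rw [cov_vertex hP.abc]; split_ifs <;> norm_num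
  by_cases h2 : q = B
  · subst h2; unfold hc; rw [← cov_rot, cov_vertex (by rw [o_rot]; exact hP.abc)]; split_ifs <;> norm_num
  by_cases h3 : q = C
  · subst h3; unfold hc
    rw [← cov_rot, ← cov_rot, cov_vertex (by rw [o_rot']; exact hP.abc)]; split_ifs <;> norm_num
  · rw [hc_interior hP hd hq h1 h2 h3]

/-- At most one triangle at `q` meets the ray in direction `d`. -/
theorem Tri.vc_unique (hP : Cfg P A B C) (h : Tri P A B C T) {d q x y x' y' : Pt} (hd : d ≠ 0)
    (h1 : (q, x, y) ∈ T) (h2 : (q, x', y') ∈ T) (sx : sd d q x < 0) (sy : 0 ≤ sd d q y)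
    (sx' : sd d q x' < 0) (sy' : 0 ≤ sd d q y') : x = x' ∧ y = y' := by
  have hq := h.mem _ _ _ h1
  have hcard := h.vc hP hd hq
  have hle := hc_le hP hd hq
  rw [← hcard] at hle
  have hle' : (T.filter (fun t => t.1 = q ∧ sd d q t.2.1 < 0 ∧ 0 ≤ sd d q t.2.2)).card ≤ 1 := by
    exact_mod_cast hle
  have := Finset.card_le_one.1 hle' (q, x, y) (by simp [h1, sx, sy]) (q, x', y') (by simp [h2, sx', sy'])
  simpa using this

theorem Tri.vc_exists (hP : Cfg P A B C) (h : Tri P A B C T) {d q : Pt} (hd : d ≠ 0) (hq : q ∈ P)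
    (n1 : q ≠ A) (n2 : q ≠ B) (n3 : q ≠ C) :
    ∃ x y, (q, x, y) ∈ T ∧ sd d q x < 0 ∧ 0 ≤ sd d q y := by
  have hcard := h.vc hP hd hq
  rw [hc_interior hP hd hq n1 n2 n3] at hcard
  have hpos : 0 < (T.filter (fun t => t.1 = q ∧ sd d q t.2.1 < 0 ∧ 0 ≤ sd d q t.2.2)).card := by
    have : (0:ℤ) < ((T.filter (fun t => t.1 = q ∧ sd d q t.2.1 < 0 ∧ 0 ≤ sd d q t.2.2)).card : ℤ) := by
      rw [hcard]; norm_num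
    exact_mod_cast this
  obtain ⟨⟨a, x, y⟩, ht⟩ := Finset.card_pos.1 hpos
  simp only [Finset.mem_filter] at ht
  obtain ⟨ht, rfl, s1, s2⟩ := ht
  exact ⟨x, y, ht, s1, s2⟩

theorem sd_sub (q w x : Pt) : sd (w - q) q x = o q w x := by
  unfold sd o; simp

theorem sd_sub_neg (q w x : Pt) : sd (q - w) q x = - o q w x := by
  unfold sd o; simp; ring

theorem Tri.func (hP : Cfg P A B C) (h : Tri P A B C T) {u v w w' : Pt}
    (h1 : (u, v, w) ∈ T) (h2 : (u, v, w') ∈ T) : w = w' := by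
  by_contra hne
  have p1 := h.pos _ _ _ h1
  have p2 := h.pos _ _ _ h2
  obtain ⟨a1, a2, a3⟩ := ne_of_o_pos p1
  obtain ⟨b1, b2, b3⟩ := ne_of_o_pos p2
  have hnz := hP.gp _ (h.mem _ _ _ h1) _ (h.mem3 h1) _ (h.mem3 h2) a2 b2 hne
  have e1 := o_swap' u v w
  have e2 := o_swap' u v w'
  have e3 := o_swap' u w w'
  rcases lt_or_gt_of_ne hnz with hlt | hgt
  · refine hne (h.vc_unique hP (d := w' - u) (sub_ne_zero.2 b2.symm) h1 h2 ?_ ?_ ?_ ?_).2 <;> rw [sd_sub]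
    · rw [e2]; linarith
    · rw [e3]; linarith
    · rw [e2]; linarith
    · rw [o_self']
  · refine hne (h.vc_unique hP (d := w - u) (sub_ne_zero.2 a2.symm) h1 h2 ?_ ?_ ?_ ?_).2 <;> rw [sd_sub]
    · rw [e1]; linarith
    · rw [o_self']
    · rw [e1]; linarith
    · linarith

/-- number of triangles using a directed edge -/
theorem Tri.edge_count (h : Tri P A B C T) {u v : Pt} (huv : u ≠ v) :
    (((T.filter (fun t => t.1 = u ∧ t.2.1 = v)).card : ℕ) : ℤ) -
    ((T.filter (fun t => t.1 = v ∧ t.2.1 = u)).card : ℕ) =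
    (((if A = u ∧ B = v then 1 else 0) - (if A = v ∧ B = u then 1 else 0)) +
    ((if B = u ∧ C = v then 1 else 0) - (if B = v ∧ C = u then 1 else 0))) +
    ((if C = u ∧ A = v then 1 else 0) - (if C = v ∧ A = u then 1 else 0)) := by
  have := h.bd (fun x y => (if x = u ∧ y = v then 1 else 0) - (if x = v ∧ y = u then 1 else 0)) (by
    intro x y
    simp only [and_comm]
    ring)
  rw [← this, Finset.sum_sub_distrib, Finset.sum_boole, Finset.sum_boole]

theorem Tri.card_edge_le (hP : Cfg P A B C) (h : Tri P A B C T) (u v : Pt) :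
    (T.filter (fun t => t.1 = u ∧ t.2.1 = v)).card ≤ 1 := by
  rw [Finset.card_le_one]
  rintro ⟨a, b, c⟩ h1 ⟨a', b', c'⟩ h2
  simp only [Finset.mem_filter] at h1 h2
  obtain ⟨h1, rfl, rfl⟩ := h1
  obtain ⟨h2, rfl, rfl⟩ := h2
  rw [h.func hP h1 h2]

/-- hull edge -/
def hullE (A B C u v : Pt) : Prop := (u = A ∧ v = B) ∨ (u = B ∧ v = C) ∨ (u = C ∧ v = A)

theorem Tri.twin (hP : Cfg P A B C) (h : Tri P A B C T) {u v w : Pt}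
    (h1 : (u, v, w) ∈ T) (hn : ¬ hullE A B C u v) : ∃ z, (v, u, z) ∈ T := by
  have hne := (ne_of_o_pos (h.pos _ _ _ h1)).1
  have hc := h.edge_count hne
  by_contra hcon
  push Not at hcon
  have e0 : (T.filter (fun t => t.1 = v ∧ t.2.1 = u)) = ∅ := by
    apply Finset.filter_eq_empty_iff.2
    rintro ⟨a, b, c⟩ ht ⟨rfl, rfl⟩
    exact hcon _ ht
  have e1 : 0 < (T.filter (fun t => t.1 = u ∧ t.2.1 = v)).card :=
    Finset.card_pos.2 ⟨(u, v, w), by simp [h1]⟩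
  rw [e0] at hc
  unfold hullE at hn
  push Not at hn
  have x1 : ¬ (A = u ∧ B = v) := fun hh => hn.1 hh.1.symm hh.2.symm
  have x2 : ¬ (B = u ∧ C = v) := fun hh => hn.2.1 hh.1.symm hh.2.symm
  have x3 : ¬ (C = u ∧ A = v) := fun hh => hn.2.2 hh.1.symm hh.2.symm
  rw [if_neg x1, if_neg x2, if_neg x3] at hc
  simp only [Finset.card_empty] at hc
  split_ifs at hc <;> omega

theorem Tri.hull_edge (hP : Cfg P A B C) (h : Tri P A B C T) {u v : Pt}
    (hh : hullE A B C u v) : (∃ z, (u, v, z) ∈ T) ∧ ∀ z, (v, u, z) ∉ T := by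
  obtain ⟨n1, n2, n3⟩ := ne_of_o_pos hP.abc
  have hne : u ≠ v := by
    rcases hh with ⟨rfl, rfl⟩ | ⟨rfl, rfl⟩ | ⟨rfl, rfl⟩
    exacts [n1, n3, n2.symm]
  have hc := h.edge_count hne
  have l1 := h.card_edge_le hP u v
  have l2 := h.card_edge_le hP v u
  have key : (T.filter (fun t => t.1 = u ∧ t.2.1 = v)).card = 1 ∧
      (T.filter (fun t => t.1 = v ∧ t.2.1 = u)).card = 0 := by
    rcases hh with ⟨rfl, rfl⟩ | ⟨rfl, rfl⟩ | ⟨rfl, rfl⟩ <;>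
      simp [n1, n2, n3, n1.symm, n2.symm, n3.symm] at hc <;> omega
  constructor
  · obtain ⟨⟨a, b, c⟩, ht⟩ := Finset.card_pos.1 (by rw [key.1]; norm_num :
      0 < (T.filter (fun t => t.1 = u ∧ t.2.1 = v)).card)
    simp only [Finset.mem_filter] at ht
    obtain ⟨ht, rfl, rfl⟩ := ht
    exact ⟨c, ht⟩
  · intro z hz
    have := Finset.card_eq_zero.1 key.2
    have hm : (v, u, z) ∈ T.filter (fun t => t.1 = v ∧ t.2.1 = u) := by simp [hz]
    rw [this] at hm
    simp at hm

theorem Tri.twin_left (hP : Cfg P A B C) (h : Tri P A B C T) {u v w : Pt}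
    (h1 : (u, v, w) ∈ T) (n1 : u ≠ A) (n2 : u ≠ B) (n3 : u ≠ C) : ∃ z, (v, u, z) ∈ T :=
  h.twin hP h1 (by rintro (⟨rfl, -⟩ | ⟨rfl, -⟩ | ⟨rfl, -⟩) <;> contradiction)

theorem Tri.twin_right (hP : Cfg P A B C) (h : Tri P A B C T) {u v w : Pt}
    (h1 : (u, v, w) ∈ T) (n1 : v ≠ A) (n2 : v ≠ B) (n3 : v ≠ C) : ∃ z, (v, u, z) ∈ T :=
  h.twin hP h1 (by rintro (⟨-, rfl⟩ | ⟨-, rfl⟩ | ⟨-, rfl⟩) <;> contradiction)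

end SC

namespace SC
variable {P : Finset Pt} {A B C : Pt} {T : Finset (Pt × Pt × Pt)}

theorem cont_o (a b : Pt) : Continuous (fun q : Pt => o q a b) := by
  unfold o; fun_prop

theorem exists_generic_one {U : Set Pt} (hU : IsOpen U) (hne : U.Nonempty) {a b : Pt} (hab : a ≠ b) :
    ∃ q ∈ U, o q a b ≠ 0 := by
  obtain ⟨m, hm⟩ := hne
  by_cases h0 : o m a b = 0
  · have hc : Continuous (fun e : ℝ => ((m.1 - e * (b.2 - a.2), m.2 + e * (b.1 - a.1)) : Pt)) := by
      fun_prop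
    have h1 : ∀ᶠ e in nhds (0:ℝ), ((m.1 - e * (b.2 - a.2), m.2 + e * (b.1 - a.1)) : Pt) ∈ U := by
      apply hc.continuousAt.eventually_mem
      apply hU.mem_nhds
      simpa using hm
    have h2 : ∃ᶠ e in nhds (0:ℝ), 0 < e :=
      (self_mem_nhdsWithin (a := (0:ℝ)) (s := Set.Ioi 0) |> fun h =>
        (Filter.Eventually.frequently (f := nhdsWithin (0:ℝ) (Set.Ioi 0)) h).filter_mono nhdsWithin_le_nhds)
    obtain ⟨e, he, hpos⟩ := (h2.and_eventually h1).exists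
    refine ⟨_, hpos, ?_⟩
    have e1 : o ((m.1 - e * (b.2 - a.2), m.2 + e * (b.1 - a.1)) : Pt) a b
        = o m a b + e * ((b.1 - a.1) ^ 2 + (b.2 - a.2) ^ 2) := by
      unfold o; ring
    rw [e1, h0]
    have : 0 < (b.1 - a.1) ^ 2 + (b.2 - a.2) ^ 2 := by
      by_contra hcon
      have s1 := sq_nonneg (b.1 - a.1)
      have s2 := sq_nonneg (b.2 - a.2)
      have z1 : b.1 - a.1 = 0 := by
        have : (b.1 - a.1) ^ 2 = 0 := by linarith
        simpa using this
      have z2 : b.2 - a.2 = 0 := by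
        have : (b.2 - a.2) ^ 2 = 0 := by linarith
        simpa using this
      exact hab (Prod.ext (by linarith) (by linarith))
    have := mul_pos he this
    intro hh; linarith
  · exact ⟨m, hm, h0⟩

theorem exists_generic {U : Set Pt} (hU : IsOpen U) (hne : U.Nonempty) (L : Finset (Pt × Pt)) :
    ∃ q ∈ U, ∀ e ∈ L, e.1 ≠ e.2 → o q e.1 e.2 ≠ 0 := by
  induction L using Finset.induction_on generalizing U with
  | empty => obtain ⟨m, hm⟩ := hne; exact ⟨m, hm, by simp⟩
  | insert e L _ ih =>
    by_cases he : e.1 = e.2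
    · obtain ⟨q, hq, h⟩ := ih hU hne
      refine ⟨q, hq, ?_⟩
      intro e' he' hne'
      rcases Finset.mem_insert.1 he' with rfl | h'
      · exact absurd he hne'
      · exact h _ h' hne'
    · obtain ⟨q0, hq0, h0⟩ := exists_generic_one hU hne he
      obtain ⟨q, hq, h⟩ := ih (U := U ∩ {q | o q e.1 e.2 ≠ 0})
        (hU.inter ((cont_o e.1 e.2).isOpen_preimage _ isOpen_ne)) ⟨q0, hq0, h0⟩
      refine ⟨q, hq.1, ?_⟩
      intro e' he' hne'
      rcases Finset.mem_insert.1 he' with rfl | h'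
      · exact hq.2
      · exact h _ h' hne'

theorem exists_generic' {U : Set Pt} (hU : IsOpen U) (hne : U.Nonempty) (P : Finset Pt) :
    ∃ q ∈ U, ∀ a ∈ P, ∀ b ∈ P, a ≠ b → o q a b ≠ 0 := by
  obtain ⟨q, hq, h⟩ := exists_generic hU hne (P ×ˢ P)
  exact ⟨q, hq, fun a ha b hb hab => h (a, b) (by simp [ha, hb]) hab⟩

/-! ### Crossing -/

/-- proper crossing of segments -/
def X (a b c d : Pt) : Prop := o a b c * o a b d < 0 ∧ o c d a * o c d b < 0

theorem X_symm {a b c d : Pt} (h : X a b c d) : X c d a b := ⟨h.2, h.1⟩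
theorem X_swap1 {a b c d : Pt} (h : X a b c d) : X b a c d := by
  refine ⟨?_, ?_⟩
  · rw [o_swap a b c, o_swap a b d]; linarith [h.1]
  · linarith [h.2, mul_comm (o c d a) (o c d b)]
theorem X_swap2 {a b c d : Pt} (h : X a b c d) : X a b d c := X_symm (X_swap1 (X_symm h))

theorem cross_pt {u v x y : Pt} (h : X u v x y) :
    ∃ t s : ℝ, 0 < t ∧ t < 1 ∧ 0 < s ∧ s < 1 ∧
      u.1 + t * (v.1 - u.1) = x.1 + s * (y.1 - x.1) ∧
      u.2 + t * (v.2 - u.2) = x.2 + s * (y.2 - x.2) := by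
  obtain ⟨h1, h2⟩ := h
  have frac : ∀ a b : ℝ, a * b < 0 → a - b ≠ 0 ∧ 0 < a / (a - b) ∧ a / (a - b) < 1 := by
    intro a b hab
    rcases mul_neg_iff.1 hab with ⟨ha, hb⟩ | ⟨ha, hb⟩
    · have : 0 < a - b := by linarith
      refine ⟨this.ne', div_pos ha this, ?_⟩
      rw [div_lt_one this]; linarith
    · have : a - b < 0 := by linarith
      refine ⟨this.ne, div_pos_of_neg_of_neg ha this, ?_⟩
      rw [div_lt_one_of_neg this]; linarith
  obtain ⟨d1, p1, q1⟩ := frac _ _ h1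
  obtain ⟨d2, p2, q2⟩ := frac _ _ h2
  refine ⟨_, _, p2, q2, p1, q1, ?_, ?_⟩
  · have : o u v x - o u v y = - (o x y u - o x y v) := by unfold o; ring
    rw [this] at d1 ⊢
    field_simp
    unfold o; ring
  · have : o u v x - o u v y = - (o x y u - o x y v) := by unfold o; ring
    rw [this] at d1 ⊢
    field_simp
    unfold o; ring

/-! ### Covering by generic points -/

def rot3 (a b c : Pt) : Finset (Pt × Pt × Pt) := {(a, b, c), (b, c, a), (c, a, b)}

theorem mem_rot3 {a b c : Pt} {t : Pt × Pt × Pt} :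
    t ∈ rot3 a b c ↔ t = (a, b, c) ∨ t = (b, c, a) ∨ t = (c, a, b) := by
  unfold rot3; simp

theorem sum_rot3 {M : Type*} [AddCommMonoid M] {a b c : Pt} (hab : a ≠ b) (hac : a ≠ c) (hbc : b ≠ c)
    (F : Pt × Pt × Pt → M) :
    ∑ t ∈ rot3 a b c, F t = F (a, b, c) + F (b, c, a) + F (c, a, b) := by
  unfold rot3
  rw [Finset.sum_insert, Finset.sum_insert, Finset.sum_singleton, add_assoc]
  · simp [hbc]
  · simp [hab, hac]

theorem card_rot3 {a b c : Pt} (hab : a ≠ b) (hac : a ≠ c) (hbc : b ≠ c) : (rot3 a b c).card = 3 := by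
  rw [Finset.card_eq_sum_ones, sum_rot3 hab hac hbc]

theorem Tri.cover_count (h : Tri P A B C T) (hABC : 0 < o A B C) {q : Pt}
    (hA : A ∈ P) (hB : B ∈ P) (hC : C ∈ P)
    (hg : ∀ a ∈ P, ∀ b ∈ P, a ≠ b → o q a b ≠ 0) :
    (T.filter (fun t => inTri q t.1 t.2.1 t.2.2)).card = if inTri q A B C then 3 else 0 := by
  have hd : ((1, 0) : Pt) ≠ 0 := by
    intro hh; have := congrArg Prod.fst hh; simp at this
  have hs := h.sum_cov (1, 0) q
  obtain ⟨n1, n2, n3⟩ := ne_of_o_pos hABC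
  rw [cov_eq hd hABC (hg _ hA _ hB n1) (hg _ hB _ hC n3) (hg _ hC _ hA n2.symm)] at hs
  have : ∀ t ∈ T, cov (1, 0) q t = if inTri q t.1 t.2.1 t.2.2 then 1 else 0 := by
    rintro ⟨a, b, c⟩ ht
    have hpos := h.pos _ _ _ ht
    obtain ⟨n1, n2, n3⟩ := ne_of_o_pos hpos
    exact cov_eq hd hpos (hg _ (h.mem _ _ _ ht) _ (h.mem2 ht) n1) (hg _ (h.mem2 ht) _ (h.mem3 ht) n3)
      (hg _ (h.mem3 ht) _ (h.mem _ _ _ ht) n2.symm)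
  rw [Finset.sum_congr rfl this, Finset.sum_boole] at hs
  split_ifs at hs ⊢ <;> exact_mod_cast hs

theorem Tri.cover_unique (h : Tri P A B C T) (hP : Cfg P A B C) {q : Pt}
    (hg : ∀ a ∈ P, ∀ b ∈ P, a ≠ b → o q a b ≠ 0)
    {a b c a' b' c' : Pt} (h1 : (a, b, c) ∈ T) (h2 : (a', b', c') ∈ T)
    (i1 : inTri q a b c) (i2 : inTri q a' b' c') : (a', b', c') ∈ rot3 a b c := by
  have hcc := h.cover_count hP.abc hP.hA hP.hB hP.hC hg
  have hle : (T.filter (fun t => inTri q t.1 t.2.1 t.2.2)).card ≤ 3 := by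
    rw [hcc]; split_ifs <;> norm_num
  obtain ⟨n1, n2, n3⟩ := ne_of_o_pos (h.pos _ _ _ h1)
  have hsub : rot3 a b c ⊆ T.filter (fun t => inTri q t.1 t.2.1 t.2.2) := by
    intro t ht
    rw [Finset.mem_filter]
    rcases mem_rot3.1 ht with rfl | rfl | rfl
    · exact ⟨h1, i1⟩
    · exact ⟨h.rot _ _ _ h1, inTri_rot i1⟩
    · exact ⟨h.rot2 h1, inTri_rot (inTri_rot i1)⟩
  have := Finset.eq_of_subset_of_card_le hsub (by rw [card_rot3 n1 n2 n3]; exact hle)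
  rw [this]
  simp [h2, i2]

theorem Tri.cover_exists (h : Tri P A B C T) (hP : Cfg P A B C) {q : Pt}
    (hg : ∀ a ∈ P, ∀ b ∈ P, a ≠ b → o q a b ≠ 0) (hq : inTri q A B C) :
    ∃ a b c, (a, b, c) ∈ T ∧ inTri q a b c := by
  have hcc := h.cover_count hP.abc hP.hA hP.hB hP.hC hg
  rw [if_pos hq] at hcc
  obtain ⟨⟨a, b, c⟩, ht⟩ := Finset.card_pos.1 (by rw [hcc]; norm_num :
    0 < (T.filter (fun t => inTri q t.1 t.2.1 t.2.2)).card)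
  rw [Finset.mem_filter] at ht
  exact ⟨a, b, c, ht⟩

/-- Edges of a triangulation do not cross. -/
theorem Tri.noncross (hP : Cfg P A B C) (h : Tri P A B C T) {u v w x y z : Pt}
    (h1 : (u, v, w) ∈ T) (h2 : (x, y, z) ∈ T) : ¬ X u v x y := by
  intro hX
  have pu := h.pos _ _ _ h1
  have px := h.pos _ _ _ h2
  obtain ⟨t, s, t0, t1, s0, s1, e1, e2⟩ := cross_pt hX
  -- a direction point
  have hr : ∃ r : Pt, 0 < o r u v ∧ 0 < o r x y := by
    have ha : ∃ a : Pt, 0 < o a u v ∧ o a x y = 0 := by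
      rcases mul_neg_iff.1 hX.1 with ⟨ha, hb⟩ | ⟨ha, hb⟩
      · exact ⟨x, by rwa [o_rot'] , o_self _ _⟩
      · exact ⟨y, by rwa [o_rot'] , by rw [o_rot']; exact o_self' _ _⟩
    have hb : ∃ a : Pt, 0 < o a x y ∧ o a u v = 0 := by
      rcases mul_neg_iff.1 hX.2 with ⟨ha, hb⟩ | ⟨ha, hb⟩
      · exact ⟨u, by rwa [o_rot'] , o_self _ _⟩
      · exact ⟨v, by rwa [o_rot'] , by rw [o_rot']; exact o_self' _ _⟩
    obtain ⟨a, a1, a2⟩ := ha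
    obtain ⟨b, b1, b2⟩ := hb
    refine ⟨((a.1 + b.1) / 2, (a.2 + b.2) / 2), ?_, ?_⟩
    · have : o ((a.1 + b.1) / 2, (a.2 + b.2) / 2) u v = (o a u v + o b u v) / 2 := by unfold o; ring
      rw [this]; linarith
    · have : o ((a.1 + b.1) / 2, (a.2 + b.2) / 2) x y = (o a x y + o b x y) / 2 := by unfold o; ring
      rw [this]; linarith
  obtain ⟨r, r1, r2⟩ := hr
  set m : Pt := (u.1 + t * (v.1 - u.1), u.2 + t * (v.2 - u.2)) with hm
  have hm' : m = (x.1 + s * (y.1 - x.1), x.2 + s * (y.2 - x.2)) := by rw [hm, e1, e2]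
  have m1 : o m u v = 0 := by rw [hm]; unfold o; ring
  have m2 : 0 < o m v w := by
    have : o m v w = (1 - t) * o u v w := by rw [hm]; unfold o; ring
    rw [this]; exact mul_pos (by linarith) pu
  have m3 : 0 < o m w u := by
    have : o m w u = t * o u v w := by rw [hm]; unfold o; ring
    rw [this]; exact mul_pos t0 pu
  have m4 : o m x y = 0 := by rw [hm']; unfold o; ring
  have m5 : 0 < o m y z := by
    have : o m y z = (1 - s) * o x y z := by rw [hm']; unfold o; ring
    rw [this]; exact mul_pos (by linarith) px
  have m6 : 0 < o m z x := by
    have : o m z x = s * o x y z := by rw [hm']; unfold o; ring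
    rw [this]; exact mul_pos s0 px
  let U : Set Pt := {q | (0 < o q u v ∧ 0 < o q v w ∧ 0 < o q w u) ∧ (0 < o q x y ∧ 0 < o q y z ∧ 0 < o q z x)}
  have hop : ∀ a b : Pt, IsOpen {q : Pt | 0 < o q a b} := fun a b =>
    (cont_o a b).isOpen_preimage _ isOpen_Ioi
  have hU : IsOpen U :=
    ((hop u v).inter ((hop v w).inter (hop w u))).inter ((hop x y).inter ((hop y z).inter (hop z x)))
  have hne : U.Nonempty := by
    have hc : Continuous (fun e : ℝ => ((m.1 + e * (r.1 - m.1), m.2 + e * (r.2 - m.2)) : Pt)) := by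
      fun_prop
    have hev : ∀ a b : Pt, 0 < o m a b →
        ∀ᶠ e in nhdsWithin (0:ℝ) (Set.Ioi 0), 0 < o ((m.1 + e * (r.1 - m.1), m.2 + e * (r.2 - m.2)) : Pt) a b := by
      intro a b hab
      apply Filter.Eventually.filter_mono nhdsWithin_le_nhds
      have : Filter.Tendsto (fun e : ℝ => o ((m.1 + e * (r.1 - m.1), m.2 + e * (r.2 - m.2)) : Pt) a b)
          (nhds 0) (nhds (o m a b)) := by
        have := ((cont_o a b).comp hc).tendsto 0
        simpa [Function.comp_def] using this
      exact this.eventually (lt_mem_nhds hab)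
    have hpos : ∀ᶠ e in nhdsWithin (0:ℝ) (Set.Ioi 0), 0 < e := self_mem_nhdsWithin
    obtain ⟨e, ⟨⟨⟨⟨he, h2⟩, h3⟩, h5⟩, h6⟩⟩ :=
      ((((hpos.and (hev _ _ m2)).and (hev _ _ m3)).and (hev _ _ m5)).and (hev _ _ m6)).exists
    refine ⟨_, ⟨?_, h2, h3⟩, ⟨?_, h5, h6⟩⟩
    · have : o ((m.1 + e * (r.1 - m.1), m.2 + e * (r.2 - m.2)) : Pt) u v
          = (1 - e) * o m u v + e * o r u v := by unfold o; ring
      rw [this, m1]; have := mul_pos he r1; linarith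
    · have : o ((m.1 + e * (r.1 - m.1), m.2 + e * (r.2 - m.2)) : Pt) x y
          = (1 - e) * o m x y + e * o r x y := by unfold o; ring
      rw [this, m4]; have := mul_pos he r2; linarith
  obtain ⟨q, hq, hg⟩ := exists_generic' hU hne P
  have hr3 := h.cover_unique hP hg h1 h2 hq.1 hq.2
  have hX1 := hX.1
  rcases mem_rot3.1 hr3 with hh | hh | hh <;>
    simp only [Prod.mk.injEq] at hh <;> obtain ⟨rfl, rfl, rfl⟩ := hh
  · rw [o_self''] at hX1; simp at hX1
  · rw [o_self'] at hX1; simp at hX1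
  · rw [o_self''] at hX1; simp at hX1

end SC

namespace SC
variable {P : Finset Pt} {A B C : Pt} {T : Finset (Pt × Pt × Pt)}

/-- rotation-closed -/
def RC (T : Finset (Pt × Pt × Pt)) : Prop := ∀ a b c, (a, b, c) ∈ T → (b, c, a) ∈ T

theorem RC.iff (h : RC T) {a b c : Pt} : (b, c, a) ∈ T ↔ (a, b, c) ∈ T :=
  ⟨fun hh => h _ _ _ (h _ _ _ hh), fun hh => h _ _ _ hh⟩

theorem RC_rot3 (a b c : Pt) : RC (rot3 a b c) := by
  intro x y z hh
  rw [mem_rot3] at hh ⊢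
  simp only [Prod.mk.injEq] at hh ⊢
  tauto

theorem RC.union {T' : Finset (Pt × Pt × Pt)} (h : RC T) (h' : RC T') : RC (T ∪ T') := by
  intro x y z hh
  rw [Finset.mem_union] at hh ⊢
  exact hh.imp (h _ _ _) (h' _ _ _)

theorem RC.sdiff {T' : Finset (Pt × Pt × Pt)} (h : RC T) (h' : RC T') : RC (T \ T') := by
  intro x y z hh
  rw [Finset.mem_sdiff] at hh ⊢
  exact ⟨h _ _ _ hh.1, fun h2 => hh.2 (h'.iff.1 h2)⟩

theorem RC.disj (h : RC T) {a b c : Pt} (hn : (a, b, c) ∉ T) : Disjoint T (rot3 a b c) := by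
  rw [Finset.disjoint_left]
  intro t ht htr
  rcases mem_rot3.1 htr with rfl | rfl | rfl
  · exact hn ht
  · exact hn (h.iff.1 ht)
  · exact hn (h.iff.1 (h.iff.1 ht))

theorem RC.sub (h : RC T) {a b c : Pt} (hm : (a, b, c) ∈ T) : rot3 a b c ⊆ T := by
  intro t htr
  rcases mem_rot3.1 htr with rfl | rfl | rfl
  · exact hm
  · exact h _ _ _ hm
  · exact h _ _ _ (h _ _ _ hm)

theorem Tri.rc (h : Tri P A B C T) : RC T := h.rot

theorem bd_replace {Old New : Finset (Pt × Pt × Pt)} {f : Pt → Pt → ℤ} (hO : Old ⊆ T)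
    (hN : Disjoint (T \ Old) New)
    (hs : ∑ t ∈ Old, f t.1 t.2.1 = ∑ t ∈ New, f t.1 t.2.1) :
    ∑ t ∈ (T \ Old) ∪ New, f t.1 t.2.1 = ∑ t ∈ T, f t.1 t.2.1 := by
  rw [Finset.sum_union hN, ← hs, Finset.sum_sdiff hO]

/-! ### Flip -/

def flipT (T : Finset (Pt × Pt × Pt)) (u v w z : Pt) : Finset (Pt × Pt × Pt) :=
  (T \ (rot3 u v w ∪ rot3 v u z)) ∪ (rot3 z v w ∪ rot3 w u z)

theorem flip_geo {q u v w z : Pt} (c2 : 0 < o w u z) (hq : inTri q z v w) (h0 : o q u v ≠ 0) :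
    inTri q u v w ∨ inTri q v u z := by
  obtain ⟨q1, q2, q3⟩ := hq
  have hs := o_sum q w u z
  have hp := o_pl q u w z v
  have e1 := o_swap' q w u
  have e2 := o_swap' q z w
  have e3 := o_swap' q u v
  rcases lt_or_gt_of_ne h0 with hlt | hgt
  · right
    refine ⟨by linarith, ?_, q1⟩
    by_contra hcon; push Not at hcon
    have : o q u w < 0 := by linarith
    nlinarith
  · left
    refine ⟨hgt, q2, ?_⟩
    by_contra hcon; push Not at hcon
    have a1 : 0 ≤ o q u w := by linarith
    have a2 : 0 < o q u z := by linarith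
    have := mul_nonneg a1 q1.le
    have := mul_pos a2 q2
    have := mul_pos hgt q3
    linarith

theorem Tri.flip_emp (hP : Cfg P A B C) (h : Tri P A B C T) {u v w z : Pt} (h1 : (u, v, w) ∈ T)
    (h2 : (v, u, z) ∈ T) (c2 : 0 < o w u z) {q : Pt} (hq : q ∈ P) : ¬ inTri q z v w := by
  intro hi
  by_cases hu : q = u
  · subst hu
    have := hi.2.2
    rw [o_swap] at c2; linarith
  by_cases hv : q = v
  · subst hv
    have := hi.1
    rw [o_self''] at this; exact lt_irrefl _ this
  have n1 := (ne_of_o_pos (h.pos _ _ _ h1)).1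
  rcases flip_geo c2 hi (hP.gp _ hq _ (h.mem _ _ _ h1) _ (h.mem2 h1) hu hv n1) with hh | hh
  · exact h.emp _ _ _ h1 q hq hh
  · exact h.emp _ _ _ h2 q hq hh

theorem Tri.flip (hP : Cfg P A B C) (h : Tri P A B C T) {u v w z : Pt} (h1 : (u, v, w) ∈ T)
    (h2 : (v, u, z) ∈ T) (c1 : 0 < o z v w) (c2 : 0 < o w u z) : Tri P A B C (flipT T u v w z) := by
  have p1 := h.pos _ _ _ h1
  have p2 := h.pos _ _ _ h2
  obtain ⟨uv, uw, vw⟩ := ne_of_o_pos p1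
  obtain ⟨_, vz, uz⟩ := ne_of_o_pos p2
  obtain ⟨zv, zw, _⟩ := ne_of_o_pos c1
  have rcO : RC (rot3 u v w ∪ rot3 v u z) := (RC_rot3 _ _ _).union (RC_rot3 _ _ _)
  have nz1 : (z, v, w) ∉ T := by
    intro hh
    exact uz (h.func hP (h.rot _ _ _ h1) (h.rot _ _ _ hh))
  have nz2 : (w, u, z) ∉ T := by
    intro hh
    exact vw (h.func hP (h.rot _ _ _ h2) (h.rot _ _ _ hh))
  refine ⟨?_, ?_, ?_, ?_, ?_⟩
  · intro a b c ht
    unfold flipT at ht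
    simp only [Finset.mem_union, Finset.mem_sdiff, mem_rot3, Prod.mk.injEq] at ht
    rcases ht with ⟨ht, -⟩ | (⟨rfl, -⟩ | ⟨rfl, -⟩ | ⟨rfl, -⟩) | ⟨rfl, -⟩ | ⟨rfl, -⟩ | ⟨rfl, -⟩
    exacts [h.mem _ _ _ ht, h.mem3 h2, h.mem _ _ _ h2, h.mem3 h1, h.mem3 h1, h.mem _ _ _ h1, h.mem3 h2]
  · exact (h.rc.sdiff rcO).union ((RC_rot3 _ _ _).union (RC_rot3 _ _ _))
  · intro a b c ht
    unfold flipT at ht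
    simp only [Finset.mem_union, Finset.mem_sdiff, mem_rot3, Prod.mk.injEq] at ht
    rcases ht with ⟨ht, -⟩ | (⟨rfl, rfl, rfl⟩ | ⟨rfl, rfl, rfl⟩ | ⟨rfl, rfl, rfl⟩) | ⟨rfl, rfl, rfl⟩ | ⟨rfl, rfl, rfl⟩ | ⟨rfl, rfl, rfl⟩
    · exact h.pos _ _ _ ht
    · exact c1
    · rwa [o_rot]
    · rwa [o_rot']
    · exact c2
    · rwa [o_rot]
    · rwa [o_rot']
  · intro a b c ht q hq hi
    unfold flipT at ht
    have k1 := h.flip_emp hP h1 h2 c2 hq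
    have k2 := h.flip_emp hP h2 h1 c1 hq
    simp only [Finset.mem_union, Finset.mem_sdiff, mem_rot3, Prod.mk.injEq] at ht
    rcases ht with ⟨ht, -⟩ | (⟨rfl, rfl, rfl⟩ | ⟨rfl, rfl, rfl⟩ | ⟨rfl, rfl, rfl⟩) | ⟨rfl, rfl, rfl⟩ | ⟨rfl, rfl, rfl⟩ | ⟨rfl, rfl, rfl⟩
    · exact h.emp _ _ _ ht q hq hi
    · exact k1 hi
    · exact k1 ((inTri_rot_iff _ _ _ _).1 hi)
    · exact k1 ((inTri_rot_iff _ _ _ _).1 ((inTri_rot_iff _ _ _ _).1 hi))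
    · exact k2 hi
    · exact k2 ((inTri_rot_iff _ _ _ _).1 hi)
    · exact k2 ((inTri_rot_iff _ _ _ _).1 ((inTri_rot_iff _ _ _ _).1 hi))
  · intro f hf
    rw [← h.bd f hf]
    have d1 : Disjoint (rot3 u v w) (rot3 v u z) := by
      apply (RC_rot3 _ _ _).disj
      simp [mem_rot3, uv, uv.symm, uw, vw, uw.symm, vw.symm]
    have d2 : Disjoint (rot3 z v w) (rot3 w u z) := by
      apply (RC_rot3 _ _ _).disj
      simp [mem_rot3, uv, uv.symm, uw, vw, uw.symm, vw.symm, zw, zw.symm, uz]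
    apply bd_replace
    · exact Finset.union_subset (h.rc.sub h1) (h.rc.sub h2)
    · rw [Finset.disjoint_union_right]
      exact ⟨(h.rc.disj nz1).mono_left Finset.sdiff_subset, (h.rc.disj nz2).mono_left Finset.sdiff_subset⟩
    · rw [Finset.sum_union d1, Finset.sum_union d2, sum_rot3 uv uw vw, sum_rot3 uv.symm vz uz,
        sum_rot3 zv zw vw, sum_rot3 uw.symm zw.symm uz]
      simp only
      have := hf u v
      have := hf w z
      linarith

/-! ### Split and merge -/

def splitT (T : Finset (Pt × Pt × Pt)) (p a b c : Pt) : Finset (Pt × Pt × Pt) :=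
  (T \ rot3 a b c) ∪ (rot3 p a b ∪ (rot3 p b c ∪ rot3 p c a))

theorem bary (q x y z s t : Pt) :
    o x y z * o q s t = o q y z * o x s t + o q z x * o y s t + o q x y * o z s t := by
  unfold o; ring

theorem inTri_sub {q p a b c : Pt} (hp : inTri p a b c) (hq : inTri q p a b) : inTri q a b c := by
  obtain ⟨p1, p2, p3⟩ := hp
  obtain ⟨q1, q2, q3⟩ := hq
  have hs := o_sum p a b c
  refine ⟨q2, ?_, ?_⟩
  · have := bary q p a b b c
    rw [o_self] at this
    have h1 : 0 < o p a b * o q b c := by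
      rw [this]
      have := mul_pos q2 p2
      have := mul_pos q3 (by linarith : 0 < o a b c)
      linarith
    exact (mul_pos_iff_of_pos_left p1).1 h1
  · have := bary q p a b c a
    rw [o_self'' a c, o_rot a b c |> fun h => (by rw [← h] : o a b c = o b c a).symm] at this
    have h1 : 0 < o p a b * o q c a := by
      rw [this]
      have := mul_pos q2 p3
      have := mul_pos q1 (by linarith : 0 < o a b c)
      linarith
    exact (mul_pos_iff_of_pos_left p1).1 h1

theorem split_sum {p a b c : Pt} (pa : p ≠ a) (pb : p ≠ b) (pc : p ≠ c) (ab : a ≠ b) (ac : a ≠ c)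
    (bc : b ≠ c) {f : Pt → Pt → ℤ} (hf : ∀ x y, f y x = - f x y) :
    ∑ t ∈ rot3 a b c, f t.1 t.2.1 = ∑ t ∈ rot3 p a b ∪ (rot3 p b c ∪ rot3 p c a), f t.1 t.2.1 := by
  have d2 : Disjoint (rot3 p b c) (rot3 p c a) := by
    apply (RC_rot3 _ _ _).disj
    simp [mem_rot3, pa, pb, pc, ab, ac, bc, bc.symm]
  have d1 : Disjoint (rot3 p a b) (rot3 p b c ∪ rot3 p c a) := by
    rw [Finset.disjoint_union_right]
    constructor
    · apply (RC_rot3 _ _ _).disj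
      simp [mem_rot3, pa, pb, pc, ab, ac, bc, bc.symm, ab.symm]
    · apply (RC_rot3 _ _ _).disj
      simp [mem_rot3, pa, pb, pc, ab, ac, bc, bc.symm, ac.symm]
  rw [Finset.sum_union d1, Finset.sum_union d2, sum_rot3 ab ac bc, sum_rot3 pa pb ab, sum_rot3 pb pc bc,
    sum_rot3 pc pa ac.symm]
  simp only
  have := hf p a
  have := hf p b
  have := hf p c
  linarith

theorem Cfg.erase (hP : Cfg P A B C) {p : Pt} (h1 : p ≠ A) (h2 : p ≠ B) (h3 : p ≠ C) :
    Cfg (P.erase p) A B C := by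
  refine ⟨?_, ?_, ?_, hP.abc, ?_, ?_⟩
  · exact Finset.mem_erase.2 ⟨h1.symm, hP.hA⟩
  · exact Finset.mem_erase.2 ⟨h2.symm, hP.hB⟩
  · exact Finset.mem_erase.2 ⟨h3.symm, hP.hC⟩
  · intro a ha b hb c hc
    exact hP.gp a (Finset.mem_of_mem_erase ha) b (Finset.mem_of_mem_erase hb) c (Finset.mem_of_mem_erase hc)
  · intro q hq
    exact hP.ins q (Finset.mem_of_mem_erase hq)

theorem Cfg.gen (hP : Cfg P A B C) {p : Pt} (hp : p ∈ P) :
    ∀ a ∈ P.erase p, ∀ b ∈ P.erase p, a ≠ b → o p a b ≠ 0 := by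
  intro a ha b hb hab
  exact hP.gp p hp a (Finset.mem_of_mem_erase ha) b (Finset.mem_of_mem_erase hb)
    (Finset.ne_of_mem_erase ha).symm (Finset.ne_of_mem_erase hb).symm hab

theorem Tri.notp {p : Pt} (h : Tri (P.erase p) A B C T) {a b c : Pt} (ht : (a, b, c) ∈ T) :
    p ≠ a ∧ p ≠ b ∧ p ≠ c :=
  ⟨(Finset.ne_of_mem_erase (h.mem _ _ _ ht)).symm, (Finset.ne_of_mem_erase (h.mem2 ht)).symm,
    (Finset.ne_of_mem_erase (h.mem3 ht)).symm⟩

theorem Tri.split (hP : Cfg P A B C) {p : Pt} (hp : p ∈ P) (n1 : p ≠ A) (n2 : p ≠ B) (n3 : p ≠ C)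
    (h : Tri (P.erase p) A B C T) {a b c : Pt} (ht : (a, b, c) ∈ T) (hi : inTri p a b c) :
    Tri P A B C (splitT T p a b c) := by
  have hP' := hP.erase n1 n2 n3
  obtain ⟨pa, pb, pc⟩ := h.notp ht
  obtain ⟨ab, ac, bc⟩ := ne_of_o_pos (h.pos _ _ _ ht)
  have ma := Finset.mem_of_mem_erase (h.mem _ _ _ ht)
  have mb := Finset.mem_of_mem_erase (h.mem2 ht)
  have mc := Finset.mem_of_mem_erase (h.mem3 ht)
  have npT : ∀ x y, (p, x, y) ∉ T := fun x y hh => (h.notp hh).1 rfl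
  have hem : ∀ x y z, inTri p x y z → (x, y, z) ∈ T → ∀ q ∈ P, ¬ inTri q p x y := by
    intro x y z hi' ht' q hq hiq
    by_cases hqp : q = p
    · subst hqp; have := hiq.1; rw [o_self] at this; exact lt_irrefl _ this
    · exact h.emp _ _ _ ht' q (Finset.mem_erase.2 ⟨hqp, hq⟩) (inTri_sub hi' hiq)
  have e1 := hem _ _ _ hi ht
  have e2 := hem _ _ _ (inTri_rot hi) (h.rot _ _ _ ht)
  have e3 := hem _ _ _ (inTri_rot (inTri_rot hi)) (h.rot2 ht)
  refine ⟨?_, ?_, ?_, ?_, ?_⟩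
  · intro x y z hx
    unfold splitT at hx
    simp only [Finset.mem_union, Finset.mem_sdiff, mem_rot3, Prod.mk.injEq] at hx
    rcases hx with ⟨hx, -⟩ | (⟨rfl, -⟩ | ⟨rfl, -⟩ | ⟨rfl, -⟩) | (⟨rfl, -⟩ | ⟨rfl, -⟩ | ⟨rfl, -⟩) | ⟨rfl, -⟩ | ⟨rfl, -⟩ | ⟨rfl, -⟩
    · exact Finset.mem_of_mem_erase (h.mem _ _ _ hx)
    all_goals assumption
  · exact (h.rc.sdiff (RC_rot3 _ _ _)).union ((RC_rot3 _ _ _).union ((RC_rot3 _ _ _).union (RC_rot3 _ _ _)))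
  · obtain ⟨i1, i2, i3⟩ := hi
    intro x y z hx
    unfold splitT at hx
    simp only [Finset.mem_union, Finset.mem_sdiff, mem_rot3, Prod.mk.injEq] at hx
    rcases hx with ⟨hx, -⟩ | (⟨rfl, rfl, rfl⟩ | ⟨rfl, rfl, rfl⟩ | ⟨rfl, rfl, rfl⟩) | (⟨rfl, rfl, rfl⟩ | ⟨rfl, rfl, rfl⟩ | ⟨rfl, rfl, rfl⟩) | ⟨rfl, rfl, rfl⟩ | ⟨rfl, rfl, rfl⟩ | ⟨rfl, rfl, rfl⟩
    · exact h.pos _ _ _ hx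
    all_goals first | assumption | (rw [o_rot]; assumption) | (rw [o_rot']; assumption)
  · intro x y z hx q hq hin
    have hin2 := inTri_rot hin
    have hin3 := inTri_rot hin2
    unfold splitT at hx
    simp only [Finset.mem_union, Finset.mem_sdiff] at hx
    rcases hx with ⟨hx, hx'⟩ | hx
    · by_cases hqp : q = p
      · subst hqp
        exact hx' (h.cover_unique hP' (hP.gen hp) ht hx hi hin)
      · exact h.emp _ _ _ hx q (Finset.mem_erase.2 ⟨hqp, hq⟩) hin
    · simp only [mem_rot3, Prod.mk.injEq] at hx
      rcases hx with (⟨rfl, rfl, rfl⟩ | ⟨rfl, rfl, rfl⟩ | ⟨rfl, rfl, rfl⟩) | (⟨rfl, rfl, rfl⟩ | ⟨rfl, rfl, rfl⟩ | ⟨rfl, rfl, rfl⟩) | ⟨rfl, rfl, rfl⟩ | ⟨rfl, rfl, rfl⟩ | ⟨rfl, rfl, rfl⟩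
      · exact e1 q hq hin
      · exact e1 q hq hin3
      · exact e1 q hq hin2
      · exact e2 q hq hin
      · exact e2 q hq hin3
      · exact e2 q hq hin2
      · exact e3 q hq hin
      · exact e3 q hq hin3
      · exact e3 q hq hin2
  · intro f hf
    rw [← h.bd f hf]
    apply bd_replace (h.rc.sub ht)
    · have hd : ∀ x y, Disjoint (T \ rot3 a b c) (rot3 p x y) := fun x y =>
        (h.rc.disj (npT x y)).mono_left Finset.sdiff_subset
      rw [Finset.disjoint_union_right, Finset.disjoint_union_right]
      exact ⟨hd _ _, hd _ _, hd _ _⟩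
    · exact split_sum pa pb pc ab ac bc hf

def mergeT (T : Finset (Pt × Pt × Pt)) (p a b c : Pt) : Finset (Pt × Pt × Pt) :=
  (T \ (rot3 p a b ∪ (rot3 p b c ∪ rot3 p c a))) ∪ rot3 a b c

theorem inTri_cases {q p a b c : Pt} (hi : inTri q a b c) (ha : o q p a ≠ 0) (hb : o q p b ≠ 0)
    (hc : o q p c ≠ 0) : inTri q p a b ∨ inTri q p b c ∨ inTri q p c a := by
  obtain ⟨i1, i2, i3⟩ := hi
  have hp := o_pl q p a b c
  have ea := o_swap' q p a
  have eb := o_swap' q p b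
  have ec := o_swap' q p c
  unfold inTri
  rcases lt_or_gt_of_ne ha with a1 | a1 <;> rcases lt_or_gt_of_ne hb with b1 | b1 <;>
    rcases lt_or_gt_of_ne hc with c1 | c1
  · nlinarith
  · right; right; exact ⟨c1, i3, by linarith⟩
  · right; left; exact ⟨b1, i2, by linarith⟩
  · right; right; exact ⟨c1, i3, by linarith⟩
  · left; exact ⟨a1, i1, by linarith⟩
  · left; exact ⟨a1, i1, by linarith⟩
  · right; left; exact ⟨b1, i2, by linarith⟩
  · nlinarith [mul_pos a1 i2, mul_pos b1 i3, mul_pos c1 i1]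

theorem Tri.merge (hP : Cfg P A B C) {p : Pt}
    (h : Tri P A B C T) {a b c : Pt} (h1 : (p, a, b) ∈ T) (h2 : (p, b, c) ∈ T) (h3 : (p, c, a) ∈ T)
    (honly : ∀ x y, (p, x, y) ∈ T → (x = a ∧ y = b) ∨ (x = b ∧ y = c) ∨ (x = c ∧ y = a))
    : Tri (P.erase p) A B C (mergeT T p a b c) := by
  have q1 := h.pos _ _ _ h1
  have q2 := h.pos _ _ _ h2
  have q3 := h.pos _ _ _ h3
  obtain ⟨pa, pb, ab⟩ := ne_of_o_pos q1
  obtain ⟨_, pc, bc⟩ := ne_of_o_pos q2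
  obtain ⟨_, _, ca⟩ := ne_of_o_pos q3
  have hpos : 0 < o a b c := by rw [← o_sum p a b c]; linarith
  have nabc : (a, b, c) ∉ T := by
    intro hh; exact pc (h.func hP (h.rot _ _ _ h1) hh)
  have ma := Finset.mem_erase.2 ⟨pa.symm, h.mem2 h1⟩
  have mb := Finset.mem_erase.2 ⟨pb.symm, h.mem2 h2⟩
  have mc := Finset.mem_erase.2 ⟨pc.symm, h.mem2 h3⟩
  have he : ∀ q ∈ P.erase p, ¬ inTri q a b c := by
    intro q hq hi
    have hqP := Finset.mem_of_mem_erase hq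
    have hqp := Finset.ne_of_mem_erase hq
    have na := (ne_of_o_pos hi.1).1
    have nb := (ne_of_o_pos hi.2.1).1
    have nc := (ne_of_o_pos hi.2.2).1
    have mp := h.mem _ _ _ h1
    rcases inTri_cases hi (hP.gp q hqP p mp a (h.mem2 h1) hqp na pa)
      (hP.gp q hqP p mp b (h.mem2 h2) hqp nb pb) (hP.gp q hqP p mp c (h.mem2 h3) hqp nc pc) with hh | hh | hh
    · exact h.emp _ _ _ h1 q hqP hh
    · exact h.emp _ _ _ h2 q hqP hh
    · exact h.emp _ _ _ h3 q hqP hh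
  refine ⟨?_, ?_, ?_, ?_, ?_⟩
  · intro x y z hx
    unfold mergeT at hx
    rw [Finset.mem_union, Finset.mem_sdiff] at hx
    rcases hx with ⟨hx, hn⟩ | hx
    · refine Finset.mem_erase.2 ⟨?_, h.mem _ _ _ hx⟩
      rintro rfl
      apply hn
      rcases honly _ _ hx with ⟨rfl, rfl⟩ | ⟨rfl, rfl⟩ | ⟨rfl, rfl⟩ <;> simp [mem_rot3]
    · simp only [mem_rot3, Prod.mk.injEq] at hx
      rcases hx with ⟨rfl, -⟩ | ⟨rfl, -⟩ | ⟨rfl, -⟩ <;> assumption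
  · exact (h.rc.sdiff ((RC_rot3 _ _ _).union ((RC_rot3 _ _ _).union (RC_rot3 _ _ _)))).union (RC_rot3 _ _ _)
  · intro x y z hx
    unfold mergeT at hx
    rw [Finset.mem_union, Finset.mem_sdiff] at hx
    rcases hx with ⟨hx, hn⟩ | hx
    · exact h.pos _ _ _ hx
    · simp only [mem_rot3, Prod.mk.injEq] at hx
      rcases hx with ⟨rfl, rfl, rfl⟩ | ⟨rfl, rfl, rfl⟩ | ⟨rfl, rfl, rfl⟩
      · exact hpos
      · rwa [o_rot]
      · rwa [o_rot']
  · intro x y z hx q hq hin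
    have hin2 := inTri_rot hin
    have hin3 := inTri_rot hin2
    unfold mergeT at hx
    rw [Finset.mem_union, Finset.mem_sdiff] at hx
    rcases hx with ⟨hx, hn⟩ | hx
    · exact h.emp _ _ _ hx q (Finset.mem_of_mem_erase hq) hin
    · simp only [mem_rot3, Prod.mk.injEq] at hx
      rcases hx with ⟨rfl, rfl, rfl⟩ | ⟨rfl, rfl, rfl⟩ | ⟨rfl, rfl, rfl⟩
      · exact he q hq hin
      · exact he q hq hin3
      · exact he q hq hin2
  · intro f hf
    rw [← h.bd f hf]
    apply bd_replace
    · exact Finset.union_subset (h.rc.sub h1) (Finset.union_subset (h.rc.sub h2) (h.rc.sub h3))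
    · exact (h.rc.disj nabc).mono_left Finset.sdiff_subset
    · exact (split_sum pa pb pc ab ca.symm bc hf).symm

end SC

namespace SC
variable {P : Finset Pt} {A B C : Pt} {T : Finset (Pt × Pt × Pt)}

/-- interior point -/
structure Inn (P : Finset Pt) (A B C p : Pt) : Prop where
  mem : p ∈ P
  nA : p ≠ A
  nB : p ≠ B
  nC : p ≠ C

variable {p : Pt}

theorem Tri.next (hP : Cfg P A B C) (h : Tri P A B C T) (hp : Inn P A B C p) {x y : Pt}
    (h1 : (p, x, y) ∈ T) : ∃ z, (p, y, z) ∈ T :=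
  h.twin_right hP (h.rot2 h1) hp.nA hp.nB hp.nC

theorem Tri.prev (hP : Cfg P A B C) (h : Tri P A B C T) (hp : Inn P A B C p) {x y : Pt}
    (h1 : (p, x, y) ∈ T) : ∃ z, (p, z, x) ∈ T := by
  obtain ⟨z, hz⟩ := h.twin_left hP h1 hp.nA hp.nB hp.nC
  exact ⟨z, h.rot _ _ _ hz⟩

theorem Tri.next_unique (hP : Cfg P A B C) (h : Tri P A B C T) {x y y' : Pt}
    (h1 : (p, x, y) ∈ T) (h2 : (p, x, y') ∈ T) : y = y' := h.func hP h1 h2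

theorem Tri.prev_unique (hP : Cfg P A B C) (h : Tri P A B C T) {x x' y : Pt}
    (h1 : (p, x, y) ∈ T) (h2 : (p, x', y) ∈ T) : x = x' := h.func hP (h.rot2 h1) (h.rot2 h2)

theorem Tri.cone (hP : Cfg P A B C) (h : Tri P A B C T) (hp : Inn P A B C p) {u v x y : Pt}
    (h1 : (p, u, v) ∈ T) (h2 : (p, x, y) ∈ T) (c1 : 0 < o p u x) (c2 : 0 < o p x v) : False := by
  obtain ⟨z, hz⟩ := h.prev hP hp h2
  have hx : x - p ≠ 0 := sub_ne_zero.2 (ne_of_o_pos c2).1.symm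
  have := h.vc_unique hP hx h1 hz (by rw [sd_sub, o_swap']; linarith) (by rw [sd_sub]; exact c2.le)
    (by rw [sd_sub, o_swap']; linarith [h.pos _ _ _ hz]) (by rw [sd_sub, o_self'])
  rw [this.2, o_self'] at c2
  exact lt_irrefl _ c2

/-- Other link vertices lie opposite to a wide vertex. -/
theorem Tri.wide_other (hP : Cfg P A B C) (h : Tri P A B C T) (hp : Inn P A B C p) {u v w x y : Pt}
    (h1 : (p, u, v) ∈ T) (h2 : (p, v, w) ∈ T) (hw : o p u w < 0) (h3 : (p, x, y) ∈ T)
    (xu : x ≠ u) (xv : x ≠ v) (xw : x ≠ w) : 0 < o p w x ∧ 0 < o p x u := by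
  have mp := hp.mem
  have pv := (ne_of_o_pos (h.pos _ _ _ h1))
  have pw := (ne_of_o_pos (h.pos _ _ _ h2))
  have px := (ne_of_o_pos (h.pos _ _ _ h3))
  have mx := h.mem2 h3
  have mu := h.mem2 h1
  have mv := h.mem2 h2
  have mw := h.mem3 h2
  have nvx : o p v x ≠ 0 := hP.gp _ mp _ mv _ mx pw.1 px.1 xv.symm
  have nwx : o p w x ≠ 0 := hP.gp _ mp _ mw _ mx pw.2.1 px.1 xw.symm
  have nxu : o p x u ≠ 0 := hP.gp _ mp _ mx _ mu px.1 pv.1 xu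
  have id := o_pl p v w x u
  have a1 := h.pos _ _ _ h1
  have a2 := h.pos _ _ _ h2
  rw [o_swap' p u v] at id
  rcases lt_or_gt_of_ne nvx with hv | hv
  · have e1 : 0 < o p x u := by
      by_contra hc
      refine h.cone hP hp h1 h3 ?_ ?_
      · rw [o_swap']; have := lt_of_le_of_ne (not_lt.1 hc) nxu; linarith
      · rw [o_swap']; linarith
    refine ⟨?_, e1⟩
    by_contra hc
    have := lt_of_le_of_ne (not_lt.1 hc) nwx
    nlinarith [mul_pos a2 e1, mul_pos_of_neg_of_neg hv hw, mul_pos_of_neg_of_neg (neg_lt_zero.2 a1) this]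
  · have e1 : 0 < o p w x := by
      by_contra hc
      refine h.cone hP hp h2 h3 hv ?_
      rw [o_swap']; have := lt_of_le_of_ne (not_lt.1 hc) nwx; linarith
    refine ⟨e1, ?_⟩
    by_contra hc
    have := lt_of_le_of_ne (not_lt.1 hc) nxu
    nlinarith [mul_pos a2 (neg_pos.2 this), mul_pos hv (neg_pos.2 hw), mul_pos a1 e1]

/-- edges of the link -/
def link (T : Finset (Pt × Pt × Pt)) (p : Pt) : Finset (Pt × Pt) :=
  (T.filter (fun t => t.1 = p)).image Prod.snd

theorem mem_link {x y : Pt} : (x, y) ∈ link T p ↔ (p, x, y) ∈ T := by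
  unfold link
  simp only [Finset.mem_image, Finset.mem_filter]
  constructor
  · rintro ⟨⟨a, t⟩, ⟨h1, rfl⟩, rfl⟩
    exact h1
  · intro h; exact ⟨(p, x, y), ⟨h, rfl⟩, rfl⟩

theorem card_link : (link T p).card = (T.filter (fun t => t.1 = p)).card := by
  unfold link
  apply Finset.card_image_of_injOn
  rintro ⟨a, b⟩ h ⟨c, d⟩ h' e
  simp only [Finset.coe_filter, Set.mem_setOf_eq] at h h'
  simp only at e
  rw [Prod.mk.injEq]; exact ⟨h.2.trans h'.2.symm, e⟩

/-- 3-cycle link -/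
def root (T : Finset (Pt × Pt × Pt)) (p a b c : Pt) : Prop :=
  (p, a, b) ∈ T ∧ (p, b, c) ∈ T ∧ (p, c, a) ∈ T

theorem root.rot {a b c : Pt} (h : root T p a b c) : root T p b c a := ⟨h.2.1, h.2.2, h.1⟩

theorem root.pos (h : Tri P A B C T) {a b c : Pt} (hr : root T p a b c) : 0 < o a b c := by
  rw [← o_sum p]
  have := h.pos _ _ _ hr.1
  have := h.pos _ _ _ hr.2.1
  have := h.pos _ _ _ hr.2.2
  linarith

/-- if the link contains a 3-cycle then it is this 3-cycle -/
theorem root.only (hP : Cfg P A B C) (h : Tri P A B C T) (hp : Inn P A B C p) {a b c x y : Pt}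
    (hr : root T p a b c) (hx : (p, x, y) ∈ T) : x = a ∨ x = b ∨ x = c := by
  by_contra hcon
  push Not at hcon
  have hw : o p a c < 0 := by rw [o_swap']; linarith [h.pos _ _ _ hr.2.2]
  have := h.wide_other hP hp hr.1 hr.2.1 hw hx hcon.1 hcon.2.1 hcon.2.2
  exact h.cone hP hp hr.2.2 hx this.1 this.2

theorem root.link_eq (hP : Cfg P A B C) (h : Tri P A B C T) (hp : Inn P A B C p) {a b c : Pt}
    (hr : root T p a b c) : link T p = {(a, b), (b, c), (c, a)} := by
  ext ⟨x, y⟩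
  rw [mem_link]
  simp only [Finset.mem_insert, Finset.mem_singleton, Prod.mk.injEq]
  constructor
  · intro hx
    rcases hr.only hP h hp hx with rfl | rfl | rfl
    · exact Or.inl ⟨rfl, h.next_unique hP hx hr.1⟩
    · exact Or.inr (Or.inl ⟨rfl, h.next_unique hP hx hr.2.1⟩)
    · exact Or.inr (Or.inr ⟨rfl, h.next_unique hP hx hr.2.2⟩)
  · rintro (⟨rfl, rfl⟩ | ⟨rfl, rfl⟩ | ⟨rfl, rfl⟩)
    exacts [hr.1, hr.2.1, hr.2.2]

theorem root.card (hP : Cfg P A B C) (h : Tri P A B C T) (hp : Inn P A B C p) {a b c : Pt}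
    (hr : root T p a b c) : (link T p).card = 3 := by
  rw [hr.link_eq hP h hp]
  have := ne_of_o_pos (hr.pos h)
  rw [Finset.card_insert_of_notMem, Finset.card_insert_of_notMem, Finset.card_singleton]
  · simp [this.2.2]
  · simp [this.1, this.2.1]

/-- the link edges ending where we look -/
theorem Tri.nn (h : Tri P A B C T) {x y z : Pt}
    (h1 : (p, x, y) ∈ T) (h2 : (p, y, z) ∈ T) : z ≠ x := by
  rintro rfl
  have a := h.pos _ _ _ h1
  have b := h.pos _ _ _ h2
  rw [o_swap'] at b; linarith

/-- an ear of the link -/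
structure Ear (T : Finset (Pt × Pt × Pt)) (p u v w : Pt) : Prop where
  h1 : (p, u, v) ∈ T
  h2 : (p, v, w) ∈ T
  c1 : 0 < o u v w
  c2 : 0 < o p u w

theorem Tri.ne_of_link (h : Tri P A B C T) {x y : Pt} (h1 : (p, x, y) ∈ T) : p ≠ x ∧ p ≠ y ∧ x ≠ y :=
  ne_of_o_pos (h.pos _ _ _ h1)

theorem Tri.link_nonempty (hP : Cfg P A B C) (h : Tri P A B C T) (hp : Inn P A B C p) :
    ∃ x y, (p, x, y) ∈ T := by
  obtain ⟨x, y, h1, _⟩ := h.vc_exists hP (d := ((1 : ℝ), (0 : ℝ))) (by simp) hp.mem hp.nA hp.nB hp.nC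
  exact ⟨x, y, h1⟩

/-- there is a link edge containing all wide vertices unless the link is a triangle -/
theorem Tri.wide_edge (hP : Cfg P A B C) (h : Tri P A B C T) (hp : Inn P A B C p)
    (hr : ∀ a b c, ¬ root T p a b c) :
    ∃ a b, (p, a, b) ∈ T ∧ ∀ u v w, (p, u, v) ∈ T → (p, v, w) ∈ T → v ≠ a → v ≠ b → 0 < o p u w := by
  have nz : ∀ u v w, (p, u, v) ∈ T → (p, v, w) ∈ T → o p u w ≠ 0 := by
    intro u v w h1 h2
    exact hP.gp _ hp.mem _ (h.mem2 h1) _ (h.mem3 h2) (h.ne_of_link h1).1 (h.ne_of_link h2).2.1 (h.nn h1 h2).symm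
  by_cases hw : ∃ u v w, (p, u, v) ∈ T ∧ (p, v, w) ∈ T ∧ o p u w < 0
  swap
  · push Not at hw
    obtain ⟨x, y, h1⟩ := h.link_nonempty hP hp
    exact ⟨x, y, h1, fun u v w a b _ _ => lt_of_le_of_ne (hw u v w a b) (nz u v w a b).symm⟩
  obtain ⟨u, v, w, h1, h2, hw⟩ := hw
  have key : ∀ y x z, (p, y, x) ∈ T → (p, x, z) ∈ T → x ≠ u → x ≠ v → x ≠ w → 0 < o p y z := by
    intro y x z a b xu xv xw
    by_contra hc
    have hc' := lt_of_le_of_ne (not_lt.1 hc) (nz _ _ _ a b)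
    obtain ⟨k1, k2⟩ := h.wide_other hP hp h1 h2 hw b xu xv xw
    have hwu : 0 < o p w u := by rw [o_swap']; linarith
    have ey : 0 ≤ o p w y := by
      by_cases yw : y = w
      · rw [yw, o_self']
      · have yu : y ≠ u := by rintro rfl; exact xv (h.next_unique hP a h1)
        have yv : y ≠ v := by rintro rfl; exact xw (h.next_unique hP a h2)
        exact (h.wide_other hP hp h1 h2 hw a yu yv yw).1.le
    have ez : 0 < o p w z := by
      by_cases zu : z = u
      · rw [zu]; exact hwu
      · have zw : z ≠ w := by rintro rfl; exact xv (h.prev_unique hP b h2)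
        have zv : z ≠ v := by rintro rfl; exact xu (h.prev_unique hP b h1)
        obtain ⟨z', hz'⟩ := h.next hP hp b
        exact (h.wide_other hP hp h1 h2 hw hz' zu zv zw).1
    have id := o_pl p w y x z
    have a' := h.pos _ _ _ a
    have b' := h.pos _ _ _ b
    have e3 : 0 < o p z y := by rw [o_swap']; linarith
    nlinarith [mul_nonneg ey b'.le, mul_pos k1 e3, mul_pos ez a']
  obtain ⟨y, hy⟩ := h.prev hP hp h1
  obtain ⟨x, hx⟩ := h.next hP hp h2
  by_cases wu : 0 < o p y v
  · refine ⟨v, w, h2, fun a b c hab hbc b1 b2 => ?_⟩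
    by_cases bu : b = u
    · subst bu
      rw [h.prev_unique hP hab hy, h.next_unique hP hbc h1]; exact wu
    · exact key a b c hab hbc bu b1 b2
  · have wu' := lt_of_le_of_ne (not_lt.1 wu) (nz _ _ _ hy h1)
    refine ⟨u, v, h1, fun a b c hab hbc b1 b2 => ?_⟩
    by_cases bw : b = w
    · subst bw
      rw [h.prev_unique hP hab h2, h.next_unique hP hbc hx]
      by_contra hc
      have hc' := lt_of_le_of_ne (not_lt.1 hc) (nz _ _ _ h2 hx)
      by_cases yx : y = x
      · subst yx
        rw [o_swap'] at hc'; linarith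
      · have yb : y ≠ b := by
          rintro rfl
          exact hr u v y ⟨h1, h2, hy⟩
        have yv : y ≠ v := by
          rintro rfl
          exact (h.nn hy h1) rfl
        have := (h.wide_other hP hp h2 hx hc' hy yv yb yx).2
        linarith
    · exact key a b c hab hbc b1 b2 bw

theorem Tri.ear_exists (hP : Cfg P A B C) (h : Tri P A B C T) (hp : Inn P A B C p)
    (hr : ∀ a b c, ¬ root T p a b c) : ∃ u v w, Ear T p u v w := by
  obtain ⟨a, b, hab, hw⟩ := h.wide_edge hP hp hr
  obtain ⟨q, y, hq, sq, _⟩ := h.vc_exists hP (d := a - b) (sub_ne_zero.2 (h.ne_of_link hab).2.2) hp.mem hp.nA hp.nB hp.nC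
  obtain ⟨⟨v, w⟩, hm, hmax⟩ := Finset.exists_max_image (link T p) (fun e => o a b e.1) ⟨(q, y), mem_link.2 hq⟩
  rw [mem_link] at hm
  obtain ⟨u, hu⟩ := h.prev hP hp hm
  have e1 : o a b v > o a b p := by
    have := hmax (q, y) (mem_link.2 hq)
    simp only at this
    have e : sd (a - b) p q = o a b p - o a b q := by unfold sd o; simp; ring
    linarith
  have e2 : o a b u ≤ o a b v := hmax (u, v) (mem_link.2 hu)
  obtain ⟨w', hw'⟩ := h.next hP hp hm
  have e3 : o a b w ≤ o a b v := hmax (w, w') (mem_link.2 hw')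
  have e0 : 0 < o a b p := by have := h.pos _ _ _ hab; rwa [← o_rot] at this
  have va : v ≠ a := by rintro rfl; rw [o_self''] at e1; linarith
  have vb : v ≠ b := by rintro rfl; rw [o_self'] at e1; linarith
  have c2 := hw u v w hu hm va vb
  have c1' : o u v w ≠ 0 := hP.gp _ (h.mem2 hu) _ (h.mem2 hm) _ (h.mem3 hm) (h.ne_of_link hu).2.2 (h.nn hu hm).symm
    (h.ne_of_link hm).2.2
  refine ⟨u, v, w, hu, hm, ?_, c2⟩
  by_contra hc
  have hc' := lt_of_le_of_ne (not_lt.1 hc) c1'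
  have p1 := h.pos _ _ _ hu
  have p2 := h.pos _ _ _ hm
  -- (φ v - φ p) o(p,u,w) = (φ u - φ p) o(p,v,w) + (φ w - φ p) o(p,u,v)
  have id : (o a b v - o a b p) * o p u w = (o a b u - o a b p) * o p v w + (o a b w - o a b p) * o p u v := by
    unfold o; ring
  have id2 : o u v w = o p u v + o p v w - o p u w := by unfold o; ring
  nlinarith [mul_nonneg (sub_nonneg.2 e2) p2.le, mul_nonneg (sub_nonneg.2 e3) p1.le, mul_pos (sub_pos.2 e1) (neg_pos.2 hc')]

theorem Tri.card_link_of_not_root (hP : Cfg P A B C) (h : Tri P A B C T) (hp : Inn P A B C p)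
    (hr : ∀ a b c, ¬ root T p a b c) : 4 ≤ (link T p).card := by
  obtain ⟨x, y, h1⟩ := h.link_nonempty hP hp
  obtain ⟨z, h2⟩ := h.next hP hp h1
  obtain ⟨w, h3⟩ := h.next hP hp h2
  have hwx : w ≠ x := by rintro rfl; exact hr _ _ _ ⟨h1, h2, h3⟩
  obtain ⟨r, h4⟩ := h.next hP hp h3
  have n1 := h.ne_of_link h1
  have n2 := h.ne_of_link h2
  have n3 := h.ne_of_link h3
  have m1 := h.nn h1 h2
  have m2 := h.nn h2 h3
  have : ({(x, y), (y, z), (z, w), (w, r)} : Finset (Pt × Pt)) ⊆ link T p := by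
    intro e he
    simp only [Finset.mem_insert, Finset.mem_singleton] at he
    rcases he with rfl | rfl | rfl | rfl <;> rw [mem_link] <;> assumption
  refine le_trans (le_of_eq ?_) (Finset.card_le_card this)
  rw [Finset.card_insert_of_notMem, Finset.card_insert_of_notMem, Finset.card_insert_of_notMem, Finset.card_singleton]
  · simp [n3.2.2]
  · simp [n2.2.2, m2.symm]
  · simp [n1.2.2, m1.symm, hwx.symm]

theorem Tri.root_of_card (hP : Cfg P A B C) (h : Tri P A B C T) (hp : Inn P A B C p)
    (hc : (link T p).card ≤ 3) : ∃ a b c, root T p a b c := by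
  by_contra hcon
  push Not at hcon
  have := h.card_link_of_not_root hP hp hcon
  omega

theorem Tri.card_link_ge (hP : Cfg P A B C) (h : Tri P A B C T) (hp : Inn P A B C p) :
    3 ≤ (link T p).card := by
  by_contra hcon
  obtain ⟨a, b, c, hr⟩ := h.root_of_card hP hp (by omega)
  have := hr.card hP h hp
  omega

theorem Ear.not_root (h : Tri P A B C T) (hP : Cfg P A B C) {u v w : Pt} (he : Ear T p u v w)
    (a b c : Pt) (hp : Inn P A B C p) : ¬ root T p a b c := by
  have key : ∀ a b c, root T p a b c → v = b → False := by
    rintro a b c hr rfl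
    have e1 := h.prev_unique hP he.h1 hr.1
    have e2 := h.next_unique hP he.h2 hr.2.1
    have := he.c2
    rw [e1, e2, o_swap'] at this
    linarith [h.pos _ _ _ hr.2.2]
  intro hr
  rcases hr.only hP h hp he.h2 with e | e | e
  · exact key _ _ _ hr.rot.rot e
  · exact key _ _ _ hr e
  · exact key _ _ _ hr.rot e

end SC

namespace SC
variable {P : Finset Pt} {A B C : Pt} {T : Finset (Pt × Pt × Pt)} {p : Pt}

theorem flipT_symm (T : Finset (Pt × Pt × Pt)) (u v w z : Pt) : flipT T u v w z = flipT T v u z w := by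
  unfold flipT
  rw [Finset.union_comm (rot3 u v w), Finset.union_comm (rot3 z v w)]

theorem rot3_rot (a b c : Pt) : rot3 b c a = rot3 a b c := by
  ext t; rw [mem_rot3, mem_rot3]; tauto

theorem flipT_invol (h : RC T) {u v w z : Pt} (h1 : (u, v, w) ∈ T) (h2 : (v, u, z) ∈ T)
    (n1 : (z, v, w) ∉ T) (n2 : (w, u, z) ∉ T) : flipT (flipT T u v w z) w z v u = T := by
  have s1 := h.sub h1
  have s2 := h.sub h2
  have d1 := h.disj n1
  have d2 := h.disj n2
  unfold flipT
  rw [← rot3_rot w z v, ← rot3_rot z w u,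
    show rot3 u z v = rot3 v u z from (rot3_rot v u z), show rot3 v w u = rot3 u v w from (rot3_rot u v w)]
  rw [Finset.union_comm (rot3 v u z)]
  ext t
  have e1 : t ∈ T → t ∉ rot3 z v w := fun ht => Finset.disjoint_left.1 d1 ht
  have e2 : t ∈ T → t ∉ rot3 w u z := fun ht => Finset.disjoint_left.1 d2 ht
  have i1 := @s1 t
  have i2 := @s2 t
  simp only [Finset.mem_union, Finset.mem_sdiff]
  tauto

/-- remove an ear -/
def earT (T : Finset (Pt × Pt × Pt)) (p u v w : Pt) : Finset (Pt × Pt × Pt) := flipT T p v w u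
/-- insert an outer triangle -/
def insT (T : Finset (Pt × Pt × Pt)) (p x y v : Pt) : Finset (Pt × Pt × Pt) := flipT T y x v p

theorem Ear.tri (hP : Cfg P A B C) (h : Tri P A B C T) {u v w : Pt} (he : Ear T p u v w) :
    Tri P A B C (earT T p u v w) :=
  h.flip hP he.h2 (h.rot2 he.h1) he.c1 (by have := he.c2; rwa [← o_rot'] at this)

/-- an outer triangle that can be inserted -/
structure Out (T : Finset (Pt × Pt × Pt)) (p x y v : Pt) : Prop where
  h1 : (p, x, y) ∈ T
  h2 : (y, x, v) ∈ T
  c1 : 0 < o p x v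
  c2 : 0 < o p v y

theorem Out.tri (hP : Cfg P A B C) (h : Tri P A B C T) {x y v : Pt} (he : Out T p x y v) :
    Tri P A B C (insT T p x y v) :=
  h.flip hP he.h2 (h.rot _ _ _ he.h1) he.c1 (by have := he.c2; rwa [← o_rot] at this)

theorem mem_flipT {u v w z : Pt} {t : Pt × Pt × Pt} : t ∈ flipT T u v w z ↔
    (t ∈ T ∧ t ∉ rot3 u v w ∧ t ∉ rot3 v u z) ∨ t ∈ rot3 z v w ∨ t ∈ rot3 w u z := by
  unfold flipT
  simp only [Finset.mem_union, Finset.mem_sdiff, not_or]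

theorem Ear.ne (h : Tri P A B C T) {u v w : Pt} (he : Ear T p u v w) :
    p ≠ u ∧ p ≠ v ∧ p ≠ w ∧ u ≠ v ∧ v ≠ w ∧ u ≠ w := by
  have a := h.ne_of_link he.h1
  have b := h.ne_of_link he.h2
  exact ⟨a.1, b.1, b.2.1, a.2.2, b.2.2, (h.nn he.h1 he.h2).symm⟩

theorem Ear.link (hP : Cfg P A B C) (h : Tri P A B C T) {u v w x y : Pt} (he : Ear T p u v w) :
    (p, x, y) ∈ earT T p u v w ↔ ((p, x, y) ∈ T ∧ x ≠ v ∧ y ≠ v) ∨ (x = u ∧ y = w) := by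
  obtain ⟨n1, n2, n3, n4, n5, n6⟩ := he.ne h
  unfold earT
  rw [mem_flipT]
  simp only [mem_rot3, Prod.mk.injEq, n1, n2, n3, false_and, or_false, true_and, false_or]
  constructor
  · rintro (⟨a, b, c⟩ | ⟨rfl, rfl⟩)
    · refine Or.inl ⟨a, ?_, ?_⟩
      · rintro rfl; exact b ⟨rfl, h.next_unique hP a he.h2⟩
      · rintro rfl; exact c ⟨h.prev_unique hP a he.h1, rfl⟩
    · exact Or.inr ⟨rfl, rfl⟩
  · rintro (⟨a, b, c⟩ | ⟨rfl, rfl⟩)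
    · exact Or.inl ⟨a, fun hh => b hh.1, fun hh => c hh.2⟩
    · exact Or.inr ⟨rfl, rfl⟩

theorem Ear.out (h : Tri P A B C T) {u v w a b c : Pt} (he : Ear T p u v w)
    (na : a ≠ p) (nb : b ≠ p) (nc : c ≠ p) :
    (a, b, c) ∈ earT T p u v w ↔ (a, b, c) ∈ T ∨ (a, b, c) ∈ rot3 u v w := by
  unfold earT
  rw [mem_flipT]
  simp only [mem_rot3, Prod.mk.injEq, na, nb, nc, false_and, and_false, or_false, not_false_eq_true, and_true]

theorem Out.ne (h : Tri P A B C T) {x y v : Pt} (he : Out T p x y v) :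
    p ≠ x ∧ p ≠ y ∧ p ≠ v ∧ x ≠ y ∧ x ≠ v ∧ y ≠ v := by
  have a := h.ne_of_link he.h1
  have b := ne_of_o_pos he.c1
  have c := ne_of_o_pos he.c2
  exact ⟨a.1, a.2.1, b.2.1, a.2.2, b.2.2, c.2.2.symm⟩

theorem Out.link (hP : Cfg P A B C) (h : Tri P A B C T) {x y v a b : Pt} (he : Out T p x y v) :
    (p, a, b) ∈ insT T p x y v ↔ ((p, a, b) ∈ T ∧ ¬ (a = x ∧ b = y)) ∨ (a = x ∧ b = v) ∨ (a = v ∧ b = y) := by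
  obtain ⟨n1, n2, n3, n4, n5, n6⟩ := he.ne h
  unfold insT
  rw [mem_flipT]
  simp only [mem_rot3, Prod.mk.injEq, n1, n2, n3, false_and, or_false, true_and, false_or, not_false_eq_true]

theorem Out.out (h : Tri P A B C T) {x y v a b c : Pt} (he : Out T p x y v)
    (na : a ≠ p) (nb : b ≠ p) (nc : c ≠ p) :
    (a, b, c) ∈ insT T p x y v ↔ (a, b, c) ∈ T ∧ (a, b, c) ∉ rot3 y x v := by
  unfold insT
  rw [mem_flipT]
  simp only [mem_rot3, Prod.mk.injEq, na, nb, nc, false_and, and_false, or_false, not_false_eq_true, and_true]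

theorem Ear.ins (hP : Cfg P A B C) (h : Tri P A B C T) {u v w : Pt} (he : Ear T p u v w) :
    insT (earT T p u v w) p u w v = T := by
  obtain ⟨n1, n2, n3, n4, n5, n6⟩ := he.ne h
  unfold insT earT
  refine flipT_invol h.rc he.h2 (h.rot2 he.h1) ?_ ?_
  · intro hh; exact n3 (h.func hP hh (h.rot _ _ _ he.h1)).symm
  · intro hh; exact n5 (h.next_unique hP he.h1 (h.rot _ _ _ hh))

theorem Out.notmem (hP : Cfg P A B C) (h : Tri P A B C T) {x y v : Pt} (he : Out T p x y v) :
    (p, x, v) ∉ T ∧ (p, v, y) ∉ T := by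
  obtain ⟨n1, n2, n3, n4, n5, n6⟩ := he.ne h
  exact ⟨fun hh => n6 (h.next_unique hP he.h1 hh), fun hh => n5 (h.prev_unique hP he.h1 hh)⟩

theorem Out.ear_ins (hP : Cfg P A B C) (h : Tri P A B C T) {x y v : Pt} (he : Out T p x y v) :
    earT (insT T p x y v) p x v y = T := by
  obtain ⟨k1, k2⟩ := he.notmem hP h
  unfold insT earT
  rw [flipT_symm]
  refine flipT_invol h.rc he.h2 (h.rot _ _ _ he.h1) ?_ ?_
  · exact k1
  · intro hh; exact k2 (h.rot2 hh)

theorem Out.pos (h : Tri P A B C T) {x y v : Pt} (he : Out T p x y v) : 0 < o x v y := by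
  have := h.pos _ _ _ he.h2
  rwa [← o_rot] at this

theorem Out.ear (hP : Cfg P A B C) (h : Tri P A B C T) {x y v : Pt} (he : Out T p x y v) :
    Ear (insT T p x y v) p x v y where
  h1 := by rw [he.link hP h]; simp
  h2 := by rw [he.link hP h]; simp
  c1 := he.pos h
  c2 := h.pos _ _ _ he.h1

theorem Ear.toOut (hP : Cfg P A B C) (h : Tri P A B C T) {u v w : Pt} (he : Ear T p u v w) :
    Out (earT T p u v w) p u w v where
  h1 := by rw [he.link hP h]; simp
  h2 := by
    obtain ⟨n1, n2, n3, n4, n5, n6⟩ := he.ne h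
    rw [he.out h n3.symm n1.symm n2.symm]; right; rw [mem_rot3]; tauto
  c1 := h.pos _ _ _ he.h1
  c2 := h.pos _ _ _ he.h2

/-- cardinality of the link after insertion -/
theorem Out.card (hP : Cfg P A B C) (h : Tri P A B C T) {x y v : Pt} (he : Out T p x y v) :
    SC.link (insT T p x y v) p = insert (x, v) (insert (v, y) ((SC.link T p).erase (x, y))) := by
  ext ⟨a, b⟩
  rw [mem_link, he.link hP h]
  simp only [Finset.mem_insert, Finset.mem_erase, mem_link, Prod.mk.injEq, ne_eq]
  tauto

theorem Out.notmem' (hP : Cfg P A B C) (h : Tri P A B C T) {x y v : Pt} (he : Out T p x y v) :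
    (v, y) ∉ ((SC.link T p).erase (x, y)) ∧ (x, v) ∉ insert (v, y) ((SC.link T p).erase (x, y)) := by
  obtain ⟨k1, k2⟩ := he.notmem hP h
  obtain ⟨n1, n2, n3, n4, n5, n6⟩ := he.ne h
  simp only [Finset.mem_insert, Finset.mem_erase, mem_link, Prod.mk.injEq, ne_eq]
  tauto

theorem Out.card' (hP : Cfg P A B C) (h : Tri P A B C T) {x y v : Pt} (he : Out T p x y v) :
    (SC.link (insT T p x y v) p).card = (SC.link T p).card + 1 := by
  obtain ⟨k1, k2⟩ := he.notmem' hP h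
  rw [he.card hP h, Finset.card_insert_of_notMem k2, Finset.card_insert_of_notMem k1,
    Finset.card_erase_of_mem (mem_link.2 he.h1)]
  have : 0 < (SC.link T p).card := Finset.card_pos.2 ⟨_, mem_link.2 he.h1⟩
  omega

/-! heights -/

def DD (h : Pt → ℝ) (u v w z : Pt) : ℝ := o u w z * h v + o u z v * h w + o u v w * h z - o v w z * h u

structure Ht (P : Finset Pt) (h : Pt → ℝ) : Prop where
  ne : ∀ u ∈ P, ∀ v ∈ P, ∀ w ∈ P, ∀ z ∈ P, u ≠ v → u ≠ w → u ≠ z → v ≠ w → v ≠ z → w ≠ z → DD h u v w z ≠ 0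
  pos : ∀ u ∈ P, ∀ v ∈ P, ∀ w ∈ P, ∀ z ∈ P, inTri u v w z → 0 < DD h u v w z

def gk (h : Pt → ℝ) (p a b c : Pt) : ℝ := (o p b c * h a + o p c a * h b + o p a b * h c) / o a b c

theorem gk_rot (h : Pt → ℝ) (p a b c : Pt) : gk h p b c a = gk h p a b c := by
  unfold gk; rw [o_rot a b c]; ring

theorem gk_sub1 {h : Pt → ℝ} {p u v w z : Pt} (h1 : o u v w ≠ 0) (h2 : o u w z ≠ 0) :
    gk h p u v w - gk h p u w z = - (o p u w * DD h u v w z) / (o u v w * o u w z) := by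
  unfold gk DD
  rw [div_sub_div _ _ h1 h2]
  congr 1
  unfold o; ring

theorem gk_sub2 {h : Pt → ℝ} {p u v w z : Pt} (h1 : o u v w ≠ 0) (h2 : o v w z ≠ 0) :
    gk h p u v w - gk h p v w z = - (o p v w * DD h u v w z) / (o u v w * o v w z) := by
  unfold gk DD
  rw [div_sub_div _ _ h1 h2]
  congr 1
  unfold o; ring

theorem gk_sub3 {h : Pt → ℝ} {p u v w z : Pt} (h1 : o u v w ≠ 0) (h2 : o z u v ≠ 0) :
    gk h p u v w - gk h p z u v = - (o p u v * DD h u v w z) / (o u v w * o z u v) := by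
  unfold gk DD
  rw [div_sub_div _ _ h1 h2]
  congr 1
  unfold o; ring

theorem DD_perm (h : Pt → ℝ) (u v w z : Pt) : DD h w u v z = DD h u v w z := by
  unfold DD o; ring

theorem aux_sign {x a b c d e : ℝ} (hx : a - b = -(c * d) / (x * e)) (c0 : 0 < c) (x0 : 0 < x) (e0 : 0 < e) :
    (b < a ↔ d < 0) ∧ (b ≤ a ↔ d ≤ 0) := by
  have hxe := mul_pos x0 e0
  have h2 : (a - b) * (x * e) = -(c * d) := by rw [hx]; field_simp
  constructor
  · constructor
    · intro hab
      have := mul_pos (sub_pos.2 hab) hxe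
      by_contra hd
      nlinarith [mul_nonneg c0.le (not_lt.1 hd)]
    · intro hd
      have := mul_pos c0 (neg_pos.2 hd)
      by_contra hab
      nlinarith [mul_nonneg (sub_nonneg.2 (not_lt.1 hab)) hxe.le]
  · constructor
    · intro hab
      have := mul_nonneg (sub_nonneg.2 hab) hxe.le
      by_contra hd
      nlinarith [mul_pos c0 (not_le.1 hd)]
    · intro hd
      have := mul_nonneg c0.le (neg_nonneg.2 hd)
      by_contra hab
      nlinarith [mul_pos (sub_pos.2 (not_le.1 hab)) hxe]

theorem geo_S {h : Pt → ℝ} (hh : Ht P h) (hP : Cfg P A B C) {p u v w z : Pt} (mu : u ∈ P) (mv : v ∈ P) (mw : w ∈ P) (mz : z ∈ P)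
    (vz : v ≠ z) (h1 : 0 < o u v w) (h2 : 0 < o u w z) (p1 : 0 < o p u v) (p2 : 0 < o p v w) (p3 : 0 < o p u w)
    (hg : gk h p u w z ≤ gk h p u v w) :
    (0 < o v w z ∧ gk h p v w z < gk h p u v w) ∧ (0 < o z u v ∧ gk h p z u v < gk h p u v w) := by
  obtain ⟨a1, a2, a3⟩ := ne_of_o_pos h1
  obtain ⟨b1, b2, b3⟩ := ne_of_o_pos h2
  have d0 := ((aux_sign (gk_sub1 h1.ne' h2.ne') p3 h1 h2).2).1 hg
  have d1 : DD h u v w z < 0 := lt_of_le_of_ne d0 (hh.ne _ mu _ mv _ mw _ mz a1 a2 b2 a3 vz b3)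
  have c1 : 0 < o v w z := by
    by_contra hc
    have hc' := lt_of_le_of_ne (not_lt.1 hc) (hP.gp _ mv _ mw _ mz a3 vz b3)
    have := hh.pos w mw u mu v mv z mz ⟨by rw [o_rot']; exact h1, by rw [o_swap]; linarith, by rw [o_rot]; exact h2⟩
    rw [DD_perm] at this; linarith
  have c2 : 0 < o z u v := by
    by_contra hc
    have hc' := lt_of_le_of_ne (not_lt.1 hc) (hP.gp _ mz _ mu _ mv b2.symm vz.symm a1)
    have := hh.pos u mu v mv w mw z mz ⟨h1, h2, by rw [o_swap]; linarith⟩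
    linarith
  exact ⟨⟨c1, ((aux_sign (gk_sub2 h1.ne' c1.ne') p2 h1 c1).1).2 d1⟩,
    ⟨c2, ((aux_sign (gk_sub3 h1.ne' c2.ne') p1 h1 c2).1).2 d1⟩⟩

theorem geo_I {h : Pt → ℝ} (hh : Ht P h) (hP : Cfg P A B C) {p a c b w : Pt} (ma : a ∈ P) (mc : c ∈ P) (mb : b ∈ P) (mw : w ∈ P)
    (aw : a ≠ w) (h1 : 0 < o a c b) (p1 : 0 < o p a b) (p3 : 0 < o p c b) (p4 : 0 < o p b w)
    (h2 : 0 < o c b w) (hg : gk h p c b w ≤ gk h p a c b) :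
    0 < o a b w ∧ gk h p a b w < gk h p a c b := by
  obtain ⟨a1, a2, a3⟩ := ne_of_o_pos h1
  obtain ⟨b1, b2, b3⟩ := ne_of_o_pos h2
  have d0 := ((aux_sign (gk_sub2 h1.ne' h2.ne') p3 h1 h2).2).1 hg
  have d1 : DD h a c b w < 0 := lt_of_le_of_ne d0 (hh.ne _ ma _ mc _ mb _ mw a1 a2 aw a3 b2 b3)
  have c1 : 0 < o a b w := by
    by_contra hc
    have hc' := lt_of_le_of_ne (not_lt.1 hc) (hP.gp _ ma _ mb _ mw a2 aw b3)
    have id : o p b w * o a c b = o c b w * (- o p a b) + o a b w * o p c b := by unfold o; ring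
    nlinarith [mul_pos p4 h1, mul_pos h2 p1, mul_pos (neg_pos.2 hc') p3]
  exact ⟨c1, ((aux_sign (gk_sub1 h1.ne' c1.ne') p1 h1 c1).1).2 d1⟩

theorem geo_I' {h : Pt → ℝ} (hh : Ht P h) (hP : Cfg P A B C) {p a c b w : Pt} (ma : a ∈ P) (mc : c ∈ P) (mb : b ∈ P) (mw : w ∈ P)
    (bw : b ≠ w) (h1 : 0 < o a c b) (p1 : 0 < o p a b) (p3 : 0 < o p a c) (p4 : 0 < o p w a)
    (h2 : 0 < o w a c) (hg : gk h p w a c ≤ gk h p a c b) :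
    0 < o w a b ∧ gk h p w a b < gk h p a c b := by
  obtain ⟨a1, a2, a3⟩ := ne_of_o_pos h1
  obtain ⟨b1, b2, b3⟩ := ne_of_o_pos h2
  have d0 := ((aux_sign (gk_sub3 h1.ne' h2.ne') p3 h1 h2).2).1 hg
  have d1 : DD h a c b w < 0 := lt_of_le_of_ne d0 (hh.ne _ ma _ mc _ mb _ mw a1 a2 b1.symm a3 b2.symm bw)
  have c1 : 0 < o w a b := by
    by_contra hc
    have hc' := lt_of_le_of_ne (not_lt.1 hc) (hP.gp _ mw _ ma _ mb b1 bw.symm a2)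
    have id : o p w a * o a c b = o w a c * (- o p a b) + o w a b * o p a c := by unfold o; ring
    nlinarith [mul_pos p4 h1, mul_pos h2 p1, mul_pos (neg_pos.2 hc') p3]
  have c1' : 0 < o a b w := by rw [o_rot]; exact c1
  rw [← gk_rot h p w a b]
  exact ⟨c1, ((aux_sign (gk_sub1 h1.ne' c1'.ne') p1 h1 c1').1).2 d1⟩

end SC

namespace SC
variable {P : Finset Pt} {A B C : Pt} {T : Finset (Pt × Pt × Pt)} {p : Pt}

structure Key (P : Finset Pt) (h : Pt → ℝ) (p : Pt) (κ : Pt → Pt → Pt → ℕ) : Prop where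
  rot : ∀ a b c, κ b c a = κ a b c
  mono : ∀ a ∈ P, ∀ b ∈ P, ∀ c ∈ P, ∀ a' ∈ P, ∀ b' ∈ P, ∀ c' ∈ P, gk h p a b c < gk h p a' b' c' →
    κ a b c < κ a' b' c'
  inj : ∀ a ∈ P, ∀ b ∈ P, ∀ c ∈ P, ∀ a' ∈ P, ∀ b' ∈ P, ∀ c' ∈ P, κ a b c = κ a' b' c' →
    ({a, b, c} : Finset Pt) = {a', b', c'}

variable {h : Pt → ℝ} {κ : Pt → Pt → Pt → ℕ}

def AllEars (κ : Pt → Pt → Pt → ℕ) (p : Pt) (k : ℕ) (T : Finset (Pt × Pt × Pt)) : Prop :=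
  ∀ u v w, Ear T p u v w → k ≤ κ u v w

theorem root.at (hP : Cfg P A B C) (hT : Tri P A B C T) (hp : Inn P A B C p) (hk : Key P h p κ) {a b c u w : Pt}
    (hr : root T p a b c) (hu : (p, u, w) ∈ T) : ∃ z, root T p u w z ∧ κ a b c = κ u w z := by
  rcases hr.only hP hT hp hu with rfl | rfl | rfl
  · have := hT.next_unique hP hu hr.1
    subst this; exact ⟨c, hr, rfl⟩
  · have := hT.next_unique hP hu hr.2.1
    subst this; exact ⟨a, hr.rot, (hk.rot _ _ _).symm⟩
  · have := hT.next_unique hP hu hr.2.2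
    subst this; exact ⟨b, hr.rot.rot, by rw [← hk.rot, ← hk.rot]⟩

theorem Ear.mems (hT : Tri P A B C T) {u v w : Pt} (he : Ear T p u v w) : u ∈ P ∧ v ∈ P ∧ w ∈ P :=
  ⟨hT.mem2 he.h1, hT.mem2 he.h2, hT.mem3 he.h2⟩

theorem Key.le (hk : Key P h p κ) {a b c a' b' c' : Pt} (ha : a ∈ P) (hb : b ∈ P) (hc : c ∈ P) (ha' : a' ∈ P)
    (hb' : b' ∈ P) (hc' : c' ∈ P) (hle : κ a b c ≤ κ a' b' c') : gk h p a b c ≤ gk h p a' b' c' := by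
  by_contra hh
  have := hk.mono _ ha' _ hb' _ hc' _ ha _ hb _ hc (not_le.1 hh)
  omega

theorem step_S (hP : Cfg P A B C) (hT : Tri P A B C T) (hp : Inn P A B C p) (hh : Ht P h) (hk : Key P h p κ)
    {k : ℕ} {u v w : Pt} (ha : AllEars κ p k T) (he : Ear T p u v w) (hkk : κ u v w = k) :
    AllEars κ p (k + 1) (earT T p u v w) ∧ ∀ a b c, root (earT T p u v w) p a b c → k < κ a b c := by
  have hT1 := he.tri hP hT
  obtain ⟨n1, n2, n3, n4, n5, n6⟩ := he.ne hT
  obtain ⟨mu, mv, mw⟩ := he.mems hT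
  have p1 := hT.pos _ _ _ he.h1
  have p2 := hT.pos _ _ _ he.h2
  have p3 := he.c2
  have geo : ∀ z ∈ P, v ≠ z → 0 < o u w z → κ u w z ≤ k →
      (0 < o v w z ∧ κ v w z < k) ∧ (0 < o z u v ∧ κ z u v < k) := by
    intro z mz vz h2 hle
    obtain ⟨⟨a1, a2⟩, b1, b2⟩ := geo_S hh hP mu mv mw mz vz he.c1 h2 p1 p2 p3 (hk.le mu mw mz mu mv mw (hkk ▸ hle))
    subst hkk
    exact ⟨⟨a1, hk.mono _ mv _ mw _ mz _ mu _ mv _ mw a2⟩, b1, hk.mono _ mz _ mu _ mv _ mu _ mv _ mw b2⟩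
  constructor
  · intro x y z hx
    obtain ⟨mx, my, mz⟩ := hx.mems hT1
    have l1 := (he.link hP hT).1 hx.h1
    have l2 := (he.link hP hT).1 hx.h2
    by_contra hcon
    have hcon' : κ x y z ≤ k := by omega
    rcases l1 with ⟨l1, xv, yv⟩ | ⟨rfl, rfl⟩
    · rcases l2 with ⟨l2, _, zv⟩ | ⟨rfl, rfl⟩
      · have e1 := ha x y z ⟨l1, l2, hx.c1, hx.c2⟩
        have e2 : κ x y z = κ u v w := by omega
        have e3 := hk.inj _ mx _ my _ mz _ mu _ mv _ mw e2
        have : v ∈ ({x, y, z} : Finset Pt) := by rw [e3]; simp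
        simp only [Finset.mem_insert, Finset.mem_singleton] at this
        rcases this with e | e | e
        exacts [xv e.symm, yv e.symm, zv e.symm]
      · obtain ⟨-, b1, b2⟩ := geo x mx xv.symm (by rw [o_rot]; exact hx.c1) (by rw [hk.rot]; exact hcon')
        refine absurd (ha x y v ⟨l1, he.h1, b1, ?_⟩) (by omega)
        have id := o_pl p z x y v
        have q1 := hT.pos _ _ _ l1
        have q2 := hx.c2
        rw [o_swap' p x z, o_swap' p y z, o_swap' p v z, o_swap' p x v] at id
        by_contra hc
        nlinarith [mul_pos q2 p1, mul_nonneg p3.le (neg_nonneg.2 (not_lt.1 hc)), mul_pos p2 q1]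
    · rcases l2 with ⟨l2, _, zv⟩ | ⟨e, rfl⟩
      · obtain ⟨⟨b1, b2⟩, -⟩ := geo z mz zv.symm hx.c1 hcon'
        refine absurd (ha v y z ⟨he.h2, l2, b1, ?_⟩) (by omega)
        have id := o_pl p x v y z
        have q1 := hT.pos _ _ _ l2
        have q2 := hx.c2
        rw [o_swap' p v z] at id
        by_contra hc
        nlinarith [mul_pos p1 q1, mul_nonneg p3.le (neg_nonneg.2 (not_lt.1 hc)), mul_pos q2 p2]
      · exact n6 e.symm
  · intro a b c hr
    obtain ⟨z, hr', hz⟩ := hr.at hP hT1 hp hk (u := u) (w := w) (by rw [he.link hP hT]; simp)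
    rw [hz]
    by_contra hcon
    have mz := hT1.mem3 hr'.2.1
    have l2 := (he.link hP hT).1 hr'.2.1
    have l3 := (he.link hP hT).1 hr'.2.2
    rcases l2 with ⟨l2, _, zv⟩ | ⟨e, _⟩
    swap
    · exact n6 e.symm
    rcases l3 with ⟨l3, _, _⟩ | ⟨_, e⟩
    swap
    · exact n6 e
    obtain ⟨⟨a1, a2⟩, b1, b2⟩ := geo z mz zv.symm (hr'.pos hT1) (not_lt.1 hcon)
    rcases lt_or_gt_of_ne (hP.gp _ hp.mem _ mv _ mz n2 (hT.ne_of_link l3).1 zv.symm) with e | e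
    · refine absurd (ha z u v ⟨l3, he.h1, b1, ?_⟩) (by omega)
      rw [o_swap']; linarith
    · exact absurd (ha v w z ⟨he.h2, l2, a1, e⟩) (by omega)

theorem Ear.card_lt (hP : Cfg P A B C) (hT : Tri P A B C T) {u v w : Pt} (he : Ear T p u v w) :
    (SC.link (earT T p u v w) p).card + 1 = (SC.link T p).card := by
  have := (he.toOut hP hT).card' hP (he.tri hP hT)
  rw [he.ins hP hT] at this
  exact this.symm

theorem corner_ge (hP : Cfg P A B C) (hp : Inn P A B C p) (hh : Ht P h) (hk : Key P h p κ) (n : ℕ) :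
    ∀ (T : Finset (Pt × Pt × Pt)) (_ : Tri P A B C T) (_ : (link T p).card ≤ n) (k : ℕ) (_ : AllEars κ p k T)
    (_ : ∀ a b c, root T p a b c → k ≤ κ a b c) (x y z : Pt) (_ : (p, x, y) ∈ T) (_ : (p, y, z) ∈ T)
    (_ : 0 < o x y z), k ≤ κ x y z := by
  induction n with
  | zero =>
    intro T hT hc k _ _ x y z hx
    have := hT.card_link_ge hP hp
    omega
  | succ n ih =>
    intro T hT hc k ha hr x y z hx hy hpos
    by_cases hroot : ∃ a b c, root T p a b c
    · obtain ⟨a, b, c, h0⟩ := hroot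
      obtain ⟨z', hz', e⟩ := h0.at hP hT hp hk hx
      rw [hT.next_unique hP hy hz'.2.1, ← e]
      exact hr _ _ _ h0
    push Not at hroot
    have hex := hT.ear_exists hP hp hroot
    have hex' : ∃ n u v w, Ear T p u v w ∧ κ u v w = n := by
      obtain ⟨u, v, w, hu⟩ := hex; exact ⟨_, u, v, w, hu, rfl⟩
    obtain ⟨u, v, w, he, hn⟩ := Nat.find_spec hex'
    set k0 := Nat.find hex' with hk0
    have hA : AllEars κ p k0 T := fun a b c hab => Nat.find_min' hex' ⟨a, b, c, hab, rfl⟩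
    have hk0' : k ≤ k0 := by rw [← hn]; exact ha _ _ _ he
    obtain ⟨s1, s2⟩ := step_S hP hT hp hh hk hA he hn
    have hT1 := he.tri hP hT
    have IH := ih _ hT1 (by have := he.card_lt hP hT; omega) (k0 + 1) s1 s2
    obtain ⟨n1, n2, n3, n4, n5, n6⟩ := he.ne hT
    obtain ⟨mu, mv, mw⟩ := he.mems hT
    have mx := hT.mem2 hx
    have my := hT.mem2 hy
    have mz := hT.mem3 hy
    by_contra hcon
    by_cases yv : y = v
    · subst yv
      rw [hT.prev_unique hP hx he.h1, hT.next_unique hP hy he.h2] at hcon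
      omega
    by_cases xv : x = v
    · subst xv
      have := hT.next_unique hP hx he.h2
      subst this
      have zu : u ≠ z := by rintro rfl; exact hroot u x y ⟨he.h1, hx, hy⟩
      obtain ⟨g1, g2⟩ := geo_I hh hP mu mv mw mz zu he.c1 he.c2 (hT.pos _ _ _ hx) (hT.pos _ _ _ hy) hpos
        (hk.le mv mw mz mu mv mw (by omega))
      have g3 := hk.mono _ mu _ mw _ mz _ mu _ mv _ mw g2
      have := IH u y z (by rw [he.link hP hT]; simp)
        (by rw [he.link hP hT]; exact Or.inl ⟨hy, yv, hT.nn hx hy⟩) g1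
      omega
    by_cases zv : z = v
    · subst zv
      have := hT.prev_unique hP hy he.h1
      subst this
      have zu : w ≠ x := by rintro rfl; exact hroot w y z ⟨hx, he.h1, he.h2⟩
      obtain ⟨g1, g2⟩ := geo_I' hh hP mu mv mw mx zu he.c1 he.c2 (hT.pos _ _ _ hy) (hT.pos _ _ _ hx) hpos
        (hk.le mx mu mv mu mv mw (by omega))
      have g3 := hk.mono _ mx _ mu _ mw _ mu _ mv _ mw g2
      have := IH x y w (by rw [he.link hP hT]; exact Or.inl ⟨hx, xv, yv⟩) (by rw [he.link hP hT]; simp) g1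
      omega
    have := IH x y z (by rw [he.link hP hT]; exact Or.inl ⟨hx, xv, yv⟩)
      (by rw [he.link hP hT]; exact Or.inl ⟨hy, yv, zv⟩) hpos
    omega

theorem step_I (hP : Cfg P A B C) (hT : Tri P A B C T) (hp : Inn P A B C p) (hh : Ht P h) (hk : Key P h p κ)
    {k : ℕ} {x y v : Pt} (ha : AllEars κ p (k + 1) T) (hr : ∀ a b c, root T p a b c → k + 1 ≤ κ a b c)
    (he : Out T p x y v) (hkk : κ x v y = k) : AllEars κ p k (insT T p x y v) := by
  have hT1 := he.tri hP hT
  have hE := he.ear hP hT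
  have CC := corner_ge hP hp hh hk _ T hT le_rfl (k + 1) ha hr
  obtain ⟨mx, mv, my⟩ := hE.mems hT1
  obtain ⟨n1, n2, n3, n4, n5, n6⟩ := he.ne hT
  intro a b c hab
  by_contra hcon
  obtain ⟨ma, mb, mc⟩ := hab.mems hT1
  by_cases bv : b = v
  · subst bv
    rw [hT1.prev_unique hP hab.h1 hE.h1, hT1.next_unique hP hab.h2 hE.h2] at hcon
    omega
  by_cases av : a = v
  · subst av
    have := hT1.next_unique hP hab.h1 hE.h2
    subst this
    have hbc : (p, b, c) ∈ T := by
      rcases (he.link hP hT).1 hab.h2 with ⟨e, _⟩ | ⟨e, _⟩ | ⟨e, _⟩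
      · exact e
      · exact absurd e n4.symm
      · exact absurd e bv
    obtain ⟨g1, g2⟩ := geo_I hh hP mx mv my mc (hT.nn he.h1 hbc).symm (he.pos hT) (hT.pos _ _ _ he.h1) he.c2
      (hT.pos _ _ _ hbc) hab.c1 (hk.le mv my mc mx mv my (by omega))
    have g3 := hk.mono _ mx _ my _ mc _ mx _ mv _ my g2
    have := CC x b c he.h1 hbc g1
    omega
  by_cases cv : c = v
  · subst cv
    have := hT1.prev_unique hP hab.h2 hE.h1
    subst this
    have hbc : (p, a, b) ∈ T := by
      rcases (he.link hP hT).1 hab.h1 with ⟨e, _⟩ | ⟨_, e⟩ | ⟨_, e⟩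
      · exact e
      · exact absurd e bv
      · exact absurd e n4
    obtain ⟨g1, g2⟩ := geo_I' hh hP mx mv my ma (hT.nn hbc he.h1) (he.pos hT) (hT.pos _ _ _ he.h1) he.c1
      (hT.pos _ _ _ hbc) hab.c1 (hk.le ma mx mv mx mv my (by omega))
    have g3 := hk.mono _ ma _ mx _ my _ mx _ mv _ my g2
    have := CC a b y hbc he.h1 g1
    omega
  have l1 : (p, a, b) ∈ T := by
    rcases (he.link hP hT).1 hab.h1 with ⟨e, _⟩ | ⟨_, e⟩ | ⟨e, _⟩
    exacts [e, absurd e bv, absurd e av]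
  have l2 : (p, b, c) ∈ T := by
    rcases (he.link hP hT).1 hab.h2 with ⟨e, _⟩ | ⟨_, e⟩ | ⟨e, _⟩
    exacts [e, absurd e cv, absurd e bv]
  have := ha a b c ⟨l1, l2, hab.c1, hab.c2⟩
  omega

theorem ear_unique (hP : Cfg P A B C) (hT : Tri P A B C T) {u v w u' v' w' : Pt} (he : Ear T p u v w)
    (he' : Ear T p u' v' w') (hs : ({u, v, w} : Finset Pt) = {u', v', w'}) : u = u' ∧ v = v' ∧ w = w' := by
  have no : ∀ {u v w : Pt}, Ear T p u v w → (p, w, u) ∉ T := by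
    intro u v w he hh
    have a := hT.pos _ _ _ hh
    have b := he.c2
    rw [o_swap'] at a; linarith
  have m : v' ∈ ({u, v, w} : Finset Pt) := by rw [hs]; simp
  have mu : u' ∈ ({u, v, w} : Finset Pt) := by rw [hs]; simp
  have mw : w' ∈ ({u, v, w} : Finset Pt) := by rw [hs]; simp
  simp only [Finset.mem_insert, Finset.mem_singleton] at m mu mw
  obtain ⟨n1, n2, n3, n4, n5, n6⟩ := he.ne hT
  obtain ⟨k1, k2, k3, k4, k5, k6⟩ := he'.ne hT
  rcases m with rfl | rfl | rfl
  · have e := hT.next_unique hP he'.h2 he.h1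
    subst e
    rcases mu with e | e | rfl
    · exact absurd e k4
    · exact absurd e k6
    · exact absurd he'.h1 (no he)
  · exact ⟨hT.prev_unique hP he.h1 he'.h1, rfl, hT.next_unique hP he.h2 he'.h2⟩
  · have e := hT.prev_unique hP he'.h1 he.h2
    subst e
    rcases mw with rfl | e | e
    · exact absurd he'.h2 (no he)
    · exact absurd e.symm k6
    · exact absurd e.symm k5

theorem out_unique (hP : Cfg P A B C) (hT : Tri P A B C T) (hp : Inn P A B C p) {x y v x' y' v' : Pt} (he : Out T p x y v)
    (he' : Out T p x' y' v') (hs : ({x, v, y} : Finset Pt) = {x', v', y'}) : x = x' ∧ y = y' ∧ v = v' := by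
  have m : v' ∈ ({x, v, y} : Finset Pt) := by rw [hs]; simp
  have mx : x' ∈ ({x, v, y} : Finset Pt) := by rw [hs]; simp
  have my : y' ∈ ({x, v, y} : Finset Pt) := by rw [hs]; simp
  simp only [Finset.mem_insert, Finset.mem_singleton] at m mx my
  obtain ⟨n1, n2, n3, n4, n5, n6⟩ := he.ne hT
  obtain ⟨k1, k2, k3, k4, k5, k6⟩ := he'.ne hT
  obtain ⟨z, hz⟩ := hT.next hP hp he.h1
  rcases m with rfl | rfl | rfl
  · exact (hT.cone hP hp he'.h1 he.h1 he'.c1 he'.c2).elim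
  · rcases mx with rfl | e | rfl
    · rcases my with e | e | e
      · exact absurd e.symm k4
      · exact absurd e k6
      · exact ⟨rfl, e.symm, rfl⟩
    · exact absurd e k5
    · rcases my with rfl | e | e
      · exact absurd rfl (hT.nn he.h1 he'.h1)
      · exact absurd e k6
      · exact absurd e.symm k4
  · exact (hT.cone hP hp he'.h1 hz he'.c1 he'.c2).elim

end SC

namespace SC
variable {P : Finset Pt} {A B C : Pt} {T : Finset (Pt × Pt × Pt)} {p : Pt}
variable {h : Pt → ℝ} {κ : Pt → Pt → Pt → ℕ} {R : Type} [CommRing R]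

def TT (P : Finset Pt) (A B C : Pt) : Finset (Finset (Pt × Pt × Pt)) :=
  ((P ×ˢ P ×ˢ P).powerset).filter (Tri P A B C)

theorem mem_TT : T ∈ TT P A B C ↔ Tri P A B C T := by
  unfold TT
  simp only [Finset.mem_filter, Finset.mem_powerset, and_iff_right_iff_imp]
  rintro h ⟨a, b, c⟩ ht
  simp only [Finset.mem_product]
  exact ⟨h.mem _ _ _ ht, h.mem2 ht, h.mem3 ht⟩

def pc (T : Finset (Pt × Pt × Pt)) (p x y v : Pt) : Prop := (y, x, v) ∈ T ∧ 0 < o p x v ∧ 0 < o p v y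

def phi (P : Finset Pt) (X : R) (κ : Pt → Pt → Pt → ℕ) (p : Pt) (T : Finset (Pt × Pt × Pt)) (m : ℕ) (x y : Pt) : R :=
  1 + ∑ v ∈ P, if _h : pc T p x y v ∧ κ x v y < m then
    X * phi P X κ p T (κ x v y) x v * phi P X κ p T (κ x v y) v y else 0
termination_by m
decreasing_by all_goals exact _h.2

theorem phi_pos (hP : Cfg P A B C) (hT : Tri P A B C T) (X : R) {m : ℕ} {x y v : Pt} (h1 : pc T p x y v)
    (h2 : κ x v y < m) : phi P X κ p T m x y =
      1 + X * phi P X κ p T (κ x v y) x v * phi P X κ p T (κ x v y) v y := by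
  rw [phi, Finset.sum_eq_single v]
  · rw [dif_pos ⟨h1, h2⟩]
  · intro b _ hb
    rw [dif_neg]
    rintro ⟨h3, -⟩
    exact hb (hT.func hP h3.1 h1.1)
  · intro hv; exact absurd (hT.mem3 h1.1) hv

theorem phi_neg (X : R) {m : ℕ} {x y : Pt} (h1 : ∀ v, pc T p x y v → ¬ κ x v y < m) : phi P X κ p T m x y = 1 := by
  rw [phi, Finset.sum_eq_zero, add_zero]
  intro v _
  rw [dif_neg]
  exact fun hh => h1 v hh.1 hh.2

theorem phi_succ (X : R) {m : ℕ} {x y : Pt} (h1 : ∀ v, pc T p x y v → κ x v y ≠ m) :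
    phi P X κ p T (m + 1) x y = phi P X κ p T m x y := by
  rw [phi, phi]
  congr 1
  refine Finset.sum_congr rfl fun v _ => ?_
  by_cases hc : pc T p x y v
  · have := h1 v hc
    simp only [hc, true_and, Nat.lt_succ_iff]
    by_cases h2 : κ x v y < m
    · rw [dif_pos h2, dif_pos h2.le]
    · rw [dif_neg h2, dif_neg (by omega)]
  · simp only [hc, false_and, dite_false]

theorem phi_congr (X : R) {T1 : Finset (Pt × Pt × Pt)} {k : ℕ}
    (hc : ∀ x y v, κ x v y < k → (pc T p x y v ↔ pc T1 p x y v)) :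
    ∀ m ≤ k, ∀ x y, phi P X κ p T m x y = phi P X κ p T1 m x y := by
  intro m
  induction m using Nat.strong_induction_on with
  | _ m ih =>
    intro hm x y
    rw [phi, phi.eq_1 P X κ p T1]
    congr 1
    refine Finset.sum_congr rfl fun v _ => ?_
    by_cases h2 : κ x v y < m
    · have h3 := hc x y v (by omega)
      simp only [h2, and_true, h3]
      split_ifs
      · rw [ih _ h2 (by omega), ih _ h2 (by omega)]
      · rfl
    · simp only [h2, and_false, dite_false]

def step (κ : Pt → Pt → Pt → ℕ) (p : Pt) (k : ℕ) (T : Finset (Pt × Pt × Pt)) : Finset (Pt × Pt × Pt) :=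
  if hh : ∃ e : Pt × Pt × Pt, Ear T p e.1 e.2.1 e.2.2 ∧ κ e.1 e.2.1 e.2.2 = k then
    earT T p hh.choose.1 hh.choose.2.1 hh.choose.2.2 else T

theorem step_ear (hP : Cfg P A B C) (hT : Tri P A B C T) (hk : Key P h p κ) {k : ℕ} {u v w : Pt}
    (he : Ear T p u v w) (hkk : κ u v w = k) : step κ p k T = earT T p u v w := by
  have hh : ∃ e : Pt × Pt × Pt, Ear T p e.1 e.2.1 e.2.2 ∧ κ e.1 e.2.1 e.2.2 = k := ⟨(u, v, w), he, hkk⟩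
  unfold step
  rw [dif_pos hh]
  obtain ⟨a, b⟩ := hh.choose_spec
  obtain ⟨m1, m2, m3⟩ := he.mems hT
  obtain ⟨k1, k2, k3⟩ := a.mems hT
  obtain ⟨e1, e2, e3⟩ := ear_unique hP hT he a (hk.inj _ m1 _ m2 _ m3 _ k1 _ k2 _ k3 (by omega))
  rw [← e1, ← e2, ← e3]

theorem step_no {k : ℕ} (hn : ¬ ∃ u v w, Ear T p u v w ∧ κ u v w = k) : step κ p k T = T := by
  unfold step
  rw [dif_neg]
  rintro ⟨e, h1, h2⟩
  exact hn ⟨_, _, _, h1, h2⟩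

theorem step_mem (hP : Cfg P A B C) (hk : Key P h p κ) (k : ℕ) (hT : T ∈ TT P A B C) : step κ p k T ∈ TT P A B C := by
  rw [mem_TT] at *
  by_cases hn : ∃ u v w, Ear T p u v w ∧ κ u v w = k
  · obtain ⟨u, v, w, he, hkk⟩ := hn
    rw [step_ear hP hT hk he hkk]
    exact he.tri hP hT
  · rwa [step_no hn]

def mm (κ : Pt → Pt → Pt → ℕ) (p : Pt) (T : Finset (Pt × Pt × Pt)) (k : ℕ) : ℕ :=
  if hh : ∃ e : Pt × Pt × Pt, root T p e.1 e.2.1 e.2.2 then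
    min k (κ hh.choose.1 hh.choose.2.1 hh.choose.2.2) else k

theorem mm_root (hP : Cfg P A B C) (hT : Tri P A B C T) (hp : Inn P A B C p) (hk : Key P h p κ) {a b c : Pt}
    (hr : root T p a b c) (k : ℕ) : mm κ p T k = min k (κ a b c) := by
  have hh : ∃ e : Pt × Pt × Pt, root T p e.1 e.2.1 e.2.2 := ⟨(a, b, c), hr⟩
  unfold mm
  rw [dif_pos hh]
  obtain ⟨z, hz, e⟩ := hh.choose_spec.at hP hT hp hk hr.1
  have := hT.next_unique hP hr.2.1 hz.2.1
  subst this
  rw [e]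

theorem mm_no (hr : ∀ a b c, ¬ root T p a b c) (k : ℕ) : mm κ p T k = k := by
  unfold mm
  rw [dif_neg]
  rintro ⟨e, he⟩; exact hr _ _ _ he

theorem mm_big (hP : Cfg P A B C) (hT : Tri P A B C T) (hp : Inn P A B C p) (hk : Key P h p κ) (k : ℕ)
    (hr : ∀ a b c, root T p a b c → k ≤ κ a b c) : mm κ p T k = k := by
  by_cases hh : ∃ a b c, root T p a b c
  · obtain ⟨a, b, c, h0⟩ := hh
    rw [mm_root hP hT hp hk h0]; exact min_eq_left (hr _ _ _ h0)
  · exact mm_no (fun a b c h0 => hh ⟨a, b, c, h0⟩) k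

def FF (P : Finset Pt) (X : R) (κ : Pt → Pt → Pt → ℕ) (p : Pt) (k : ℕ) (T : Finset (Pt × Pt × Pt)) : R :=
  if AllEars κ p k T then X ^ (link T p).card * ∏ e ∈ link T p, phi P X κ p T (mm κ p T k) e.1 e.2 else 0

theorem FF_insert (hP : Cfg P A B C) (hT : Tri P A B C T) (hp : Inn P A B C p) (hh : Ht P h) (hk : Key P h p κ)
    (X : R) {k : ℕ} {x y v : Pt} (ha : AllEars κ p (k + 1) T) (hr : ∀ a b c, root T p a b c → k + 1 ≤ κ a b c)
    (he : Out T p x y v) (hkk : κ x v y = k) :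
    FF P X κ p k T + FF P X κ p k (insT T p x y v) = FF P X κ p (k + 1) T := by
  have hT1 := he.tri hP hT
  have hE := he.ear hP hT
  have ha' : AllEars κ p k T := fun a b c e => by have := ha a b c e; omega
  have ha1 := step_I hP hT hp hh hk ha hr he hkk
  obtain ⟨n1, n2, n3, n4, n5, n6⟩ := he.ne hT
  have mx := hT.mem2 he.h1
  have my := hT.mem3 he.h1
  have mv := hT.mem3 he.h2
  unfold FF
  rw [if_pos ha, if_pos ha', if_pos ha1, mm_big hP hT hp hk k (fun a b c h0 => by have := hr a b c h0; omega),
    mm_big hP hT hp hk (k + 1) hr, mm_no (fun a b c h0 => hE.not_root hT1 hP a b c hp h0), he.card' hP hT, he.card hP hT]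
  obtain ⟨k1, k2⟩ := he.notmem' hP hT
  rw [Finset.prod_insert k2, Finset.prod_insert k1]
  have hxy := mem_link.2 he.h1
  rw [← Finset.mul_prod_erase _ _ hxy, ← Finset.mul_prod_erase _ (fun e : Pt × Pt => phi P X κ p T (k + 1) e.1 e.2) hxy]
  have hpc : pc T p x y v := ⟨he.h2, he.c1, he.c2⟩
  have e1 : phi P X κ p T k x y = 1 := by
    refine phi_neg X fun v' hv' hlt => ?_
    rw [hT.func hP hv'.1 hpc.1] at hlt
    omega
  have e2 := phi_pos (κ := κ) hP hT X (m := k + 1) hpc (by omega)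
  rw [hkk] at e2
  have e4 := phi_congr (P := P) (p := p) (κ := κ) X (T := insT T p x y v) (T1 := T) (k := k) (by
    intro a b c hlt
    unfold pc
    constructor
    · rintro ⟨q1, q2, q3⟩
      have r1 := ne_of_o_pos q2
      have r2 := ne_of_o_pos q3
      exact ⟨((he.out hT r2.2.1.symm r1.1.symm r1.2.1.symm).1 q1).1, q2, q3⟩
    · rintro ⟨q1, q2, q3⟩
      have r1 := ne_of_o_pos q2
      have r2 := ne_of_o_pos q3
      refine ⟨(he.out hT r2.2.1.symm r1.1.symm r1.2.1.symm).2 ⟨q1, ?_⟩, q2, q3⟩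
      rw [mem_rot3]
      intro hq
      have : κ a c b = κ x v y := by
        rcases hq with hq | hq | hq <;> (simp only [Prod.mk.injEq] at hq; obtain ⟨rfl, rfl, rfl⟩ := hq) 
        · rfl
        · rw [hk.rot]
        · rw [← hk.rot]
      omega) k le_rfl
  have e5 : ∏ e ∈ (link T p).erase (x, y), phi P X κ p T (k + 1) e.1 e.2 =
      ∏ e ∈ (link T p).erase (x, y), phi P X κ p T k e.1 e.2 := by
    refine Finset.prod_congr rfl ?_
    rintro ⟨a, b⟩ hab
    rw [Finset.mem_erase, mem_link] at hab
    refine phi_succ X fun c hc hkc => hab.1 ?_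
    have ho : Out T p a b c := ⟨hab.2, hc.1, hc.2.1, hc.2.2⟩
    obtain ⟨q1, q2, q3⟩ := out_unique hP hT hp he ho (hk.inj _ mx _ mv _ my _ (hT.mem2 hab.2) _ (hT.mem3 hc.1) _ (hT.mem3 hab.2) (hkk.trans hkc.symm))
    rw [q1, q2]
  have e6 : ∏ e ∈ (link T p).erase (x, y), phi P X κ p (insT T p x y v) k e.1 e.2 =
      ∏ e ∈ (link T p).erase (x, y), phi P X κ p T k e.1 e.2 :=
    Finset.prod_congr rfl fun e _ => e4 _ _
  rw [e5, e6, e4, e4, e2, e1]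
  ring

theorem FF_same (hP : Cfg P A B C) (hT : Tri P A B C T) (hp : Inn P A B C p) (hk : Key P h p κ)
    (X : R) {k : ℕ} (ha : AllEars κ p (k + 1) T)
    (hn : ¬ ((∀ a b c, root T p a b c → k + 1 ≤ κ a b c) ∧ ∃ x y v, Out T p x y v ∧ κ x v y = k)) :
    FF P X κ p k T = FF P X κ p (k + 1) T := by
  have ha' : AllEars κ p k T := fun a b c e => by have := ha a b c e; omega
  unfold FF
  rw [if_pos ha, if_pos ha']
  by_cases hr : ∀ a b c, root T p a b c → k + 1 ≤ κ a b c
  · rw [mm_big hP hT hp hk k (fun a b c h0 => by have := hr a b c h0; omega), mm_big hP hT hp hk (k + 1) hr]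
    congr 1
    refine Finset.prod_congr rfl ?_
    rintro ⟨a, b⟩ hab
    rw [mem_link] at hab
    refine (phi_succ X fun c hc hkc => hn ⟨hr, a, b, c, ⟨hab, hc.1, hc.2.1, hc.2.2⟩, hkc⟩).symm
  · push Not at hr
    obtain ⟨a, b, c, h0, h1⟩ := hr
    rw [mm_root hP hT hp hk h0, mm_root hP hT hp hk h0]
    congr 3
    ext e
    congr 1
    omega

theorem FF_step (hP : Cfg P A B C) (hT : Tri P A B C T) (hp : Inn P A B C p) (hh : Ht P h) (hk : Key P h p κ)
    (X : R) (k : ℕ) : ∑ T1 ∈ TT P A B C with step κ p k T1 = T, FF P X κ p k T1 = FF P X κ p (k + 1) T := by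
  -- contributors other than T itself
  have other : ∀ T1, Tri P A B C T1 → step κ p k T1 = T → AllEars κ p k T1 → T1 ≠ T →
      AllEars κ p (k + 1) T ∧ (∀ a b c, root T p a b c → k + 1 ≤ κ a b c) ∧
      ∃ x y v, Out T p x y v ∧ κ x v y = k ∧ T1 = insT T p x y v := by
    intro T1 hT1 hs ha hne
    by_cases hn : ∃ u v w, Ear T1 p u v w ∧ κ u v w = k
    · obtain ⟨u, v, w, he, hkk⟩ := hn
      rw [step_ear hP hT1 hk he hkk] at hs
      subst hs
      obtain ⟨s1, s2⟩ := step_S hP hT1 hp hh hk ha he hkk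
      exact ⟨s1, s2, u, w, v, he.toOut hP hT1, hkk, (he.ins hP hT1).symm⟩
    · rw [step_no hn] at hs; exact absurd hs hne
  by_cases hA : AllEars κ p (k + 1) T
  · have hno : ¬ ∃ u v w, Ear T p u v w ∧ κ u v w = k := by
      rintro ⟨u, v, w, he, hkk⟩; have := hA _ _ _ he; omega
    by_cases hn : (∀ a b c, root T p a b c → k + 1 ≤ κ a b c) ∧ ∃ x y v, Out T p x y v ∧ κ x v y = k
    · obtain ⟨hr, x, y, v, he, hkk⟩ := hn
      have hT1 := he.tri hP hT
      have hE := he.ear hP hT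
      have hne : T ≠ insT T p x y v := by
        intro e; have := he.card' hP hT; rw [← e] at this; omega
      rw [← FF_insert hP hT hp hh hk X hA hr he hkk, ← Finset.sum_pair hne]
      symm
      refine Finset.sum_subset ?_ ?_
      · intro T1 h1
        rw [Finset.mem_insert, Finset.mem_singleton] at h1
        rw [Finset.mem_filter, mem_TT]
        rcases h1 with rfl | rfl
        · exact ⟨hT, step_no hno⟩
        · exact ⟨hT1, by rw [step_ear hP hT1 hk hE hkk]; exact he.ear_ins hP hT⟩
      · intro T1 h1 h2
        rw [Finset.mem_filter, mem_TT] at h1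
        rw [Finset.mem_insert, Finset.mem_singleton, not_or] at h2
        unfold FF
        rw [if_neg]
        intro ha
        obtain ⟨-, -, x', y', v', he', hk', e⟩ := other T1 h1.1 h1.2 ha h2.1
        obtain ⟨q1, q2, q3⟩ := out_unique hP hT hp he he' (hk.inj _ (hT.mem2 he.h1) _ (hT.mem3 he.h2) _ (hT.mem3 he.h1) _
          (hT.mem2 he'.h1) _ (hT.mem3 he'.h2) _ (hT.mem3 he'.h1) (by omega))
        subst q1 q2 q3
        exact h2.2 e
    · rw [← FF_same hP hT hp hk X hA hn]
      refine Finset.sum_eq_single T ?_ ?_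
      · intro T1 h1 h2
        rw [Finset.mem_filter, mem_TT] at h1
        unfold FF
        rw [if_neg]
        intro ha
        obtain ⟨-, hr, x', y', v', he', hk', e⟩ := other T1 h1.1 h1.2 ha h2
        exact hn ⟨hr, x', y', v', he', hk'⟩
      · intro h1
        rw [Finset.mem_filter, mem_TT] at h1
        exact absurd ⟨hT, step_no hno⟩ h1
  · have : FF P X κ p (k + 1) T = 0 := if_neg hA
    rw [this]
    refine Finset.sum_eq_zero fun T1 h1 => ?_
    rw [Finset.mem_filter, mem_TT] at h1
    refine if_neg fun ha => hA ?_
    by_cases e : T1 = T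
    · subst e
      intro u v w he
      have h3 := ha u v w he
      rcases Nat.lt_or_ge k (κ u v w) with h4 | h4
      · exact h4
      have h5 : κ u v w = k := by omega
      have h6 := h1.2
      rw [step_ear hP hT hk he h5] at h6
      have h7 := he.card_lt hP hT
      rw [h6] at h7
      omega
    · exact (other T1 h1.1 h1.2 ha e).1

theorem FF_const (hP : Cfg P A B C) (hp : Inn P A B C p) (hh : Ht P h) (hk : Key P h p κ)
    (X : R) (k : ℕ) : ∑ T ∈ TT P A B C, FF P X κ p k T = ∑ T ∈ TT P A B C, X ^ (link T p).card := by
  induction k with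
  | zero =>
    refine Finset.sum_congr rfl fun T hT => ?_
    unfold FF
    rw [if_pos (show AllEars κ p 0 T from fun u v w _ => Nat.zero_le _), Finset.prod_eq_one, mul_one]
    intro e _
    rw [mem_TT] at hT
    rw [mm_big hP hT hp hk 0 (fun _ _ _ _ => Nat.zero_le _)]
    exact phi_neg X fun v _ => Nat.not_lt_zero _
  | succ k ih =>
    rw [← ih, ← Finset.sum_fiberwise_of_maps_to (g := step κ p k) (fun T hT => step_mem hP hk k hT) (FF P X κ p k)]
    exact Finset.sum_congr rfl fun T hT => (FF_step hP (mem_TT.1 hT) hp hh hk X k).symm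

/-- final identity -/
theorem FF_final (hP : Cfg P A B C) (hp : Inn P A B C p) (hh : Ht P h) (hk : Key P h p κ) (X : R) :
    ∃ K, ∑ T ∈ TT P A B C, X ^ (link T p).card =
      ∑ T ∈ TT P A B C with (link T p).card = 3, X ^ 3 * ∏ e ∈ link T p, phi P X κ p T (mm κ p T K) e.1 e.2 := by
  obtain ⟨K, hK⟩ : ∃ K, ∀ a ∈ P, ∀ b ∈ P, ∀ c ∈ P, κ a b c < K := by
    refine ⟨(P ×ˢ P ×ˢ P).sup (fun t => κ t.1 t.2.1 t.2.2) + 1, fun a ha b hb c hc => ?_⟩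
    rw [Nat.lt_succ_iff]
    exact Finset.le_sup (f := fun t : Pt × Pt × Pt => κ t.1 t.2.1 t.2.2) (b := (a, b, c)) (by simp [ha, hb, hc])
  refine ⟨K, ?_⟩
  rw [← FF_const hP hp hh hk X K, Finset.sum_filter]
  refine Finset.sum_congr rfl fun T hT => ?_
  rw [mem_TT] at hT
  unfold FF
  by_cases hc : (link T p).card = 3
  · rw [if_pos hc, hc, if_pos]
    obtain ⟨a, b, c, hr⟩ := hT.root_of_card hP hp hc.le
    intro u v w he
    exact absurd hr (he.not_root hT hP a b c hp)
  · rw [if_neg hc, if_neg]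
    intro ha
    have : ∀ a b c, ¬ root T p a b c := fun a b c hr => hc (hr.card hP hT hp)
    obtain ⟨u, v, w, he⟩ := hT.ear_exists hP hp this
    obtain ⟨m1, m2, m3⟩ := he.mems hT
    have := ha _ _ _ he
    have := hK _ m1 _ m2 _ m3
    omega

end SC

namespace SC
variable {P : Finset Pt} {A B C : Pt} {T : Finset (Pt × Pt × Pt)} {p : Pt}
variable {h : Pt → ℝ} {κ : Pt → Pt → Pt → ℕ}

theorem exists_Key (P : Finset Pt) (h : Pt → ℝ) (p : Pt) : ∃ κ, Key P h p κ := by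
  obtain ⟨cd, hcd⟩ := Set.countable_iff_exists_injOn.1 (P.powerset.countable_toSet)
  let K : Pt → Pt → Pt → ℝ ×ₗ ℕ := fun a b c => toLex (gk h p a b c, cd {a, b, c})
  let κ : Pt → Pt → Pt → ℕ := fun a b c => ((P ×ˢ P ×ˢ P).filter (fun t => K t.1 t.2.1 t.2.2 < K a b c)).card
  have mono : ∀ a ∈ P, ∀ b ∈ P, ∀ c ∈ P, ∀ a' ∈ P, ∀ b' ∈ P, ∀ c' ∈ P, K a b c < K a' b' c' →
      κ a b c < κ a' b' c' := by
    intro a ha b hb c hc a' ha' b' hb' c' hc' hlt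
    refine Finset.card_lt_card ((Finset.ssubset_iff_of_subset ?_).2 ⟨(a, b, c), ?_, ?_⟩)
    · intro t ht
      rw [Finset.mem_filter] at ht ⊢
      exact ⟨ht.1, ht.2.trans hlt⟩
    · simp [ha, hb, hc, hlt]
    · simp
  refine ⟨κ, ?_, ?_, ?_⟩
  · intro a b c
    have : K b c a = K a b c := by
      simp only [K, gk_rot]
      congr 3
      ext x; simp only [Finset.mem_insert, Finset.mem_singleton]; tauto
    simp only [κ, this]
  · intro a ha b hb c hc a' ha' b' hb' c' hc' hlt
    exact mono a ha b hb c hc a' ha' b' hb' c' hc' (Prod.Lex.toLex_lt_toLex.2 (Or.inl hlt))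
  · intro a ha b hb c hc a' ha' b' hb' c' hc' he
    have : K a b c = K a' b' c' := by
      rcases lt_trichotomy (K a b c) (K a' b' c') with h1 | h1 | h1
      · exact absurd (mono _ ha _ hb _ hc _ ha' _ hb' _ hc' h1) (by omega)
      · exact h1
      · exact absurd (mono _ ha' _ hb' _ hc' _ ha _ hb _ hc h1) (by omega)
    have h2 := (Prod.ext_iff.1 (toLex.injective this)).2
    refine hcd ?_ ?_ h2
    · simp only [Finset.coe_powerset, Set.mem_preimage, Set.mem_powerset_iff, Finset.coe_subset]
      intro x; simp only [Finset.mem_insert, Finset.mem_singleton]; rintro (rfl | rfl | rfl) <;> assumption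
    · simp only [Finset.coe_powerset, Set.mem_preimage, Set.mem_powerset_iff, Finset.coe_subset]
      intro x; simp only [Finset.mem_insert, Finset.mem_singleton]; rintro (rfl | rfl | rfl) <;> assumption

open Polynomial in
theorem exists_Ht {E : Pt} (hP : Cfg P A B E) : ∃ h, Ht P h := by
  obtain ⟨i, hi⟩ := Set.countable_iff_exists_injOn.1 (P.countable_toSet)
  let H : ℝ → Pt → ℝ := fun t x => x.1 ^ 2 + x.2 ^ 2 + t ^ (i x + 1)
  have key : ∀ u ∈ P, ∀ v ∈ P, ∀ w ∈ P, ∀ z ∈ P, ∀ᶠ t in nhdsWithin (0:ℝ) (Set.Ioi 0),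
      ((u ≠ v → u ≠ w → u ≠ z → v ≠ w → v ≠ z → w ≠ z → DD (H t) u v w z ≠ 0) ∧
      (inTri u v w z → 0 < DD (H t) u v w z)) := by
    intro u mu v mv w mw z mz
    refine Filter.Eventually.and ?_ ?_
    · by_cases hd : u ≠ v ∧ u ≠ w ∧ u ≠ z ∧ v ≠ w ∧ v ≠ z ∧ w ≠ z
      · obtain ⟨n1, n2, n3, n4, n5, n6⟩ := hd
        let q : ℝ[X] := Polynomial.C (DD (fun x => x.1 ^ 2 + x.2 ^ 2) u v w z) + Polynomial.C (o u w z) * Polynomial.X ^ (i v + 1) +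
          Polynomial.C (o u z v) * Polynomial.X ^ (i w + 1) + Polynomial.C (o u v w) * Polynomial.X ^ (i z + 1) - Polynomial.C (o v w z) * Polynomial.X ^ (i u + 1)
        have hq : q ≠ 0 := by
          intro h0
          have := congrArg (fun r => r.coeff (i v + 1)) h0
          have e1 : i v ≠ i w := fun e => n4 (hi mv mw e)
          have e2 : i v ≠ i z := fun e => n5 (hi mv mz e)
          have e3 : i v ≠ i u := fun e => n1 (hi mv mu e).symm
          simp [q, coeff_X_pow, coeff_C, e1, e2, e3] at this
          exact hP.gp u mu w mw z mz n2 n3 n6 this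
        have hf : {t | q.IsRoot t}.Finite := Polynomial.finite_setOf_isRoot hq
        have : ∀ᶠ t in nhdsWithin (0:ℝ) (Set.Ioi 0), t ∉ {t | q.IsRoot t} \ {0} := by
          refine Filter.Eventually.filter_mono nhdsWithin_le_nhds ?_
          exact (hf.subset Set.diff_subset).isClosed.isOpen_compl.mem_nhds (by simp)
        filter_upwards [this, self_mem_nhdsWithin] with t ht ht0
        intro _ _ _ _ _ _ h0
        refine ht ⟨?_, (Set.mem_Ioi.1 ht0).ne'⟩
        simp only [Set.mem_setOf_eq, IsRoot.def, q]
        rw [← h0]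
        simp only [eval_sub, eval_add, eval_mul, eval_C, eval_pow, eval_X, DD, H]
        ring
      · exact Filter.Eventually.of_forall fun t a b c d e f => absurd ⟨a, b, c, d, e, f⟩ hd
    · by_cases hin : inTri u v w z
      · have hc : Continuous fun t => DD (H t) u v w z := by unfold DD; fun_prop
        have h0 : 0 < DD (H 0) u v w z := by
          have e : DD (H 0) u v w z = o u w z * ((v.1 - u.1) ^ 2 + (v.2 - u.2) ^ 2) +
              o u z v * ((w.1 - u.1) ^ 2 + (w.2 - u.2) ^ 2) + o u v w * ((z.1 - u.1) ^ 2 + (z.2 - u.2) ^ 2) := by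
            simp only [DD, H, o, ne_eq, Nat.add_eq_zero_iff, one_ne_zero, and_false, not_false_eq_true, zero_pow]
            ring
          obtain ⟨p1, p2, p3⟩ := hin
          have : 0 < (v.1 - u.1) ^ 2 + (v.2 - u.2) ^ 2 := by
            by_contra hcon
            have a1 : v.1 - u.1 = 0 := by nlinarith [sq_nonneg (v.1 - u.1), sq_nonneg (v.2 - u.2)]
            have a2 : v.2 - u.2 = 0 := by nlinarith [sq_nonneg (v.1 - u.1), sq_nonneg (v.2 - u.2)]
            exact (ne_of_o_pos p1).1 (Prod.ext (by linarith) (by linarith))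
          rw [e]
          positivity
        have := hc.continuousAt.eventually (lt_mem_nhds h0)
        filter_upwards [Filter.Eventually.filter_mono nhdsWithin_le_nhds this] with t ht _ using ht
      · exact Filter.Eventually.of_forall fun t a => absurd a hin
  have : ∀ᶠ t in nhdsWithin (0:ℝ) (Set.Ioi 0), ∀ u ∈ P, ∀ v ∈ P, ∀ w ∈ P, ∀ z ∈ P,
      ((u ≠ v → u ≠ w → u ≠ z → v ≠ w → v ≠ z → w ≠ z → DD (H t) u v w z ≠ 0) ∧
      (inTri u v w z → 0 < DD (H t) u v w z)) := by
    simp only [Filter.eventually_all_finset]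
    exact key
  obtain ⟨t, ht⟩ := this.exists
  exact ⟨H t, by
    constructor
    · intro u mu v mv w mw z mz a b c d e f; exact (ht u mu v mv w mw z mz).1 a b c d e f
    · intro u mu v mv w mw z mz a; exact (ht u mu v mv w mw z mz).2 a⟩

end SC

namespace SC
variable {P : Finset Pt} {A B C : Pt} {T : Finset (Pt × Pt × Pt)} {p : Pt}
variable {h : Pt → ℝ} {κ : Pt → Pt → Pt → ℕ}

inductive Tr : ℕ → ℕ → Prop
  | one : Tr 1 0
  | node {a b c d : ℕ} (h1 : Tr a b) (h2 : Tr c d) : Tr (1 + a * c) (a * c + b * c + a * d)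

theorem Tr.pos {n s : ℕ} (h : Tr n s) : 1 ≤ n := by cases h <;> omega

theorem Tr.small {n s : ℕ} (h : Tr n s) : (n = 2 → 1 ≤ s) ∧ (n = 3 → 3 ≤ s) ∧ (n = 4 → 6 ≤ s) := by
  induction h with
  | one => simp
  | @node a b c d h1 h2 ih1 ih2 =>
    have p1 := h1.pos
    have p2 := h2.pos
    refine ⟨fun e => ?_, fun e => ?_, fun e => ?_⟩
    · have : a * c = 1 := by omega
      omega
    · have e1 : a * c = 2 := by omega
      have l1 : a ≤ 2 := by nlinarith
      have l2 : c ≤ 2 := by nlinarith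
      interval_cases a <;> interval_cases c <;> simp at e1 ih1 ih2 ⊢ <;> omega
    · have e1 : a * c = 3 := by omega
      have l1 : a ≤ 3 := by nlinarith
      have l2 : c ≤ 3 := by nlinarith
      interval_cases a <;> interval_cases c <;> simp at e1 ih1 ih2 ⊢ <;> omega

theorem log_tan (x c : ℝ) (hx : 0 < x) (hc : 0 < c) : Real.log x ≤ Real.log c + x / c - 1 := by
  have := Real.log_le_sub_one_of_pos (div_pos hx hc)
  rw [Real.log_div hx.ne' hc.ne'] at this
  linarith

theorem Tr.log {n s : ℕ} (h : Tr n s) : (n : ℝ) * Real.log n ≤ n * Real.log 1.32 + Real.log 2.31 * s := by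
  have l132 : (0:ℝ) ≤ Real.log 1.32 := Real.log_nonneg (by norm_num)
  have l231 : (0:ℝ) ≤ Real.log 2.31 := Real.log_nonneg (by norm_num)
  have cmp : ∀ (x y : ℝ) (i j k : ℕ), 0 < x → x ^ i ≤ 1.32 ^ j * 2.31 ^ k → 
      i * Real.log x ≤ j * Real.log 1.32 + k * Real.log 2.31 := by
    intro x y i j k hx hle
    have := Real.log_le_log (by positivity) hle
    rw [Real.log_mul (by positivity) (by positivity), Real.log_pow, Real.log_pow, Real.log_pow] at this
    exact this
  induction h with
  | one => simp; exact l132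
  | @node a b c d h1 h2 ih1 ih2 =>
    have hs := (Tr.node h1 h2).small
    have p1 := h1.pos
    have p2 := h2.pos
    have hq : 1 ≤ a * c := Nat.mul_pos p1 p2
    by_cases h4 : a * c < 4
    · generalize hS : a * c + b * c + a * d = S at *
      generalize hN : a * c = q at *
      have mono : ∀ k : ℕ, k ≤ S → Real.log 2.31 * k ≤ Real.log 2.31 * S := by
        intro k hk
        exact mul_le_mul_of_nonneg_left (by exact_mod_cast hk) l231
      interval_cases q
      · have := hs.1 rfl
        have m := mono _ this
        have := cmp 2 0 2 2 1 (by norm_num) (by norm_num)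
        push_cast at this m ⊢
        norm_num at this m ⊢
        linarith
      · have := hs.2.1 rfl
        have m := mono _ this
        have := cmp 3 0 3 3 3 (by norm_num) (by norm_num)
        push_cast at this m ⊢
        norm_num at this m ⊢
        linarith
      · have := hs.2.2 rfl
        have m := mono _ this
        have := cmp 4 0 4 4 6 (by norm_num) (by norm_num)
        push_cast at this m ⊢
        norm_num at this m ⊢
        linarith
    · have hq4 : (4:ℝ) ≤ (a:ℝ) * c := by exact_mod_cast not_lt.1 h4
      have a0 : (0:ℝ) < a := by exact_mod_cast p1
      have c0 : (0:ℝ) < c := by exact_mod_cast p2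
      push_cast
      set q : ℝ := (a:ℝ) * c with hqd
      have lq : Real.log q = Real.log a + Real.log c := Real.log_mul a0.ne' c0.ne'
      have q0 : 0 < q := by linarith
      have j1 : q * Real.log q ≤ q * (2 * Real.log 1.32) + Real.log 2.31 * (b * c + a * d) := by
        rw [lq, hqd]
        have := mul_le_mul_of_nonneg_left ih1 c0.le
        have := mul_le_mul_of_nonneg_left ih2 a0.le
        nlinarith
      have t1 := log_tan (1 + q) 5 (by linarith) (by norm_num)
      have t2 := log_tan ((1 + q) / q) (5 / 4) (by positivity) (by norm_num)
      rw [Real.log_div (by positivity) q0.ne', Real.log_div (by norm_num) (by norm_num)] at t2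
      have t3 := mul_le_mul_of_nonneg_left t2 q0.le
      have e3 : q * (Real.log 5 - Real.log 4 + (1 + q) / q / (5 / 4) - 1) = 
        q * (Real.log 5 - Real.log 4) + (1 + q) * 4 / 5 - q := by field_simp
      rw [e3] at t3
      have n1 : 5 * Real.log 5 + 3 * Real.log 1.32 ≤ 4 * Real.log 2.31 + 4 * Real.log 4 := by
        have := Real.log_le_log (x := 5 ^ 5 * 1.32 ^ 3) (y := 2.31 ^ 4 * 4 ^ 4) (by positivity) (by norm_num)
        rw [Real.log_mul (by positivity) (by positivity), Real.log_mul (by positivity) (by positivity),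
          Real.log_pow, Real.log_pow, Real.log_pow, Real.log_pow] at this
        push_cast at this
        exact this
      have n2 : Real.log 5 + Real.log 1.32 ≤ Real.log 2.31 + Real.log 4 := by
        rw [← Real.log_mul (by positivity) (by positivity), ← Real.log_mul (by positivity) (by positivity)]
        exact Real.log_le_log (by positivity) (by norm_num)
      have n3 := mul_nonneg (sub_nonneg.2 hq4) (sub_nonneg.2 n2)
      nlinarith

theorem log231 : (0.8309:ℝ) ≤ Real.log 2.31 := by
  have h1 : Real.log 2 + 2 * Real.log 1.0747 ≤ Real.log 2.31 := by
    have := Real.log_le_log (x := 2 * 1.0747 ^ 2) (y := 2.31) (by positivity) (by norm_num)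
    rw [Real.log_mul (by positivity) (by positivity), Real.log_pow] at this
    push_cast at this
    exact this
  have h2 := Real.log_two_gt_d9
  have h3 := Real.one_sub_inv_le_log_of_pos (x := 1.0747) (by norm_num)
  norm_num at h3 h2 ⊢
  linarith

theorem Tr.three {n1 s1 n2 s2 n3 s3 : ℕ} (h1 : Tr n1 s1) (h2 : Tr n2 s2) (h3 : Tr n3 s3) :
    4 * ((n1:ℝ) * n2 * n3) - (s1 * n2 * n3 + n1 * s2 * n3 + n1 * n2 * s3) ≤ 29 := by
  have a1 : (0:ℝ) < n1 := by exact_mod_cast h1.pos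
  have a2 : (0:ℝ) < n2 := by exact_mod_cast h2.pos
  have a3 : (0:ℝ) < n3 := by exact_mod_cast h3.pos
  have e : 4 * ((n1:ℝ) * n2 * n3) - (s1 * n2 * n3 + n1 * s2 * n3 + n1 * n2 * s3) =
    n1 * n2 * n3 * (4 - (s1 / n1 + s2 / n2 + s3 / n3)) := by field_simp
  rw [e]
  set M : ℝ := s1 / n1 + s2 / n2 + s3 / n3 with hM
  have l := fun {n s : ℕ} (h : Tr n s) => h.log
  have lg : ∀ {n s : ℕ}, Tr n s → Real.log n ≤ Real.log 1.32 + Real.log 2.31 * (s / n) := by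
    intro n s h
    have a : (0:ℝ) < n := by exact_mod_cast h.pos
    have := h.log
    rw [← mul_le_mul_iff_right₀ a]
    have e : (n:ℝ) * (Real.log 1.32 + Real.log 2.31 * (s / n)) = n * Real.log 1.32 + Real.log 2.31 * s := by field_simp
    rw [e]; exact this
  by_cases hy : 4 - M ≤ 0
  · have := mul_nonneg (mul_pos (mul_pos a1 a2) a3).le (neg_nonneg.2 hy)
    linarith
  push Not at hy
  have L0 := log231
  have b1 : Real.log (n1 * n2 * n3) ≤ 3 * Real.log 1.32 + Real.log 2.31 * M := by
    rw [Real.log_mul (by positivity) (by positivity), Real.log_mul (by positivity) (by positivity)]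
    have := lg h1; have := lg h2; have := lg h3
    rw [hM]; linarith
  have b2 : Real.log (4 - M) ≤ Real.log 2.31 * (4 - M) - 1 - Real.log (Real.log 2.31) := by
    have := Real.log_le_sub_one_of_pos (x := Real.log 2.31 * (4 - M)) (by positivity)
    rw [Real.log_mul (by positivity) (by positivity)] at this
    linarith
  have b3 : 3 * Real.log 1.32 + 4 * Real.log 2.31 ≤ Real.log 29 + 1 + Real.log (Real.log 2.31) := by
    have i1 : Real.log (1.32 ^ 3 * 2.31 ^ 4) ≤ Real.log (29 * Real.exp 1 * Real.log 2.31) := by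
      refine Real.log_le_log (by positivity) ?_
      have := Real.exp_one_gt_d9
      have : (2.718:ℝ) * 0.8309 ≤ Real.exp 1 * Real.log 2.31 := by
        refine mul_le_mul (by linarith) L0 (by norm_num) (by positivity)
      norm_num at this ⊢
      linarith
    rw [Real.log_mul (by positivity) (by positivity), Real.log_pow, Real.log_pow,
      Real.log_mul (by positivity) (by positivity), Real.log_mul (by positivity) (by positivity), Real.log_exp] at i1
    push_cast at i1
    exact i1
  have hpos : 0 < (n1:ℝ) * n2 * n3 * (4 - M) := by positivity
  rw [← Real.log_le_log_iff hpos (by norm_num), Real.log_mul (by positivity) (by positivity)]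
  linarith

open TrivSqZeroExt in
/-- the value 1 + ε -/
def XX : DualNumber ℝ := 1 + DualNumber.eps

theorem phi_Tr (hP : Cfg P A B C) (hT : Tri P A B C T) (m : ℕ) : ∀ x y, ∃ n s : ℕ, Tr n s ∧
    phi P XX κ p T m x y = TrivSqZeroExt.inl (n:ℝ) + TrivSqZeroExt.inr (s:ℝ) := by
  induction m using Nat.strong_induction_on with
  | _ m ih =>
    intro x y
    by_cases hc : ∃ v, pc T p x y v ∧ κ x v y < m
    · obtain ⟨v, h1, h2⟩ := hc
      rw [phi_pos hP hT XX h1 h2]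
      obtain ⟨a, b, h3, e1⟩ := ih _ h2 x v
      obtain ⟨c, d, h4, e2⟩ := ih _ h2 v y
      refine ⟨_, _, Tr.node h3 h4, ?_⟩
      rw [e1, e2]
      ext
      · simp [XX]
      · simp [XX]; ring
    · refine ⟨1, 0, Tr.one, ?_⟩
      rw [phi_neg]
      · simp
      · intro v h1 h2; exact hc ⟨v, h1, h2⟩

theorem XX_pow (k : ℕ) : XX ^ k = TrivSqZeroExt.inl 1 + TrivSqZeroExt.inr (k:ℝ) := by
  induction k with
  | zero => simp
  | succ k ih =>
    rw [pow_succ, ih]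
    ext
    · simp [XX]
    · simp [XX]; ring

/-- summing charges at p -/
theorem charge (hP : Cfg P A B C) (hp : Inn P A B C p) :
    ∑ T ∈ TT P A B C, (7 - ((link T p).card : ℝ)) ≤ 29 * ((TT P A B C).filter (fun T => (link T p).card = 3)).card := by
  obtain ⟨h, hh⟩ := exists_Ht hP
  obtain ⟨κ, hk⟩ := exists_Key P h p
  obtain ⟨K, hK⟩ := FF_final hP hp hh hk XX
  let f : DualNumber ℝ →+ ℝ := AddMonoidHom.mk' (fun x => 7 * x.fst - x.snd) (by intro a b; simp; ring)
  have := congrArg f hK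
  rw [map_sum, map_sum] at this
  have e1 : ∀ k : ℕ, f (XX ^ k) = 7 - k := by
    intro k; rw [XX_pow]; simp [f]
  simp only [e1] at this
  rw [this, mul_comm, ← nsmul_eq_mul]
  refine Finset.sum_le_card_nsmul _ _ _ fun T hT => ?_
  rw [Finset.mem_filter, mem_TT] at hT
  obtain ⟨hT, hc⟩ := hT
  obtain ⟨a, b, c, hr⟩ := hT.root_of_card hP hp hc.le
  rw [hr.link_eq hP hT hp]
  obtain ⟨n1, n2, n3⟩ := ne_of_o_pos (hr.pos hT)
  rw [Finset.prod_insert (by simp [n1, n2]), Finset.prod_insert (by simp [n3]), Finset.prod_singleton]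
  obtain ⟨x1, y1, t1, q1⟩ := phi_Tr (κ := κ) (p := p) hP hT (mm κ p T K) a b
  obtain ⟨x2, y2, t2, q2⟩ := phi_Tr (κ := κ) (p := p) hP hT (mm κ p T K) b c
  obtain ⟨x3, y3, t3, q3⟩ := phi_Tr (κ := κ) (p := p) hP hT (mm κ p T K) c a
  rw [q1, q2, q3, XX_pow]
  refine le_trans (le_of_eq ?_) (Tr.three t1 t2 t3)
  simp [f]
  ring

end SC

namespace SC
variable {P : Finset Pt} {A B C : Pt} {T : Finset (Pt × Pt × Pt)} {p : Pt}

/-- the inner points -/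
def inn (P : Finset Pt) (A B C : Pt) : Finset Pt := P \ {A, B, C}

theorem mem_inn : p ∈ inn P A B C ↔ p ∈ P ∧ p ≠ A ∧ p ≠ B ∧ p ≠ C := by
  unfold inn; simp

theorem Inn_iff : Inn P A B C p ↔ p ∈ inn P A B C := by
  rw [mem_inn]; exact ⟨fun h => ⟨h.mem, h.nA, h.nB, h.nC⟩, fun h => ⟨h.1, h.2.1, h.2.2.1, h.2.2.2⟩⟩

theorem exists_dir (P : Finset Pt) : ∃ d : Pt, d ≠ 0 ∧ ∀ a ∈ P, ∀ b ∈ P, a ≠ b → sd d a b ≠ 0 := by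
  obtain ⟨q, -, hq⟩ := exists_generic isOpen_univ Set.univ_nonempty
    (insert ((0, 0), (1, 0)) ((P ×ˢ P).image (fun e => ((0 : Pt), e.2 - e.1))))
  refine ⟨q, ?_, ?_⟩
  · rintro rfl
    refine hq ((0, 0), (1, 0)) (by simp) (by simp) ?_
    simp [o]
  · intro a ha b hb hab h0
    refine hq (0, b - a) ?_ ?_ ?_
    · refine Finset.mem_insert_of_mem (Finset.mem_image.2 ⟨(a, b), by simp [ha, hb], rfl⟩)
    · exact fun e => hab (sub_eq_zero.1 e.symm).symm
    · unfold sd at h0; unfold o; simp; linarith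

theorem sd_neg (d q x : Pt) : sd (-d) q x = - sd d q x := by unfold sd; simp; ring

theorem Tri.card_hc (hP : Cfg P A B C) (h : Tri P A B C T) {d : Pt} (hd0 : d ≠ 0)
    (hd : ∀ a ∈ P, ∀ b ∈ P, a ≠ b → sd d a b ≠ 0) :
    (T.card : ℤ) = 3 * ∑ q ∈ P, (hc d A B C q + hc (-d) A B C q) := by
  let m : Pt × Pt × Pt → ℤ := fun t => (if sd d t.1 t.2.1 < 0 ∧ 0 ≤ sd d t.1 t.2.2 then 1 else 0) +
    (if sd (-d) t.1 t.2.1 < 0 ∧ 0 ≤ sd (-d) t.1 t.2.2 then 1 else 0)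
  have e1 : ∑ t ∈ T, m t = ∑ q ∈ P, (hc d A B C q + hc (-d) A B C q) := by
    rw [← Finset.sum_fiberwise_of_maps_to (g := fun t : Pt × Pt × Pt => t.1) (t := P) (fun t ht => h.mem _ _ _ ht)]
    refine Finset.sum_congr rfl fun q hq => ?_
    rw [← h.vc hP hd0 hq, ← h.vc hP (neg_ne_zero.2 hd0) hq]
    rw [Finset.sum_add_distrib, Finset.card_filter, Finset.card_filter]
    push_cast
    rw [Finset.sum_filter, Finset.sum_filter]
    congr 1 <;>
    · refine Finset.sum_congr rfl fun t ht => ?_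
      by_cases e : t.1 = q
      · subst e; simp
      · simp [e]
  have e2 : ∑ t ∈ T, (m t + m (t.2.1, t.2.2, t.1) + m (t.2.2, t.1, t.2.1)) = T.card := by
    rw [Finset.card_eq_sum_ones]
    push_cast
    refine Finset.sum_congr rfl ?_
    rintro ⟨a, b, c⟩ ht
    obtain ⟨n1, n2, n3⟩ := ne_of_o_pos (h.pos _ _ _ ht)
    have ha := h.mem _ _ _ ht
    have hb := h.mem2 ht
    have hc := h.mem3 ht
    have q1 := hd a ha b hb n1
    have q2 := hd a ha c hc n2
    have q3 := hd b hb c hc n3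
    simp only [m, sd_neg]
    have r1 : sd d b a = - sd d a b := by unfold sd; ring
    have r2 : sd d c a = - sd d a c := by unfold sd; ring
    have r3 : sd d c b = - sd d b c := by unfold sd; ring
    have r4 : sd d a c = sd d a b + sd d b c := by unfold sd; ring
    rw [r1, r2, r3]
    generalize sd d a b = x at *
    generalize sd d b c = y at *
    generalize sd d a c = z at *
    subst r4
    rcases lt_or_gt_of_ne q1 with g1 | g1 <;> rcases lt_or_gt_of_ne q2 with g2 | g2 <;>
      rcases lt_or_gt_of_ne q3 with g3 | g3 <;>
      first
      | (exfalso; linarith)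
      | (simp only [g1, g2, g3, neg_neg, Left.neg_neg_iff, not_lt.2 g1.le, not_lt.2 g2.le, not_lt.2 g3.le, not_le.2 g1, not_le.2 g2, not_le.2 g3,
          neg_nonneg, true_and, and_true, false_and, and_false, if_true, if_false, g1.le, g2.le, g3.le]; norm_num)
  have e3 := sum_rot h.rot m
  have e4 := sum_rot h.rot (fun t => m (t.2.1, t.2.2, t.1))
  rw [Finset.sum_add_distrib, Finset.sum_add_distrib] at e2
  simp only at e4
  rw [← e1]
  linarith

theorem Cfg.base (hP : Cfg P A B C) : Cfg {A, B, C} A B C := by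
  refine ⟨by simp, by simp, by simp, hP.abc, ?_, ?_⟩
  · have sub : ∀ x ∈ ({A, B, C} : Finset Pt), x ∈ P := by
      intro x hx; simp only [Finset.mem_insert, Finset.mem_singleton] at hx
      rcases hx with rfl | rfl | rfl
      exacts [hP.hA, hP.hB, hP.hC]
    intro a ha b hb c hc
    exact hP.gp a (sub a ha) b (sub b hb) c (sub c hc)
  · intro q hq h1 h2 h3
    simp [h1, h2, h3] at hq

theorem Tri.base (hP : Cfg P A B C) : Tri {A, B, C} A B C (rot3 A B C) := by
  obtain ⟨n1, n2, n3⟩ := ne_of_o_pos hP.abc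
  have pos : ∀ a b c, (a, b, c) ∈ rot3 A B C → 0 < o a b c := by
    intro a b c h
    rw [mem_rot3] at h
    rcases h with h | h | h <;> (simp only [Prod.mk.injEq] at h; obtain ⟨rfl, rfl, rfl⟩ := h)
    · exact hP.abc
    · rw [o_rot]; exact hP.abc
    · rw [o_rot']; exact hP.abc
  refine ⟨?_, ?_, pos, ?_, ?_⟩
  · intro a b c h
    rw [mem_rot3] at h
    rcases h with h | h | h <;> (simp only [Prod.mk.injEq] at h; simp [h.1])
  · intro a b c h
    rw [mem_rot3] at h ⊢
    simp only [Prod.mk.injEq] at h ⊢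
    tauto
  · intro a b c h q hq hin
    obtain ⟨i1, i2, i3⟩ := hin
    rw [mem_rot3] at h
    simp only [Finset.mem_insert, Finset.mem_singleton] at hq
    rcases h with h | h | h <;> (simp only [Prod.mk.injEq] at h; obtain ⟨rfl, rfl, rfl⟩ := h) <;>
      rcases hq with rfl | rfl | rfl <;>
      simp only [o_self, o_self', o_self'', lt_irrefl] at i1 i2 i3
  · intro f hf
    rw [sum_rot3 n1 n2 n3]

theorem Tri.card_eq (hP : Cfg P A B C) (h : Tri P A B C T) : T.card = 6 * (inn P A B C).card + 3 := by
  obtain ⟨d, hd0, hd⟩ := exists_dir P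
  obtain ⟨n1, n2, n3⟩ := ne_of_o_pos hP.abc
  have sub : ({A, B, C} : Finset Pt) ⊆ P := by
    intro x hx; simp only [Finset.mem_insert, Finset.mem_singleton] at hx
    rcases hx with rfl | rfl | rfl
    exacts [hP.hA, hP.hB, hP.hC]
  have h1 := h.card_hc hP hd0 hd
  have h2 := (Tri.base hP).card_hc hP.base hd0 (fun a ha b hb => hd a (sub ha) b (sub hb))
  have h3 : (rot3 A B C).card = 3 := card_rot3 n1 n2 n3
  rw [h3] at h2
  rw [← Finset.sum_sdiff sub] at h1
  have h4 : ∑ q ∈ P \ {A, B, C}, (hc d A B C q + hc (-d) A B C q) = 2 * (inn P A B C).card := by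
    rw [Finset.sum_congr rfl (g := fun _ => (2:ℤ))]
    · simp [inn]; ring
    · intro q hq
      obtain ⟨a, b, c, e⟩ := mem_inn.1 hq
      rw [hc_interior hP hd0 a b c e, hc_interior hP (neg_ne_zero.2 hd0) a b c e]; norm_num
  rw [h4] at h1
  push_cast at h2
  omega

theorem Tri.sum_deg_all (h : Tri P A B C T) : ∑ q ∈ P, (link T q).card = T.card := by
  rw [Finset.card_eq_sum_card_fiberwise (f := fun t : Pt × Pt × Pt => t.1) (t := P) (fun t ht => h.mem _ _ _ ht)]
  exact Finset.sum_congr rfl fun q _ => card_link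

theorem Tri.sum_deg (hP : Cfg P A B C) (h : Tri P A B C T) :
    ∑ q ∈ inn P A B C, (link T q).card ≤ 6 * (inn P A B C).card := by
  have h1 := h.sum_deg_all
  rw [h.card_eq hP] at h1
  obtain ⟨n1, n2, n3⟩ := ne_of_o_pos hP.abc
  have sub : ({A, B, C} : Finset Pt) ⊆ P := by
    intro x hx; simp only [Finset.mem_insert, Finset.mem_singleton] at hx
    rcases hx with rfl | rfl | rfl
    exacts [hP.hA, hP.hB, hP.hC]
  rw [← Finset.sum_sdiff sub] at h1
  have h2 : 3 ≤ ∑ q ∈ ({A, B, C} : Finset Pt), (link T q).card := by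
    rw [Finset.sum_insert (by simp [n1, n2]), Finset.sum_insert (by simp [n3]), Finset.sum_singleton]
    have pos : ∀ u v, hullE A B C u v → 1 ≤ (link T u).card := by
      intro u v huv
      obtain ⟨z, hz⟩ := (h.hull_edge hP huv).1
      exact Finset.card_pos.2 ⟨_, mem_link.2 hz⟩
    have a := pos A B (Or.inl ⟨rfl, rfl⟩)
    have b := pos B C (Or.inr (Or.inl ⟨rfl, rfl⟩))
    have c := pos C A (Or.inr (Or.inr ⟨rfl, rfl⟩))
    omega
  unfold inn at h1 ⊢
  omega

theorem root.only2 (hP : Cfg P A B C) (hT : Tri P A B C T) (hp : Inn P A B C p) {a b c x y : Pt}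
    (hr : root T p a b c) (hxy : (p, x, y) ∈ T) : (x = a ∧ y = b) ∨ (x = b ∧ y = c) ∨ (x = c ∧ y = a) := by
  have := mem_link.2 hxy
  rw [root.link_eq hP hT hp hr] at this
  simpa only [Finset.mem_insert, Finset.mem_singleton, Prod.mk.injEq] using this

theorem card_deg3_le (hP : Cfg P A B C) (hp : Inn P A B C p) :
    ((TT P A B C).filter (fun T => (link T p).card = 3)).card ≤ (TT (P.erase p) A B C).card := by
  have hr : ∀ T ∈ (TT P A B C).filter (fun T => (link T p).card = 3), ∃ e : Pt × Pt × Pt, root T p e.1 e.2.1 e.2.2 := by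
    intro T hT
    rw [Finset.mem_filter, mem_TT] at hT
    obtain ⟨a, b, c, h⟩ := hT.1.root_of_card hP hp hT.2.le
    exact ⟨(a, b, c), h⟩
  choose! e he using hr
  refine Finset.card_le_card_of_injOn (fun T => mergeT T p (e T).1 (e T).2.1 (e T).2.2) ?_ ?_
  · intro T hT
    have hT' := hT
    rw [Finset.mem_coe, Finset.mem_filter, mem_TT] at hT
    have hr := he T hT'
    rw [Finset.mem_coe, mem_TT]
    exact hT.1.merge hP hr.1 hr.2.1 hr.2.2 (fun x y hxy => root.only2 hP hT.1 hp hr hxy)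
  · -- mergeT is injective
    have key : ∀ T ∈ (TT P A B C).filter (fun T => (link T p).card = 3),
        inTri p (e T).1 (e T).2.1 (e T).2.2 ∧ Tri (P.erase p) A B C (mergeT T p (e T).1 (e T).2.1 (e T).2.2) ∧
        ((e T).1, (e T).2.1, (e T).2.2) ∈ mergeT T p (e T).1 (e T).2.1 (e T).2.2 ∧
        splitT (mergeT T p (e T).1 (e T).2.1 (e T).2.2) p (e T).1 (e T).2.1 (e T).2.2 = T := by
      intro T hT
      have hr := he T hT
      rw [Finset.mem_filter, mem_TT] at hT
      obtain ⟨hT, -⟩ := hT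
      generalize (e T).1 = a at *
      generalize (e T).2.1 = b at *
      generalize (e T).2.2 = c at *
      obtain ⟨r1, r2, r3⟩ := hr
      have i : inTri p a b c := ⟨hT.pos _ _ _ r1, hT.pos _ _ _ r2, hT.pos _ _ _ r3⟩
      refine ⟨i, hT.merge hP r1 r2 r3 (fun x y hxy => root.only2 hP hT hp ⟨r1, r2, r3⟩ hxy), ?_, ?_⟩
      · unfold mergeT; rw [Finset.mem_union]; right; rw [mem_rot3]; exact Or.inl rfl
      · have hno : ∀ t ∈ rot3 a b c, t ∉ T := by
          rintro ⟨x, y, z⟩ ht hm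
          rw [mem_rot3] at ht
          refine hT.emp _ _ _ hm p hp.mem ?_
          rcases ht with ht | ht | ht <;> (simp only [Prod.mk.injEq] at ht; obtain ⟨rfl, rfl, rfl⟩ := ht)
          · exact i
          · exact ⟨i.2.1, i.2.2, i.1⟩
          · exact ⟨i.2.2, i.1, i.2.1⟩
        have hsub : rot3 p a b ∪ (rot3 p b c ∪ rot3 p c a) ⊆ T := by
          intro t ht
          simp only [Finset.mem_union, mem_rot3] at ht
          rcases ht with (rfl | rfl | rfl) | (rfl | rfl | rfl) | (rfl | rfl | rfl)
          exacts [r1, hT.rot _ _ _ r1, hT.rot2 r1, r2, hT.rot _ _ _ r2, hT.rot2 r2, r3, hT.rot _ _ _ r3, hT.rot2 r3]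
        unfold splitT mergeT
        ext t
        simp only [Finset.mem_union, Finset.mem_sdiff] at hsub ⊢
        have s1 := hno t
        have s2 := @hsub t
        simp only [Finset.mem_union] at s2
        tauto
    intro T1 h1 T2 h2 heq
    simp only at heq
    obtain ⟨i1, t1, m1, s1⟩ := key T1 h1
    obtain ⟨i2, t2, m2, s2⟩ := key T2 h2
    rw [← heq] at m2 s2
    have hu := t1.cover_unique (hP.erase hp.nA hp.nB hp.nC) (hP.gen hp.mem) m1 m2 i1 i2
    rw [← s1, ← s2]
    generalize (e T1).1 = a at *
    generalize (e T1).2.1 = b at *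
    generalize (e T1).2.2 = c at *
    generalize (e T2).1 = a' at *
    generalize (e T2).2.1 = b' at *
    generalize (e T2).2.2 = c' at *
    rw [mem_rot3] at hu
    rcases hu with ht | ht | ht <;> (simp only [Prod.mk.injEq] at ht; obtain ⟨rfl, rfl, rfl⟩ := ht)
    · rfl
    · unfold splitT; congr 1
      · rw [← rot3_rot]
      · ext t; simp only [Finset.mem_union]; tauto
    · unfold splitT; congr 1
      · rw [rot3_rot]
      · ext t; simp only [Finset.mem_union]; tauto

theorem card_TT_le (n : ℕ) : ∀ (P : Finset Pt), Cfg P A B C → (inn P A B C).card = n →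
    ((TT P A B C).card : ℝ) ≤ (TT {A, B, C} A B C).card * 29 ^ n := by
  induction n with
  | zero =>
    intro P hP h0
    have : P = {A, B, C} := by
      refine Finset.Subset.antisymm (Finset.sdiff_eq_empty_iff_subset.1 (Finset.card_eq_zero.1 h0)) ?_
      intro x hx; simp only [Finset.mem_insert, Finset.mem_singleton] at hx
      rcases hx with rfl | rfl | rfl
      exacts [hP.hA, hP.hB, hP.hC]
    rw [this]; simp
  | succ n ih =>
    intro P hP hn
    have h1 : ∀ p ∈ inn P A B C, ∑ T ∈ TT P A B C, (7 - ((link T p).card : ℝ)) ≤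
        29 * ((TT {A, B, C} A B C).card * 29 ^ n) := by
      intro p hp
      have hp' := Inn_iff.2 hp
      refine (charge hP hp').trans (mul_le_mul_of_nonneg_left ?_ (by norm_num))
      refine le_trans (by exact_mod_cast card_deg3_le hP hp') (ih _ (hP.erase hp'.nA hp'.nB hp'.nC) ?_)
      have : inn (P.erase p) A B C = (inn P A B C).erase p := by
        ext x; simp only [mem_inn, Finset.mem_erase]; tauto
      rw [this, Finset.card_erase_of_mem hp, hn]; rfl
    have h2 := Finset.sum_le_card_nsmul _ _ _ h1
    rw [Finset.sum_comm, hn] at h2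
    have h3 : ∀ T ∈ TT P A B C, ((n + 1 : ℕ) : ℝ) ≤ ∑ p ∈ inn P A B C, (7 - ((link T p).card : ℝ)) := by
      intro T hT
      have := (mem_TT.1 hT).sum_deg hP
      rw [hn] at this
      rw [Finset.sum_sub_distrib]
      have h4 : ((∑ q ∈ inn P A B C, (link T q).card : ℕ) : ℝ) ≤ ((6 * (n + 1) : ℕ) : ℝ) := by exact_mod_cast this
      push_cast at h4 ⊢
      rw [Finset.sum_const, hn]
      simp only [nsmul_eq_mul]
      push_cast
      linarith
    have h5 := Finset.card_nsmul_le_sum _ _ _ h3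
    have h6 := h5.trans h2
    simp only [nsmul_eq_mul] at h6
    have h7 : (0:ℝ) < ((n + 1 : ℕ) : ℝ) := by positivity
    rw [mul_comm] at h6
    have := le_of_mul_le_mul_left h6 h7
    rw [pow_succ]; linarith

end SC

namespace SC
variable {P : Finset Pt} {A B C : Pt} {T : Finset (Pt × Pt × Pt)} {p : Pt}

/-! ### Existence of triangulations containing prescribed edges -/

theorem exists_Tri (n : ℕ) : ∀ (P : Finset Pt), Cfg P A B C → (inn P A B C).card = n → ∃ T, Tri P A B C T := by
  induction n with
  | zero =>
    intro P hP h0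
    have : P = {A, B, C} := by
      unfold inn at h0
      rw [Finset.card_eq_zero, Finset.sdiff_eq_empty_iff_subset] at h0
      refine Finset.Subset.antisymm h0 ?_
      intro x hx
      simp only [Finset.mem_insert, Finset.mem_singleton] at hx
      rcases hx with rfl | rfl | rfl
      exacts [hP.hA, hP.hB, hP.hC]
    exact ⟨_, this ▸ Tri.base hP⟩
  | succ n ih =>
    intro P hP hn
    obtain ⟨p, hp⟩ := Finset.card_pos.1 (by omega : 0 < (inn P A B C).card)
    have hp' := mem_inn.1 hp
    obtain ⟨T, hT⟩ := ih (P.erase p) (hP.erase hp'.2.1 hp'.2.2.1 hp'.2.2.2) (by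
      have : inn (P.erase p) A B C = (inn P A B C).erase p := by
        unfold inn; rw [Finset.erase_sdiff_comm]
      rw [this, Finset.card_erase_of_mem hp]; omega)
    obtain ⟨a, b, c, ht, hi⟩ := hT.cover_exists (hP.erase hp'.2.1 hp'.2.2.1 hp'.2.2.2) (hP.gen hp'.1)
      (hP.ins p hp'.1 hp'.2.1 hp'.2.2.1 hp'.2.2.2)
    exact ⟨_, hT.split hP hp'.1 hp'.2.1 hp'.2.2.1 hp'.2.2.2 ht hi⟩

/-- directed edges -/
def edg (T : Finset (Pt × Pt × Pt)) (u v : Pt) : Prop := ∃ w, (u, v, w) ∈ T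

theorem Cfg.hull_nonneg (hP : Cfg P A B C) {a b q : Pt} (hh : hullE A B C a b) (hq : q ∈ P) : 0 ≤ o a b q := by
  have habc := hP.abc
  by_cases c : q ≠ A ∧ q ≠ B ∧ q ≠ C
  · have := hP.ins q hq c.1 c.2.1 c.2.2
    rcases hh with ⟨rfl, rfl⟩ | ⟨rfl, rfl⟩ | ⟨rfl, rfl⟩
    · rw [← o_rot']; exact this.1.le
    · rw [← o_rot']; exact this.2.1.le
    · rw [← o_rot']; exact this.2.2.le
  · have c' : q = A ∨ q = B ∨ q = C := by tauto
    have e1 : o B C A = o A B C := o_rot _ _ _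
    have e2 : o C A B = o A B C := o_rot' _ _ _
    rcases hh with ⟨rfl, rfl⟩ | ⟨rfl, rfl⟩ | ⟨rfl, rfl⟩ <;> rcases c' with rfl | rfl | rfl <;>
      first
      | rw [o_self'']
      | rw [o_self']
      | linarith

theorem Tri.twin_of_neg (hP : Cfg P A B C) (h : Tri P A B C T) {a b x q : Pt} (h1 : (a, b, x) ∈ T)
    (hq : q ∈ P) (hn : o a b q < 0) : edg T b a :=
  h.twin hP h1 (fun hh => absurd (hP.hull_nonneg hh hq) (not_le.2 hn))

/-- the edge `ab` (with `a` on the left of `uv`) crosses `uv`. -/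
def Cr (u v a b : Pt) : Prop := 0 < o u v a ∧ o u v b < 0 ∧ o a b u < 0 ∧ 0 < o a b v

theorem Cr.symm {u v a b : Pt} (h : Cr u v a b) : Cr v u b a := by
  refine ⟨?_, ?_, ?_, ?_⟩
  · rw [o_swap]; linarith [h.2.1]
  · rw [o_swap]; linarith [h.1]
  · rw [o_swap]; linarith [h.2.2.2]
  · rw [o_swap]; linarith [h.2.2.1]

theorem Cr.X {u v a b : Pt} (h : Cr u v a b) : X a b u v :=
  ⟨mul_neg_of_neg_of_pos h.2.2.1 h.2.2.2, mul_neg_of_pos_of_neg h.1 h.2.1⟩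

theorem Cr.step (hP : Cfg P A B C) (h : Tri P A B C T) {u v a b x : Pt} (hu : u ∈ P) (hv : v ∈ P)
    (hc : Cr u v a b) (ht : (a, b, x) ∈ T) :
    x = v ∨ (0 < o u v x ∧ Cr u v x b) ∨ (o u v x < 0 ∧ Cr u v a x) := by
  by_cases xv : x = v
  · exact Or.inl xv
  right
  have ma := h.mem _ _ _ ht
  have mb := h.mem2 ht
  have mx := h.mem3 ht
  have px := h.pos _ _ _ ht
  obtain ⟨c1, c2, c3, c4⟩ := hc
  obtain ⟨ab, ax, bx⟩ := ne_of_o_pos px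
  have xu : x ≠ u := by rintro rfl; linarith
  obtain ⟨uv, ua, va⟩ := ne_of_o_pos c1
  obtain ⟨_, ub, vb⟩ := ne_of_o_ne c2.ne
  have n0 := hP.gp u hu v hv x mx uv xu.symm (Ne.symm xv)
  have n1 := hP.gp v hv b mb x mx vb (Ne.symm xv) bx
  have n2 := hP.gp v hv x mx a ma (Ne.symm xv) va ax.symm
  have e := h.emp _ _ _ ht v hv
  have i1 : 0 < o v a b := by rw [← o_rot']; rw [o_rot']; rw [← o_rot]; exact c4
  have pl := o_pl v u a b x
  have s1 : o v u a = - o u v a := o_swap _ _ _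
  have s2 : o v u b = - o u v b := o_swap _ _ _
  have s3 : o v u x = - o u v x := o_swap _ _ _
  rcases lt_or_gt_of_ne n0 with hx | hx
  · right
    refine ⟨hx, c1, hx, ?_⟩
    have k : o v x a < 0 := by
      rcases lt_or_gt_of_ne n2 with k | k
      · exact k
      · have k2 : o v b x < 0 := by
          by_contra hh
          exact e ⟨i1, lt_of_le_of_ne (not_lt.1 hh) n1.symm, k⟩
        have t1 := mul_pos_of_neg_of_neg (by linarith : o v u a < 0) k2
        have t2 := mul_pos (by linarith : 0 < o v u b) k
        have t3 := mul_pos (by linarith : 0 < o v u x) i1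
        linarith
    have k' : 0 < o a x v := by
      have : o a x v = - o v x a := by rw [o_swap'']
      linarith
    refine ⟨?_, k'⟩
    have pl2 := o_pl a u v b x
    have r1 : o a u v = o u v a := o_rot' _ _ _
    have r2 : o a u b = - o a b u := o_swap' _ _ _
    have r3 : o a v b = - o a b v := o_swap' _ _ _
    have r4 : o a u x = - o a x u := o_swap' _ _ _
    have t1 := mul_pos (by linarith : 0 < o a u v) px
    have t2 := mul_pos (by linarith : 0 < o a u b) k'
    by_contra hh
    have := mul_nonneg_of_nonpos_of_nonpos (by linarith : o a u x ≤ 0) (by linarith : o a v b ≤ 0)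
    linarith
  · left
    have k : o v b x < 0 := by
      rcases lt_or_gt_of_ne n1 with k | k
      · exact k
      · have k2 : o v x a < 0 := by
          by_contra hh
          exact e ⟨i1, k, lt_of_le_of_ne (not_lt.1 hh) n2.symm⟩
        have t1 := mul_neg_of_neg_of_pos (by linarith : o v u a < 0) k
        have t2 := mul_neg_of_pos_of_neg (by linarith : 0 < o v u b) k2
        have t3 := mul_neg_of_neg_of_pos (by linarith : o v u x < 0) i1
        linarith
    have k' : 0 < o x b v := by
      have : o x b v = - o v b x := by rw [o_swap'']
      linarith
    refine ⟨hx, hx, c2, ?_, k'⟩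
    have pl2 := o_pl b u v a x
    have r1 : o b u v = o u v b := o_rot' _ _ _
    have r2 : o b u a = o a b u := by rw [o_rot]
    have r3 : o b v a = o a b v := by rw [o_rot]
    have r4 : o b u x = o x b u := by rw [o_rot]
    have r5 : o b a x = - o a b x := o_swap _ _ _
    have r6 : o b x v = - o x b v := o_swap _ _ _
    have t1 := mul_pos_of_neg_of_neg (by linarith : o b u v < 0) (by linarith : o b a x < 0)
    have t2 := mul_pos_of_neg_of_neg (by linarith : o b u a < 0) (by linarith : o b x v < 0)
    by_contra hh
    have := mul_nonneg (by linarith : 0 ≤ o b u x) (by linarith : 0 ≤ o b v a)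
    linarith

theorem exists_psi (P : Finset Pt) (u v : Pt) : ∃ d : Pt,
    (∀ a ∈ P, 0 < o u v a → 0 < sd d u a ∧ 0 < sd d v a) ∧
    (∀ a ∈ P, o u v a < 0 → sd d u a < 0 ∧ sd d v a < 0) ∧
    (∀ a ∈ P, ∀ b ∈ P, a ≠ b → sd d a b ≠ 0) := by
  have hcont : ∀ a x : Pt, Continuous (fun d : Pt => sd d a x) := by
    intro a x; unfold sd; fun_prop
  have hopen : IsOpen (⋂ a ∈ (P : Set Pt), {d : Pt | (0 < o u v a → 0 < sd d u a ∧ 0 < sd d v a) ∧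
      (o u v a < 0 → sd d u a < 0 ∧ sd d v a < 0)}) := by
    refine P.finite_toSet.isOpen_biInter ?_
    intro a _
    rcases lt_trichotomy (o u v a) 0 with h | h | h
    · have : {d : Pt | (0 < o u v a → 0 < sd d u a ∧ 0 < sd d v a) ∧
        (o u v a < 0 → sd d u a < 0 ∧ sd d v a < 0)} = {d : Pt | sd d u a < 0} ∩ {d | sd d v a < 0} := by
        ext d; simp [h, h.not_gt]
      rw [this]
      exact (isOpen_lt (hcont _ _) continuous_const).inter (isOpen_lt (hcont _ _) continuous_const)
    · simp [h]
    · have : {d : Pt | (0 < o u v a → 0 < sd d u a ∧ 0 < sd d v a) ∧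
        (o u v a < 0 → sd d u a < 0 ∧ sd d v a < 0)} = {d : Pt | 0 < sd d u a} ∩ {d | 0 < sd d v a} := by
        ext d; simp [h, h.not_gt]
      rw [this]
      exact (isOpen_lt continuous_const (hcont _ _)).inter (isOpen_lt continuous_const (hcont _ _))
  obtain ⟨d, hd, hg⟩ := exists_generic hopen ⟨v - u, by
    simp only [Set.mem_iInter]
    intro a _
    have e1 : sd (v - u) u a = o u v a := sd_sub _ _ _
    have e2 : sd (v - u) v a = o u v a := by unfold sd o; simp; ring
    simp only [Set.mem_setOf_eq, e1, e2]
    exact ⟨fun h => ⟨h, h⟩, fun h => ⟨h, h⟩⟩⟩ ((P ×ˢ P).image (fun e => ((0 : Pt), e.2 - e.1)))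
  simp only [Set.mem_iInter] at hd
  refine ⟨d, fun a ha => (hd a ha).1, fun a ha => (hd a ha).2, ?_⟩
  intro a ha b hb hab h0
  refine hg (0, b - a) (Finset.mem_image.2 ⟨(a, b), by simp [ha, hb], rfl⟩) ?_ ?_
  · exact fun e => hab (sub_eq_zero.1 e.symm).symm
  · unfold sd at h0; unfold o; simp; linarith

theorem mem_flipT' {u v w z : Pt} {t : Pt × Pt × Pt} : t ∈ flipT T u v w z ↔
    (t ∈ T ∧ ¬ (t ∈ rot3 u v w ∨ t ∈ rot3 v u z)) ∨ t ∈ rot3 z v w ∨ t ∈ rot3 w u z := by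
  unfold flipT; simp only [Finset.mem_union, Finset.mem_sdiff]

theorem edg_flipT {u v w z x y : Pt} (h : edg T x y) (n1 : ¬ (x = u ∧ y = v)) (n2 : ¬ (x = v ∧ y = u)) :
    edg (flipT T u v w z) x y := by
  obtain ⟨k, hk⟩ := h
  by_cases c : (x, y, k) ∈ rot3 u v w ∨ (x, y, k) ∈ rot3 v u z
  · simp only [mem_rot3, Prod.mk.injEq] at c
    rcases c with (c | c | c) | (c | c | c)
    · exact absurd ⟨c.1, c.2.1⟩ n1
    · refine ⟨z, mem_flipT'.2 (Or.inr (Or.inl ?_))⟩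
      rw [mem_rot3, c.1, c.2.1]; simp
    · refine ⟨z, mem_flipT'.2 (Or.inr (Or.inr ?_))⟩
      rw [mem_rot3, c.1, c.2.1]; simp
    · exact absurd ⟨c.1, c.2.1⟩ n2
    · refine ⟨w, mem_flipT'.2 (Or.inr (Or.inr ?_))⟩
      rw [mem_rot3, c.1, c.2.1]; simp
    · refine ⟨w, mem_flipT'.2 (Or.inr (Or.inl ?_))⟩
      rw [mem_rot3, c.1, c.2.1]; simp
  · exact ⟨k, mem_flipT'.2 (Or.inl ⟨hk, c⟩)⟩

theorem pos_of_mul_pos_left' {a b : ℝ} (h : 0 < a * b) (ha : 0 < a) : 0 < b := by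
  by_contra hb
  have := mul_nonneg ha.le (by linarith : 0 ≤ -b)
  linarith

theorem sum_union_le' {α : Type*} [DecidableEq α] (s t : Finset α) (f : α → ℝ) (hf : ∀ x, 0 ≤ f x) :
    ∑ x ∈ s ∪ t, f x ≤ ∑ x ∈ s, f x + ∑ x ∈ t, f x := by
  rw [← Finset.sum_union_inter]
  have : 0 ≤ ∑ x ∈ s ∩ t, f x := Finset.sum_nonneg (fun x _ => hf x)
  linarith

theorem sum_flip_le (h : Tri P A B C T) {u v w z : Pt} (h1 : (u, v, w) ∈ T)
    (h2 : (v, u, z) ∈ T) (c1 : 0 < o z v w) (c2 : 0 < o w u z) (f : Pt → Pt → ℝ) (hf : ∀ x y, 0 ≤ f x y) :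
    ∑ t ∈ flipT T u v w z, f t.1 t.2.1 + (f u v + f v u) ≤ ∑ t ∈ T, f t.1 t.2.1 + (f w z + f z w) := by
  have p1 := h.pos _ _ _ h1
  have p2 := h.pos _ _ _ h2
  obtain ⟨uv, uw, vw⟩ := ne_of_o_pos p1
  obtain ⟨_, vz, uz⟩ := ne_of_o_pos p2
  obtain ⟨zv, zw, _⟩ := ne_of_o_pos c1
  have hsub : rot3 u v w ∪ rot3 v u z ⊆ T := by
    intro t ht
    simp only [Finset.mem_union, mem_rot3] at ht
    rcases ht with (rfl | rfl | rfl) | (rfl | rfl | rfl)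
    exacts [h1, h.rot _ _ _ h1, h.rot2 h1, h2, h.rot _ _ _ h2, h.rot2 h2]
  have hdis : Disjoint (rot3 u v w) (rot3 v u z) := by
    rw [Finset.disjoint_left]
    intro t ht ht'
    simp only [mem_rot3] at ht ht'
    rcases ht with rfl | rfl | rfl <;> simp only [Prod.mk.injEq] at ht' <;> grind
  have e1 : ∑ t ∈ T, f t.1 t.2.1 = ∑ t ∈ T \ (rot3 u v w ∪ rot3 v u z), f t.1 t.2.1 +
      ((f u v + f v w + f w u) + (f v u + f u z + f z v)) := by
    rw [← Finset.sum_sdiff hsub, Finset.sum_union hdis, sum_rot3 uv uw vw, sum_rot3 uv.symm vz uz]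
  have e2 := sum_union_le' (T \ (rot3 u v w ∪ rot3 v u z)) (rot3 z v w ∪ rot3 w u z)
    (fun t => f t.1 t.2.1) (fun t => hf _ _)
  have e3 := sum_union_le' (rot3 z v w) (rot3 w u z) (fun t => f t.1 t.2.1) (fun t => hf _ _)
  rw [sum_rot3 zv zw vw, sum_rot3 uw.symm zw.symm uz] at e3
  simp only at e3
  unfold flipT
  rw [e1]
  refine le_trans (add_le_add_left (e2.trans (add_le_add_right e3 _)) _) ?_
  linarith

theorem Tri.insert_edge (hP : Cfg P A B C) (h0 : Tri P A B C T) {u v : Pt} (hu : u ∈ inn P A B C) (hv : v ∈ P)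
    (huv : u ≠ v) :
    ∃ T', Tri P A B C T' ∧ edg T' u v ∧ ∀ x y, edg T x y → ¬ X x y u v → edg T' x y := by
  have hu' := mem_inn.1 hu
  obtain ⟨d, d1, d2, d3⟩ := exists_psi P u v
  set f : Pt → Pt → ℝ := fun a b => if Cr u v a b ∧ a ∈ P ∧ b ∈ P then sd d u a - sd d u b else 0 with hfdef
  have hf : ∀ x y, 0 ≤ f x y := by
    intro x y
    simp only [hfdef]
    split_ifs with hc
    · linarith [(d1 x hc.2.1 hc.1.1).1, (d2 y hc.2.2 hc.1.2.1).1]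
    · exact le_rfl
  obtain ⟨T', hT', hmin⟩ := Finset.exists_min_image
    ((TT P A B C).filter (fun T' => ∀ x y, edg T x y → ¬ X x y u v → edg T' x y))
    (fun T' => ∑ t ∈ T', f t.1 t.2.1) ⟨T, by rw [Finset.mem_filter, mem_TT]; exact ⟨h0, fun _ _ h _ => h⟩⟩
  rw [Finset.mem_filter, mem_TT] at hT'
  obtain ⟨h, hkeep⟩ := hT'
  refine ⟨T', h, ?_, hkeep⟩
  have psub : ∀ a b, sd d b a = sd d u a - sd d u b := by intro a b; unfold sd; ring
  by_cases hne : ∃ a b, Cr u v a b ∧ edg T' a b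
  · exfalso
    obtain ⟨a₀, b₀, hc₀, x₀, hx₀⟩ := hne
    set CS := (P ×ˢ P).filter (fun e : Pt × Pt => Cr u v e.1 e.2 ∧ edg T' e.1 e.2) with hCS
    have memCS : ∀ a b, Cr u v a b → edg T' a b → (a, b) ∈ CS := by
      intro a b h1 h2
      obtain ⟨x, hx⟩ := h2
      rw [hCS, Finset.mem_filter, Finset.mem_product]
      exact ⟨⟨h.mem _ _ _ hx, h.mem2 hx⟩, h1, x, hx⟩
    obtain ⟨⟨a, b1⟩, hab1, hmax⟩ := Finset.exists_max_image CS (fun e => sd d u e.1) ⟨_, memCS _ _ hc₀ ⟨x₀, hx₀⟩⟩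
    obtain ⟨⟨a', b⟩, hab, hmn⟩ := Finset.exists_min_image (CS.filter (fun e => e.1 = a)) (fun e => sd d u e.2)
      ⟨(a, b1), Finset.mem_filter.2 ⟨hab1, rfl⟩⟩
    rw [Finset.mem_filter] at hab
    obtain ⟨hab, haa⟩ := hab
    simp only at haa
    subst haa
    rw [hCS, Finset.mem_filter] at hab
    obtain ⟨-, hc, x, hx⟩ := hab
    simp only at hc hx
    have hmax' : ∀ c e, Cr u v c e → edg T' c e → sd d u c ≤ sd d u a' := fun c e h1 h2 => hmax _ (memCS _ _ h1 h2)
    have hmin' : ∀ e, Cr u v a' e → edg T' a' e → sd d u b ≤ sd d u e := fun e h1 h2 =>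
      hmn (a', e) (Finset.mem_filter.2 ⟨memCS _ _ h1 h2, rfl⟩)
    have ma := h.mem _ _ _ hx
    have mb := h.mem2 hx
    have pa := d1 a' ma hc.1
    have pb := d2 b mb hc.2.1
    have xpos := h.pos _ _ _ hx
    -- twin
    have huP := hu'.1
    have ubne : a' ≠ u := by rintro rfl; have := hc.1; rw [o_self''] at this; exact lt_irrefl _ this
    obtain ⟨y, hy⟩ := h.twin_of_neg hP hx huP hc.2.2.1
    have ypos := h.pos _ _ _ hy
    have bx : sd d u x < sd d u a' ∧ sd d u b < sd d u x := by
      rcases hc.step hP h huP hv hx with rfl | ⟨k1, k2⟩ | ⟨k1, k2⟩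
      · have i1 := pa.2; have i2 := pb.2
        rw [psub] at i1 i2
        exact ⟨by linarith, by linarith⟩
      · have mx := h.mem3 hx
        refine ⟨lt_of_le_of_ne (hmax' x b k2 ?_) ?_, ?_⟩
        · refine h.twin_of_neg hP (h.rot _ _ _ hx) hv ?_
          rw [o_swap]; linarith [k2.2.2.2]
        · intro e
          have := d3 a' ma x mx (ne_of_o_pos xpos).2.1
          rw [psub] at this; apply this; linarith
        · linarith [(d1 x mx k1).1]
      · have mx := h.mem3 hx
        refine ⟨by linarith [(d2 x mx k1).1], lt_of_le_of_ne (hmin' x k2 ?_) ?_⟩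
        · refine h.twin_of_neg hP (h.rot2 hx) hv ?_
          rw [o_swap]; linarith [k2.2.2.2]
        · intro e
          have := d3 b mb x mx (ne_of_o_pos xpos).2.2
          rw [psub] at this; apply this; linarith
    have by' : sd d u y < sd d u a' ∧ sd d u b < sd d u y := by
      have my := h.mem3 hy
      rcases hc.symm.step hP h hv huP hy with rfl | ⟨k1, k2⟩ | ⟨k1, k2⟩
      · have : sd d y y = 0 := by unfold sd; ring
        rw [this]; exact ⟨pa.1, pb.1⟩
      · have k3 := k2.symm
        refine ⟨by linarith [(d2 y my k3.2.1).1], lt_of_le_of_ne (hmin' y k3 ⟨b, h.rot _ _ _ hy⟩) ?_⟩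
        intro e
        have := d3 b mb y my (ne_of_o_pos ypos).2.1
        rw [psub] at this; apply this; linarith
      · have k3 := k2.symm
        refine ⟨lt_of_le_of_ne (hmax' y b k3 ⟨a', h.rot2 hy⟩) ?_, by linarith [(d1 y my k3.1).1]⟩
        intro e
        have := d3 a' ma y my (ne_of_o_pos ypos).2.2
        rw [psub] at this; apply this; linarith
    have c1 : 0 < o y b x := by
      have pl := sd_pl d b a' x y
      rw [psub a' b, psub x b, psub y b] at pl
      have r1 : o b y a' = - o b a' y := o_swap' _ _ _
      have r2 : o b a' x = - o a' b x := o_swap _ _ _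
      have t1 := mul_pos (by linarith : 0 < sd d u x - sd d u b) ypos
      have t2 := mul_pos (by linarith : 0 < sd d u y - sd d u b) xpos
      rw [r1, r2] at pl
      have : 0 < (sd d u a' - sd d u b) * o b x y := by linarith
      rw [← o_rot]
      exact pos_of_mul_pos_left' this (by linarith)
    have c2 : 0 < o x a' y := by
      have pl := sd_pl d a' b x y
      rw [psub b a', psub x a', psub y a'] at pl
      have r1 : o a' y b = o b a' y := o_rot _ _ _
      have r2 : o x a' y = - o a' x y := o_swap _ _ _
      have t1 := mul_pos (by linarith : 0 < sd d u a' - sd d u x) ypos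
      have t2 := mul_pos (by linarith : 0 < sd d u a' - sd d u y) xpos
      rw [r1] at pl
      have : 0 < (sd d u a' - sd d u b) * o x a' y := by rw [r2]; linarith
      exact pos_of_mul_pos_left' this (by linarith)
    have hfl := h.flip hP hx hy c1 c2
    have hXab := hc.X
    have hle := hmin (flipT T' a' b x y) (by
      rw [Finset.mem_filter, mem_TT]
      refine ⟨hfl, fun s t h1 h2 => edg_flipT (hkeep s t h1 h2) ?_ ?_⟩
      · rintro ⟨rfl, rfl⟩; exact h2 hXab
      · rintro ⟨rfl, rfl⟩; exact h2 (X_swap1 hXab))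
    have hs := sum_flip_le h hx hy c1 c2 f hf
    have f1 : f a' b = sd d u a' - sd d u b := by simp only [hfdef]; rw [if_pos ⟨hc, ma, mb⟩]
    have f2 := hf b a'
    have f3 : f x y + f y x < sd d u a' - sd d u b := by
      simp only [hfdef]
      split_ifs with e1 e2 e2
      · have := e1.1.1; have := e2.1.2.1; linarith
      · linarith
      · linarith
      · linarith
    linarith
  · push Not at hne
    obtain ⟨x, y, ht, s1, s2⟩ := h.vc_exists hP (sub_ne_zero.2 huv.symm) hu'.1 hu'.2.1 hu'.2.2.1 hu'.2.2.2
    rw [sd_sub] at s1 s2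
    by_cases yv : y = v
    · subst yv
      obtain ⟨z, hz⟩ := h.next hP (Inn_iff.2 hu) ht
      exact ⟨z, hz⟩
    exfalso
    have mx := h.mem2 ht
    have my := h.mem3 ht
    have hp := h.pos _ _ _ ht
    obtain ⟨ux, uy, xy⟩ := ne_of_o_pos hp
    have n0 := hP.gp u hu'.1 v hv y my huv uy (Ne.symm yv)
    have s2' : 0 < o u v y := lt_of_le_of_ne s2 n0.symm
    have xv : x ≠ v := by rintro rfl; rw [o_self'] at s1; exact lt_irrefl _ s1
    have e := h.emp _ _ _ ht v hv
    have k : o v x y < 0 := by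
      by_contra hh
      refine e ⟨?_, lt_of_le_of_ne (not_lt.1 hh) (hP.gp v hv x mx y my xv.symm (Ne.symm yv) xy).symm, ?_⟩
      · rw [← o_rot, o_swap']; linarith
      · rw [o_rot]; rw [o_rot'] ; rw [o_rot]; exact s2'
    have r1 : o y x u = - o u x y := by rw [o_swap'']
    have r2 : o y x v = - o v x y := by rw [o_swap'']
    have r3 : o x y v = o v x y := by rw [o_rot]
    refine hne y x ⟨s2', s1, by linarith, by linarith⟩ (h.twin_of_neg hP (h.rot _ _ _ ht) hv (by linarith))

theorem exists_Tri_edges (hP : Cfg P A B C) (L : Finset (Pt × Pt))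
    (hL : ∀ e ∈ L, e.1 ∈ inn P A B C ∧ e.2 ∈ inn P A B C ∧ e.1 ≠ e.2)
    (hX : ∀ e ∈ L, ∀ f ∈ L, ¬ X e.1 e.2 f.1 f.2) :
    ∃ T, Tri P A B C T ∧ ∀ e ∈ L, edg T e.1 e.2 := by
  induction L using Finset.induction_on with
  | empty =>
    obtain ⟨T, hT⟩ := exists_Tri _ P hP rfl
    exact ⟨T, hT, by simp⟩
  | insert e L he ih =>
    obtain ⟨T, hT, h1⟩ := ih (fun f hf => hL f (Finset.mem_insert_of_mem hf))
      (fun f hf g hg => hX f (Finset.mem_insert_of_mem hf) g (Finset.mem_insert_of_mem hg))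
    obtain ⟨l1, l2, l3⟩ := hL e (Finset.mem_insert_self _ _)
    obtain ⟨T', hT', h2, h3⟩ := hT.insert_edge hP l1 (mem_inn.1 l2).1 l3
    refine ⟨T', hT', ?_⟩
    intro f hf
    rcases Finset.mem_insert.1 hf with rfl | hf'
    · exact h2
    · exact h3 _ _ (h1 f hf') (hX f hf e (Finset.mem_insert_self _ _))

end SC

namespace SC
variable {P : Finset Pt} {A B C : Pt} {T : Finset (Pt × Pt × Pt)} {p : Pt}

/-! ### The swap lemma -/

theorem swap_key {ι : Type*} (adj : ι → ι → Prop) (F : Finset ι) (Q : ι → Prop) [DecidablePred Q] (T : ι)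
    (hQ : ∀ T' ∈ F, ∀ T'' ∈ F, adj T T' → adj T T'' → ¬ Q T' → ¬ Q T'' → T' = T'') :
    (1/2:ℝ) * (1/2:ℝ) ^ ((F.filter Q).filter (adj T)).card ≤ (1/2:ℝ) ^ (F.filter (adj T)).card := by
  rw [← pow_succ']
  refine pow_le_pow_of_le_one (by norm_num) (by norm_num) ?_
  have hc := Finset.card_filter_add_card_filter_not (s := F.filter (adj T)) Q
  rw [Finset.filter_filter, Finset.filter_filter] at hc
  rw [Finset.filter_filter]
  have hle : (F.filter (fun a => adj T a ∧ ¬ Q a)).card ≤ 1 := by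
    rw [Finset.card_le_one]
    intro a ha b hb
    rw [Finset.mem_filter] at ha hb
    exact hQ a ha.1 b hb.1 ha.2.1 hb.2.1 ha.2.2 hb.2.2
  have : (F.filter (fun a => Q a ∧ adj T a)) = F.filter (fun a => adj T a ∧ Q a) :=
    Finset.filter_congr (fun a _ => and_comm)
  rw [this]; omega

theorem swap_sum {ι β : Type*} (E : ι → β → Prop) (adj : ι → ι → Prop) (hirr : ∀ a, ¬ adj a a)
    (h1 : ∀ T T' T'' e, adj T T' → adj T T'' → E T e → ¬ E T' e → ¬ E T'' e → T' = T'')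
    (h2 : ∀ T T' T'' e, adj T T' → adj T T'' → ¬ E T e → E T' e → E T'' e → T' = T'') (n : ℕ) :
    ∀ F : Finset ι, F.card = n → F.Nonempty →
      (∀ T ∈ F, ∀ T' ∈ F, (∀ e, E T e ↔ E T' e) → T = T') →
      (1:ℝ) ≤ ∑ T ∈ F, (1/2:ℝ) ^ (F.filter (adj T)).card := by
  induction n using Nat.strong_induction_on with
  | _ n ih =>
  intro F hn hne hinj
  by_cases hs : ∃ T ∈ F, ∃ T' ∈ F, T ≠ T'
  · obtain ⟨T, hT, T', hT', hTT⟩ := hs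
    have : ∃ e, ¬ (E T e ↔ E T' e) := by
      by_contra hc; push Not at hc; exact hTT (hinj T hT T' hT' hc)
    obtain ⟨e, he⟩ := this
    have hne1 : (F.filter (fun T => E T e)).Nonempty := by
      by_cases c : E T e
      · exact ⟨T, Finset.mem_filter.2 ⟨hT, c⟩⟩
      · exact ⟨T', Finset.mem_filter.2 ⟨hT', by tauto⟩⟩
    have hne0 : (F.filter (fun T => ¬ E T e)).Nonempty := by
      by_cases c : E T e
      · exact ⟨T', Finset.mem_filter.2 ⟨hT', by tauto⟩⟩
      · exact ⟨T, Finset.mem_filter.2 ⟨hT, c⟩⟩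
    have hcard := Finset.card_filter_add_card_filter_not (s := F) (fun T => E T e)
    have p1 := Finset.card_pos.2 hne1
    have p0 := Finset.card_pos.2 hne0
    have i1 := ih _ (by omega) (F.filter (fun T => E T e)) rfl hne1
      (fun T hT T' hT' => hinj T (Finset.mem_filter.1 hT).1 T' (Finset.mem_filter.1 hT').1)
    have i0 := ih _ (by omega) (F.filter (fun T => ¬ E T e)) rfl hne0
      (fun T hT T' hT' => hinj T (Finset.mem_filter.1 hT).1 T' (Finset.mem_filter.1 hT').1)
    rw [← Finset.sum_filter_add_sum_filter_not F (fun T => E T e)]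
    have j1 : (1/2:ℝ) ≤ ∑ T ∈ F.filter (fun T => E T e), (1/2:ℝ) ^ (F.filter (adj T)).card := by
      calc (1/2:ℝ) ≤ (1/2) * ∑ T ∈ F.filter (fun T => E T e), (1/2:ℝ) ^ ((F.filter (fun T => E T e)).filter (adj T)).card := by
            linarith
        _ ≤ _ := by
          rw [Finset.mul_sum]
          refine Finset.sum_le_sum (fun T hT => swap_key adj F (fun T => E T e) T ?_)
          intro T' _ T'' _ a1 a2 q1 q2
          exact h1 T T' T'' e a1 a2 (Finset.mem_filter.1 hT).2 q1 q2
    have j0 : (1/2:ℝ) ≤ ∑ T ∈ F.filter (fun T => ¬ E T e), (1/2:ℝ) ^ (F.filter (adj T)).card := by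
      calc (1/2:ℝ) ≤ (1/2) * ∑ T ∈ F.filter (fun T => ¬ E T e), (1/2:ℝ) ^ ((F.filter (fun T => ¬ E T e)).filter (adj T)).card := by
            linarith
        _ ≤ _ := by
          rw [Finset.mul_sum]
          refine Finset.sum_le_sum (fun T hT => swap_key adj F (fun T => ¬ E T e) T ?_)
          intro T' _ T'' _ a1 a2 q1 q2
          exact h2 T T' T'' e a1 a2 (Finset.mem_filter.1 hT).2 (not_not.1 q1) (not_not.1 q2)
    linarith
  · push Not at hs
    obtain ⟨T, hT⟩ := hne
    have hF : F = {T} := by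
      ext a; rw [Finset.mem_singleton]
      exact ⟨fun ha => hs a ha T hT, fun ha => ha ▸ hT⟩
    have : F.filter (adj T) = ∅ := by
      rw [hF, Finset.filter_singleton, if_neg (hirr T)]
    have h0 : ∑ T ∈ F, (1/2:ℝ) ^ (F.filter (adj T)).card = (1/2:ℝ) ^ (F.filter (adj T)).card := by
      conv_lhs => rw [show (∑ T ∈ F, (1/2:ℝ) ^ (F.filter (adj T)).card) = ∑ T' ∈ ({T} : Finset ι), (1/2:ℝ) ^ (F.filter (adj T')).card from by rw [← hF]]
      rw [Finset.sum_singleton]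
    rw [h0, this]; simp

/-- a flippable edge with its quadrilateral -/
structure Fl (T : Finset (Pt × Pt × Pt)) (u v w z : Pt) : Prop where
  h1 : (u, v, w) ∈ T
  h2 : (v, u, z) ∈ T
  c1 : 0 < o z v w
  c2 : 0 < o w u z

theorem Fl.symm {u v w z : Pt} (h : Fl T u v w z) : Fl T v u z w :=
  ⟨h.h2, h.h1, h.c2, h.c1⟩

theorem Fl.func (hP : Cfg P A B C) (h : Tri P A B C T) {u v w z w' z' : Pt} (h1 : Fl T u v w z)
    (h2 : Fl T u v w' z') : w = w' ∧ z = z' :=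
  ⟨h.func hP h1.h1 h2.h1, h.func hP h1.h2 h2.h2⟩

theorem Fl.X (h : Tri P A B C T) {u v w z : Pt} (h1 : Fl T u v w z) : X u v w z := by
  have p1 := h.pos _ _ _ h1.h1
  have p2 := h.pos _ _ _ h1.h2
  have c1 := h1.c1
  have c2 := h1.c2
  have e1 : o u v z = - o v u z := o_swap _ _ _
  have e2 : o w z u = - o w u z := o_swap' _ _ _
  have e3 : o w z v = o z v w := by rw [o_rot']
  exact ⟨mul_neg_of_pos_of_neg p1 (by linarith), mul_neg_of_neg_of_pos (by linarith) (by linarith)⟩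

theorem edg_new {u v w z : Pt} : edg (flipT T u v w z) w z ∧ edg (flipT T u v w z) z w := by
  constructor
  · exact ⟨v, mem_flipT'.2 (Or.inr (Or.inl (by rw [mem_rot3]; simp)))⟩
  · exact ⟨u, mem_flipT'.2 (Or.inr (Or.inr (by rw [mem_rot3]; simp)))⟩

theorem Fl.not_edg (hP : Cfg P A B C) (h : Tri P A B C T) {u v w z : Pt} (h1 : Fl T u v w z) :
    ¬ edg (flipT T u v w z) u v := by
  rintro ⟨x, hx⟩
  obtain ⟨y, hy⟩ := (edg_new (T := T) (u := u) (v := v) (w := w) (z := z)).1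
  exact (h.flip hP h1.h1 h1.h2 h1.c1 h1.c2).noncross hP hx hy (h1.X h)

theorem edg_of_flip (h : Tri P A B C T) {u v w z x y : Pt} (h1 : Fl T u v w z) (he : edg (flipT T u v w z) x y) :
    edg T x y ∨ (x = w ∧ y = z) ∨ (x = z ∧ y = w) := by
  obtain ⟨k, hk⟩ := he
  rw [mem_flipT'] at hk
  simp only [mem_rot3, Prod.mk.injEq] at hk
  rcases hk with hk | (hk | hk | hk) | (hk | hk | hk)
  · exact Or.inl ⟨k, hk.1⟩
  · left; rw [hk.1, hk.2.1]; exact ⟨_, h.rot2 h1.h2⟩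
  · left; rw [hk.1, hk.2.1]; exact ⟨_, h.rot _ _ _ h1.h1⟩
  · right; left; exact ⟨hk.1, hk.2.1⟩
  · left; rw [hk.1, hk.2.1]; exact ⟨_, h.rot2 h1.h1⟩
  · left; rw [hk.1, hk.2.1]; exact ⟨_, h.rot _ _ _ h1.h2⟩
  · right; right; exact ⟨hk.1, hk.2.1⟩

theorem Tri.ext_edg (hP : Cfg P A B C) {T' : Finset (Pt × Pt × Pt)} (h : Tri P A B C T) (h' : Tri P A B C T')
    (he : ∀ x y, edg T x y ↔ edg T' x y) : T = T' := by
  have key : ∀ T T', Tri P A B C T → Tri P A B C T' → (∀ x y, edg T x y ↔ edg T' x y) → T ⊆ T' := by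
    rintro T T' h h' he ⟨u, v, w⟩ ht
    obtain ⟨z, hz⟩ := (he u v).1 ⟨w, ht⟩
    by_cases hwz : w = z
    · rw [hwz]; exact hz
    exfalso
    have p1 := h.pos _ _ _ ht
    have p2 := h'.pos _ _ _ hz
    obtain ⟨uv, uw, vw⟩ := ne_of_o_pos p1
    obtain ⟨_, uz, vz⟩ := ne_of_o_pos p2
    have mu := h.mem _ _ _ ht
    have mv := h.mem2 ht
    have mw := h.mem3 ht
    have mz := h'.mem3 hz
    have n1 := hP.gp z mz v mv w mw vz.symm (Ne.symm hwz) vw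
    have n2 := hP.gp z mz w mw u mu (Ne.symm hwz) uz.symm uw.symm
    have e1 := h.emp _ _ _ ht z mz
    have e2 := h'.emp _ _ _ hz w mw
    have r1 : o z u v = o u v z := o_rot' _ _ _
    have r2 : o w u v = o u v w := o_rot' _ _ _
    have r3 : o w v z = - o z v w := by rw [o_swap'']
    have r4 : o w z u = - o z w u := by rw [o_swap]
    have crossT : ∀ a b c d, edg T a b → edg T c d → ¬ X a b c d := by
      rintro a b c d ⟨_, h1⟩ ⟨_, h2⟩
      exact h.noncross hP h1 h2
    rcases lt_or_gt_of_ne n1 with k | k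
    · have k2 : 0 < o z w u := by
        by_contra hh
        refine e2 ⟨by linarith, by linarith, ?_⟩
        have := lt_of_le_of_ne (not_lt.1 hh) n2
        linarith
      -- z u crosses v w
      refine crossT z u v w ((he _ _).2 ⟨_, h'.rot2 hz⟩) ⟨_, h.rot _ _ _ ht⟩ ⟨?_, ?_⟩
      · have : o z u w = - o z w u := o_swap' _ _ _
        rw [r1, this]; exact mul_neg_of_pos_of_neg p2 (by linarith)
      · have s1 : o v w z = o z v w := o_rot _ _ _
        have s2 : o v w u = o u v w := o_rot _ _ _
        rw [s1, s2]; exact mul_neg_of_neg_of_pos k p1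
    · have k2 : o z w u < 0 := by
        by_contra hh
        exact e1 ⟨by linarith, k, lt_of_le_of_ne (not_lt.1 hh) n2.symm⟩
      refine crossT v z w u ((he _ _).2 ⟨_, h'.rot _ _ _ hz⟩) ⟨_, h.rot2 ht⟩ ⟨?_, ?_⟩
      · have s1 : o v z w = - o z v w := o_swap _ _ _
        have s2 : o v z u = o u v z := o_rot _ _ _
        rw [s1, s2]; exact mul_neg_of_neg_of_pos (by linarith) p2
      · have s1 : o w u v = o u v w := o_rot' _ _ _
        have s2 : o w u z = o z w u := o_rot _ _ _
        rw [s1, s2]; exact mul_neg_of_pos_of_neg p1 k2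
  exact Finset.Subset.antisymm (key _ _ h h' he) (key _ _ h' h (fun x y => (he x y).symm))

def adjT (P : Finset Pt) (A B C : Pt) (T T' : Finset (Pt × Pt × Pt)) : Prop :=
  Tri P A B C T ∧ ∃ u v w z, Fl T u v w z ∧ T' = flipT T u v w z

theorem Fl.same (hP : Cfg P A B C) (h : Tri P A B C T) {u v w z u' v' w' z' : Pt} (h1 : Fl T u v w z)
    (h2 : Fl T u' v' w' z') (hh : (u' = u ∧ v' = v) ∨ (u' = v ∧ v' = u)) :
    flipT T u v w z = flipT T u' v' w' z' := by
  rcases hh with ⟨rfl, rfl⟩ | ⟨rfl, rfl⟩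
  · obtain ⟨rfl, rfl⟩ := Fl.func hP h h1 h2; rfl
  · obtain ⟨rfl, rfl⟩ := Fl.func hP h h1 h2.symm
    exact flipT_symm ..

theorem Fl.diag (hP : Cfg P A B C) (h : Tri P A B C T) {u v w z u' v' : Pt} (h1 : Fl T u v w z)
    (h2 : Fl T u' v' w z) : u' = u ∧ v' = v := by
  have wz : w ≠ z := (ne_of_o_pos h1.c2).2.1
  have := h.vc_unique hP (sub_ne_zero.2 wz.symm) (h.rot2 h1.h1) (h.rot2 h2.h1)
    (by rw [sd_sub, o_swap']; linarith [h1.c2]) (by rw [sd_sub, o_rot']; exact h1.c1.le)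
    (by rw [sd_sub, o_swap']; linarith [h2.c2]) (by rw [sd_sub, o_rot']; exact h2.c1.le)
  exact ⟨this.1.symm, this.2.symm⟩

def Dfl (P : Finset Pt) (T : Finset (Pt × Pt × Pt)) : Finset (Pt × Pt) :=
  (P ×ˢ P).filter (fun e => ∃ w z, Fl T e.1 e.2 w z)

theorem mem_Dfl (h : Tri P A B C T) {u v : Pt} : (u, v) ∈ Dfl P T ↔ ∃ w z, Fl T u v w z := by
  unfold Dfl
  rw [Finset.mem_filter, Finset.mem_product]
  refine ⟨fun hh => hh.2, fun hh => ⟨?_, hh⟩⟩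
  obtain ⟨w, z, hf⟩ := hh
  exact ⟨h.mem _ _ _ hf.h1, h.mem2 hf.h1⟩

theorem swap_main (hP : Cfg P A B C) (L : Finset (Pt × Pt))
    (hL : ∀ e ∈ L, e.1 ∈ inn P A B C ∧ e.2 ∈ inn P A B C ∧ e.1 ≠ e.2)
    (hX : ∀ e ∈ L, ∀ f ∈ L, ¬ X e.1 e.2 f.1 f.2) :
    (1:ℝ) ≤ ∑ T ∈ (TT P A B C).filter (fun T => ∀ e ∈ L, edg T e.1 e.2),
      (Real.sqrt 2)⁻¹ ^ ((Dfl P T).filter (fun e => e ∉ L ∧ (e.2, e.1) ∉ L)).card := by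
  obtain ⟨T0, hT0, hT0'⟩ := exists_Tri_edges hP L hL hX
  set F := (TT P A B C).filter (fun T => ∀ e ∈ L, edg T e.1 e.2) with hF
  have hmain := swap_sum (fun T (e : Pt × Pt) => edg T e.1 e.2) (adjT P A B C) ?_ ?_ ?_ _ F rfl
    ⟨T0, by rw [hF, Finset.mem_filter, mem_TT]; exact ⟨hT0, hT0'⟩⟩ ?_
  · refine hmain.trans (Finset.sum_le_sum ?_)
    intro T hT
    rw [hF, Finset.mem_filter, mem_TT] at hT
    obtain ⟨h, hTL⟩ := hT
    have h2 : (1/2:ℝ) = (Real.sqrt 2)⁻¹ ^ 2 := by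
      rw [inv_pow, Real.sq_sqrt (by norm_num)]; norm_num
    rw [h2, ← pow_mul]
    have hs1 : (1:ℝ) ≤ Real.sqrt 2 := by rw [Real.one_le_sqrt]; norm_num
    refine pow_le_pow_of_le_one (by positivity) (inv_le_one_of_one_le₀ hs1) ?_
    -- counting
    have hex : ∀ e ∈ (Dfl P T).filter (fun e => e ∉ L ∧ (e.2, e.1) ∉ L), ∃ q : Pt × Pt, Fl T e.1 e.2 q.1 q.2 := by
      intro e he
      rw [Finset.mem_filter] at he
      obtain ⟨w, z, hf⟩ := (mem_Dfl h).1 (show (e.1, e.2) ∈ Dfl P T from he.1)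
      exact ⟨(w, z), hf⟩
    choose! q hq using hex
    refine Finset.card_le_mul_card_image_of_maps_to (f := fun e => flipT T e.1 e.2 (q e).1 (q e).2) ?_ 2 ?_
    · intro e he
      have hf := hq e he
      rw [Finset.mem_filter] at he
      rw [Finset.mem_filter, hF, Finset.mem_filter, mem_TT]
      refine ⟨⟨h.flip hP hf.h1 hf.h2 hf.c1 hf.c2, ?_⟩, h, _, _, _, _, hf, rfl⟩
      intro g hg
      refine edg_flipT (hTL g hg) ?_ ?_
      · rintro ⟨e1, e2⟩
        exact he.2.1 (by rw [show e = g from Prod.ext e1.symm e2.symm]; exact hg)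
      · rintro ⟨e1, e2⟩
        exact he.2.2 (by rw [show (e.2, e.1) = g from Prod.ext e1.symm e2.symm]; exact hg)
    · intro T' hT'
      rcases Finset.eq_empty_or_nonempty (((Dfl P T).filter (fun e => e ∉ L ∧ (e.2, e.1) ∉ L)).filter
        (fun e => flipT T e.1 e.2 (q e).1 (q e).2 = T')) with h0 | ⟨e, he⟩
      · rw [h0]; simp
      · refine (Finset.card_le_card (t := {e, (e.2, e.1)}) ?_).trans Finset.card_le_two
        rw [Finset.mem_filter] at he
        intro g hg
        rw [Finset.mem_filter] at hg
        have hfe := hq e he.1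
        have hfg := hq g hg.1
        have hne := Fl.not_edg hP h hfe
        rw [he.2, ← hg.2] at hne
        rw [Finset.mem_insert, Finset.mem_singleton]
        by_contra hcon
        push Not at hcon
        refine hne (edg_flipT ⟨_, hfe.h1⟩ ?_ ?_)
        · rintro ⟨e1, e2⟩; exact hcon.1 (Prod.ext e1.symm e2.symm)
        · rintro ⟨e1, e2⟩; exact hcon.2 (Prod.ext e2.symm e1.symm)
  · rintro T ⟨h, u, v, w, z, hf, e⟩
    have := Fl.not_edg hP h hf
    rw [← e] at this
    exact this ⟨_, hf.h1⟩
  · rintro T T' T'' ⟨x, y⟩ ⟨h, u, v, w, z, hf, rfl⟩ ⟨-, u', v', w', z', hf', rfl⟩ k1 k2 k3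
    have a1 : (x = u ∧ y = v) ∨ (x = v ∧ y = u) := by
      by_contra hc; push Not at hc
      exact k2 (edg_flipT k1 (by tauto) (by tauto))
    have a2 : (x = u' ∧ y = v') ∨ (x = v' ∧ y = u') := by
      by_contra hc; push Not at hc
      exact k3 (edg_flipT k1 (by tauto) (by tauto))
    refine Fl.same hP h hf hf' ?_
    rcases a1 with ⟨rfl, rfl⟩ | ⟨rfl, rfl⟩ <;> rcases a2 with ⟨rfl, rfl⟩ | ⟨rfl, rfl⟩ <;> simp
  · rintro T T' T'' ⟨x, y⟩ ⟨h, u, v, w, z, hf, rfl⟩ ⟨-, u', v', w', z', hf', rfl⟩ k1 k2 k3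
    have a1 := (edg_of_flip h hf k2).resolve_left k1
    have a2 := (edg_of_flip h hf' k3).resolve_left k1
    refine Fl.same hP h hf hf' ?_
    have a3 : (w' = w ∧ z' = z) ∨ (w' = z ∧ z' = w) := by
      rcases a1 with ⟨rfl, rfl⟩ | ⟨rfl, rfl⟩ <;> rcases a2 with ⟨rfl, rfl⟩ | ⟨rfl, rfl⟩ <;> simp
    rcases a3 with ⟨rfl, rfl⟩ | ⟨rfl, rfl⟩
    · exact Or.inl (Fl.diag hP h hf hf')
    · exact Or.inr (Fl.diag hP h hf.symm hf')
  · intro T hT T' hT' he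
    rw [hF, Finset.mem_filter, mem_TT] at hT hT'
    exact hT.1.ext_edg hP hT'.1 (fun x y => he (x, y))

end SC

namespace SC

/-! ### Determinants -/

theorem hadamard_fin (n : ℕ) (K : Matrix (Fin n) (Fin n) ℝ) :
    K.det ≤ ∏ i, √(∑ j, K i j ^ 2) := by
  haveI : Fact (Module.finrank ℝ (EuclideanSpace ℝ (Fin n)) = n) := ⟨by simp⟩
  let b := EuclideanSpace.basisFun (Fin n) ℝ
  have h := (b.toBasis.orientation).abs_volumeForm_apply_le (fun i => WithLp.toLp 2 (K i))
  rw [Orientation.volumeForm_robust _ b rfl] at h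
  have h2 : b.toBasis.det (fun i => WithLp.toLp 2 (K i)) = K.det := by
    rw [Module.Basis.det_apply, ← Matrix.det_transpose]
    congr 1
  rw [h2] at h
  refine (le_abs_self _).trans (h.trans (le_of_eq ?_))
  refine Finset.prod_congr rfl fun i _ => ?_
  rw [EuclideanSpace.norm_eq]
  simp

theorem hadamard {ι : Type*} [Fintype ι] [DecidableEq ι] (K : Matrix ι ι ℝ) :
    K.det ≤ ∏ i, √(∑ j, K i j ^ 2) := by
  let e := Fintype.equivFin ι
  have h := hadamard_fin _ (K.submatrix e.symm e.symm)
  rw [Matrix.det_submatrix_equiv_self] at h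
  refine h.trans (le_of_eq ?_)
  rw [← e.symm.prod_comp]
  refine Finset.prod_congr rfl fun i _ => ?_
  rw [← e.symm.sum_comp]
  rfl

open Equiv.Perm in
/-- reverse the cycle through `i` -/
def rev {ι : Type*} [Fintype ι] [DecidableEq ι] (σ : Equiv.Perm ι) (i : ι) : Equiv.Perm ι :=
  σ * (σ.cycleOf i) ^ (-2 : ℤ)

section
variable {ι : Type*} [Fintype ι] [DecidableEq ι]

theorem cyc_zpow_in {σ : Equiv.Perm ι} {i x : ι} (h : σ.SameCycle i x) (k : ℤ) :
    ((σ.cycleOf i) ^ k) x = (σ ^ k) x := by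
  rw [Equiv.Perm.SameCycle.cycleOf_eq h, Equiv.Perm.cycleOf_zpow_apply_self]

theorem cyc_zpow_out {σ : Equiv.Perm ι} {i x : ι} (h : ¬ σ.SameCycle i x) (k : ℤ) :
    ((σ.cycleOf i) ^ k) x = x :=
  Equiv.Perm.zpow_apply_eq_self_of_apply_eq_self (Equiv.Perm.cycleOf_apply_of_not_sameCycle h) k

theorem cyc_comm (σ : Equiv.Perm ι) (i : ι) : Commute σ (σ.cycleOf i) := by
  ext x
  rw [Equiv.Perm.mul_apply, Equiv.Perm.mul_apply]
  by_cases h : σ.SameCycle i x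
  · rw [h.cycleOf_apply, (Equiv.Perm.sameCycle_apply_right.2 h).cycleOf_apply]
  · rw [Equiv.Perm.cycleOf_apply_of_not_sameCycle h, Equiv.Perm.cycleOf_apply_of_not_sameCycle
      (fun h' => h (Equiv.Perm.sameCycle_apply_right.1 h'))]

theorem rev_zpow_in {σ : Equiv.Perm ι} {i x : ι} (h : σ.SameCycle i x) (k : ℤ) :
    ((rev σ i) ^ k) x = (σ ^ (-k)) x := by
  have hc : Commute σ ((σ.cycleOf i) ^ (-2 : ℤ)) :=
    (cyc_comm σ i).zpow_right _
  rw [rev, hc.mul_zpow, ← zpow_mul, Equiv.Perm.mul_apply, cyc_zpow_in h, ← Equiv.Perm.mul_apply, ← zpow_add]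
  congr 2; ring

theorem rev_zpow_out {σ : Equiv.Perm ι} {i x : ι} (h : ¬ σ.SameCycle i x) (k : ℤ) :
    ((rev σ i) ^ k) x = (σ ^ k) x := by
  have hc : Commute σ ((σ.cycleOf i) ^ (-2 : ℤ)) :=
    (cyc_comm σ i).zpow_right _
  rw [rev, hc.mul_zpow, ← zpow_mul, Equiv.Perm.mul_apply, cyc_zpow_out h]

theorem rev_same (σ : Equiv.Perm ι) (i x y : ι) :
    (rev σ i).SameCycle x y ↔ σ.SameCycle x y := by
  by_cases h : σ.SameCycle i x
  · constructor
    · rintro ⟨k, hk⟩; exact ⟨-k, by rw [← rev_zpow_in h, hk]⟩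
    · rintro ⟨k, hk⟩; exact ⟨-k, by rw [rev_zpow_in h, neg_neg, hk]⟩
  · constructor
    · rintro ⟨k, hk⟩; exact ⟨k, by rw [← rev_zpow_out h, hk]⟩
    · rintro ⟨k, hk⟩; exact ⟨k, by rw [rev_zpow_out h, hk]⟩

theorem rev_in {σ : Equiv.Perm ι} {i x : ι} (h : σ.SameCycle i x) : rev σ i x = σ⁻¹ x := by
  have := rev_zpow_in h 1
  simpa using this

theorem rev_out {σ : Equiv.Perm ι} {i x : ι} (h : ¬ σ.SameCycle i x) : rev σ i x = σ x := by
  have := rev_zpow_out h 1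
  simpa using this

theorem rev_rev (σ : Equiv.Perm ι) (i : ι) : rev (rev σ i) i = σ := by
  ext x
  by_cases h : σ.SameCycle i x
  · rw [rev_in ((rev_same _ _ _ _).2 h), Equiv.Perm.inv_eq_iff_eq, rev_in (Equiv.Perm.sameCycle_apply_right.2 h)]
    simp
  · rw [rev_out (fun h' => h ((rev_same _ _ _ _).1 h')), rev_out h]

theorem rev_sign (σ : Equiv.Perm ι) (i : ι) : Equiv.Perm.sign (rev σ i) = Equiv.Perm.sign σ := by
  rw [rev, Equiv.Perm.sign_mul, map_zpow]
  rcases Int.units_eq_one_or (Equiv.Perm.sign (σ.cycleOf i)) with h | h <;> rw [h] <;> simp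

theorem rev_prod (K : Matrix ι ι ℝ) (hK : ∀ i j, K j i = - K i j) (σ : Equiv.Perm ι) (i : ι)
    (ho : Odd (Finset.univ.filter (fun x => σ.SameCycle i x)).card) :
    ∏ x, K x (rev σ i x) = - ∏ x, K x (σ x) := by
  rw [← Finset.prod_filter_mul_prod_filter_not Finset.univ (fun x => σ.SameCycle i x),
    ← Finset.prod_filter_mul_prod_filter_not (s := Finset.univ) (p := fun x => σ.SameCycle i x) (f := fun x => K x (σ x))]
  have h1 : ∏ x ∈ Finset.univ.filter (fun x => ¬ σ.SameCycle i x), K x (rev σ i x)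
      = ∏ x ∈ Finset.univ.filter (fun x => ¬ σ.SameCycle i x), K x (σ x) :=
    Finset.prod_congr rfl fun x hx => by rw [rev_out (Finset.mem_filter.1 hx).2]
  have h2 : ∏ x ∈ Finset.univ.filter (fun x => σ.SameCycle i x), K x (rev σ i x)
      = ∏ x ∈ Finset.univ.filter (fun x => σ.SameCycle i x), -K x (σ x) := by
    refine Finset.prod_nbij' (fun x => σ⁻¹ x) (fun x => σ x) ?_ ?_ ?_ ?_ ?_
    · intro x hx
      rw [Finset.mem_filter] at hx ⊢
      exact ⟨Finset.mem_univ _, Equiv.Perm.sameCycle_symm_apply_right.2 hx.2⟩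
    · intro x hx
      rw [Finset.mem_filter] at hx ⊢
      exact ⟨Finset.mem_univ _, Equiv.Perm.sameCycle_apply_right.2 hx.2⟩
    · intro x _; simp
    · intro x _; simp
    · intro x hx
      rw [rev_in (Finset.mem_filter.1 hx).2, hK]
      simp
  rw [h1, h2, Finset.prod_neg, ho.neg_one_pow]
  ring

theorem det_even (K : Matrix ι ι ℝ) (hK : ∀ i j, K j i = - K i j) :
    K.det = ∑ σ ∈ (Finset.univ : Finset (Equiv.Perm ι)).filter
      (fun σ => ∀ i, Even (Finset.univ.filter (fun x => σ.SameCycle i x)).card),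
      ((Equiv.Perm.sign σ : ℤ) : ℝ) * ∏ x, K x (σ x) := by
  rw [← Matrix.det_transpose, Matrix.det_apply']
  simp only [Matrix.transpose_apply]
  rw [← Finset.sum_filter_add_sum_filter_not Finset.univ
    (fun σ : Equiv.Perm ι => ∀ i, Even (Finset.univ.filter (fun x => σ.SameCycle i x)).card)]
  rw [add_eq_left]
  by_cases hι : Nonempty ι
  swap
  · rw [Finset.filter_false_of_mem]
    · simp
    · intro σ _ h; exact h (fun i => absurd ⟨i⟩ hι)
  let pick : (ι → ι → Prop) → ι := fun r =>
    Classical.epsilon (fun i => Odd (Finset.univ.filter (fun x => r i x)).card)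
  have hpick : ∀ σ ∈ (Finset.univ : Finset (Equiv.Perm ι)).filter
      (fun σ => ¬ ∀ i, Even (Finset.univ.filter (fun x => σ.SameCycle i x)).card),
      Odd (Finset.univ.filter (fun x => σ.SameCycle (pick σ.SameCycle) x)).card := by
    intro σ hσ
    have h := (Finset.mem_filter.1 hσ).2
    push Not at h
    obtain ⟨i, hi⟩ := h
    have := Classical.epsilon_spec (p := fun i => Odd (Finset.univ.filter (fun x => σ.SameCycle i x)).card)
      ⟨i, Nat.not_even_iff_odd.1 (by convert hi)⟩
    convert this
  have hs : ∀ σ : Equiv.Perm ι, ∀ i, (rev σ i).SameCycle = σ.SameCycle := by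
    intro σ i; funext x y; exact propext (rev_same σ i x y)
  have key : ∀ σ ∈ (Finset.univ : Finset (Equiv.Perm ι)).filter
      (fun σ => ¬ ∀ i, Even (Finset.univ.filter (fun x => σ.SameCycle i x)).card),
      ((Equiv.Perm.sign σ : ℤ) : ℝ) * ∏ x, K x (σ x) +
      ((Equiv.Perm.sign (rev σ (pick σ.SameCycle)) : ℤ) : ℝ) * ∏ x, K x (rev σ (pick σ.SameCycle) x) = 0 := by
    intro σ hσ
    rw [rev_sign, rev_prod K hK _ _ (hpick σ hσ)]; ring
  refine Finset.sum_involution (fun σ _ => rev σ (pick σ.SameCycle)) key ?_ ?_ ?_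
  · intro σ hσ h0 he
    have := key σ hσ
    rw [he] at this
    exact h0 (by linarith)
  · intro σ hσ
    rw [Finset.mem_filter] at hσ ⊢
    refine ⟨Finset.mem_univ _, ?_⟩
    intro h; apply hσ.2
    intro i
    have := h i
    convert this using 3
    rw [hs]
  · intro σ hσ
    simp only [hs]
    exact rev_rev _ _
end

end SC

namespace SC

/-! ### Positivity of even permutations terms -/

def ev {m : ℕ} (k : Fin m) : Fin (2 * m) := ⟨2 * k, by omega⟩
def od {m : ℕ} (k : Fin m) : Fin (2 * m) := ⟨2 * k + 1, by omega⟩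

theorem ev_od {m : ℕ} (i : Fin (2 * m)) : (∃ k : Fin m, i = ev k) ∨ ∃ k : Fin m, i = od k := by
  rcases Nat.even_or_odd' i.1 with ⟨k, hk | hk⟩
  · exact Or.inl ⟨⟨k, by omega⟩, Fin.ext hk⟩
  · exact Or.inr ⟨⟨k, by omega⟩, Fin.ext hk⟩

theorem prod_pairs {m : ℕ} (h : Fin (2 * m) → ℝ) : ∏ q, h q = ∏ k : Fin m, h (ev k) * h (od k) := by
  induction m with
  | zero => simp
  | succ m ih =>
    have h1 : ∏ q, h q = h (ev 0) * (h (od 0) * ∏ q : Fin (2 * m), h (q.succ.succ)) := by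
      change ∏ q : Fin (2 * m + 1 + 1), h q = _
      rw [Fin.prod_univ_succ, Fin.prod_univ_succ]; rfl
    rw [h1, ih, Fin.prod_univ_succ, mul_assoc]
    congr 1

theorem pos_fin (m : ℕ) : ∀ (f : Fin (2 * m) → Fin (2 * m) → ℝ) (g : Fin m → Fin (2 * m) → ℝ)
    (s : Fin m → ℝ)
    (h1 : ∀ k, 0 < s k * f (ev k) (od k)) (h2 : ∀ k, 0 < g k (ev k)) (h3 : ∀ k, 0 < g k (od k))
    (h4 : ∀ k l, k < l → 0 < f (ev k) (ev l) * f (ev k) (od l) * f (od k) (ev l) * f (od k) (od l) *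
      (g k (ev l) * g k (od l) * g l (ev k) * g l (od k))),
    0 < (∏ i, ∏ j ∈ Finset.Ioi i, f i j) * ((∏ k, s k) * ∏ k, ∏ q, g k q) := by
  induction m with
  | zero => intros; simp
  | succ m ih =>
    intro f g s h1 h2 h3 h4
    have hf : ∏ i, ∏ j ∈ Finset.Ioi i, f i j =
        (f (ev 0) (od 0) * ∏ j : Fin (2 * m), f (ev 0) j.succ.succ) * ((∏ j : Fin (2 * m), f (od 0) j.succ.succ) *
          ∏ i : Fin (2 * m), ∏ j ∈ Finset.Ioi i, f i.succ.succ j.succ.succ) := by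
      change ∏ i : Fin (2 * m + 1 + 1), ∏ j ∈ Finset.Ioi i, f i j = _
      rw [Fin.prod_univ_succ, Fin.prod_univ_succ]
      congr 1
      · rw [Fin.prod_Ioi_zero, Fin.prod_univ_succ]; rfl
      · congr 1
        · rw [Fin.prod_Ioi_succ, Fin.prod_Ioi_zero]; rfl
        · refine Finset.prod_congr rfl fun i _ => ?_
          rw [Fin.prod_Ioi_succ, Fin.prod_Ioi_succ]
    have hg : ∀ k, ∏ q, g k q = g k (ev 0) * (g k (od 0) * ∏ q : Fin (2 * m), g k (q.succ.succ)) := by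
      intro k
      change ∏ q : Fin (2 * m + 1 + 1), g k q = _
      rw [Fin.prod_univ_succ, Fin.prod_univ_succ]; rfl
    have IH := ih (fun i j => f i.succ.succ j.succ.succ) (fun k q => g k.succ q.succ.succ) (fun k => s k.succ)
      (fun k => h1 k.succ) (fun k => h2 k.succ) (fun k => h3 k.succ)
      (fun k l hkl => h4 k.succ l.succ (Fin.succ_lt_succ_iff.2 hkl))
    have e4 : 0 < ∏ l : Fin m, (f (ev 0) (ev l.succ) * f (ev 0) (od l.succ) * f (od 0) (ev l.succ) * f (od 0) (od l.succ) *
      (g 0 (ev l.succ) * g 0 (od l.succ) * g l.succ (ev 0) * g l.succ (od 0))) :=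
      Finset.prod_pos fun l _ => h4 0 l.succ (Fin.succ_pos l)
    simp only [Finset.prod_mul_distrib] at e4
    have a1 : ∏ j : Fin (2 * m), f (ev 0) j.succ.succ = (∏ l : Fin m, f (ev 0) (ev l.succ)) * ∏ l : Fin m, f (ev 0) (od l.succ) := by
      rw [prod_pairs, Finset.prod_mul_distrib]; rfl
    have a2 : ∏ j : Fin (2 * m), f (od 0) j.succ.succ = (∏ l : Fin m, f (od 0) (ev l.succ)) * ∏ l : Fin m, f (od 0) (od l.succ) := by
      rw [prod_pairs, Finset.prod_mul_distrib]; rfl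
    have a3 : ∏ j : Fin (2 * m), g 0 j.succ.succ = (∏ l : Fin m, g 0 (ev l.succ)) * ∏ l : Fin m, g 0 (od l.succ) := by
      rw [prod_pairs, Finset.prod_mul_distrib]; rfl
    rw [hf, Fin.prod_univ_succ (f := s), Fin.prod_univ_succ (f := fun k => ∏ q, g k q), hg 0, a1, a2, a3]
    simp only [hg, Finset.prod_mul_distrib]
    have := mul_pos (mul_pos (mul_pos (mul_pos (h1 0) (h2 0)) (h3 0)) e4) IH
    refine lt_of_lt_of_eq this ?_
    ring

theorem vand_perm (n : ℕ) (v : Fin n → ℝ) (τ : Equiv.Perm (Fin n)) :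
    (∏ i, ∏ j ∈ Finset.Ioi i, (v (τ j) - v (τ i))) =
      ((Equiv.Perm.sign τ : ℤ) : ℝ) * ∏ i, ∏ j ∈ Finset.Ioi i, (v j - v i) := by
  rw [← Matrix.det_vandermonde (fun i => v (τ i)), ← Matrix.det_vandermonde, ← Matrix.det_permute]
  rfl

section
variable {ι : Type*} [Fintype ι] [DecidableEq ι]

theorem colour (σ : Equiv.Perm ι) (he : ∀ i, Even (Finset.univ.filter (fun x => σ.SameCycle i x)).card) :
    ∃ B : Finset ι, ∀ x, x ∈ B ↔ σ x ∉ B := by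
  have hodd : ∀ r : ι, ∀ j : ℤ, (σ ^ j) r = r → Even j := by
    intro r j hj
    have h1 : ((Function.minimalPeriod (σ • ·) r : ℕ) : ℤ) ∣ j := by
      rw [← MulAction.zpow_smul_eq_iff_minimalPeriod_dvd]; exact hj
    have h2 : Function.minimalPeriod (σ • ·) r = (Finset.univ.filter (fun x => σ.SameCycle r x)).card := by
      rw [MulAction.minimalPeriod_eq_card, Fintype.card_of_subtype]
      intro x
      rw [Finset.mem_filter]
      constructor
      · rintro ⟨_, k, hk⟩
        exact ⟨⟨σ ^ k, k, rfl⟩, hk⟩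
      · rintro ⟨⟨_, k, rfl⟩, hk⟩
        exact ⟨Finset.mem_univ _, k, hk⟩
    rw [h2] at h1
    exact ((Int.even_coe_nat _).2 (he r)).trans_dvd h1
  let rep : ι → ι := fun x => (Quotient.mk (Equiv.Perm.SameCycle.setoid σ) x).out
  have hrep : ∀ x, σ.SameCycle (rep x) x := fun x => Quotient.mk_out (s := Equiv.Perm.SameCycle.setoid σ) x
  have hrep2 : ∀ x, rep (σ x) = rep x := by
    intro x
    have : (Quotient.mk (Equiv.Perm.SameCycle.setoid σ) (σ x)) = Quotient.mk (Equiv.Perm.SameCycle.setoid σ) x :=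
      Quotient.sound (s := Equiv.Perm.SameCycle.setoid σ) (Equiv.Perm.sameCycle_apply_left.2 (Equiv.Perm.SameCycle.refl σ x))
    simp only [rep]; rw [this]
  refine ⟨Finset.univ.filter (fun x => ∃ k : ℤ, Even k ∧ (σ ^ k) (rep x) = x), fun x => ?_⟩
  simp only [Finset.mem_filter, Finset.mem_univ, true_and, hrep2]
  constructor
  · rintro ⟨k, hk, h⟩ ⟨l, hl, h'⟩
    have : (σ ^ (l - (1 + k))) (rep x) = rep x := by
      have e : (σ ^ (1 + k)) (rep x) = (σ ^ l) (rep x) := by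
        rw [zpow_add, Equiv.Perm.mul_apply, h, h', zpow_one]
      rw [sub_eq_neg_add, zpow_add, Equiv.Perm.mul_apply, ← e, ← Equiv.Perm.mul_apply, ← zpow_add]
      simp
    have := hodd _ _ this
    rw [Int.even_iff] at *
    omega
  · intro h
    obtain ⟨j, hj⟩ := hrep x
    rcases Int.even_or_odd j with hjj | hjj
    · exact ⟨j, hjj, hj⟩
    · exfalso; apply h
      refine ⟨1 + j, ?_, by rw [zpow_add, Equiv.Perm.mul_apply, hj, zpow_one]⟩
      rw [Int.even_iff]; rw [Int.odd_iff] at hjj; omega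

theorem sign_pos (σ : Equiv.Perm ι) (he : ∀ i, Even (Finset.univ.filter (fun x => σ.SameCycle i x)).card)
    (v : ι → ℝ) (s : ι → ι → ℝ) (g : ι → ι → ι → ℝ)
    (h1 : ∀ x, 0 < s x (σ x) * (v (σ x) - v x)) (h2 : ∀ x, 0 < g x (σ x) x) (h3 : ∀ x, 0 < g x (σ x) (σ x))
    (h4 : ∀ x y, x ≠ y → x ≠ σ y → σ x ≠ y →
      0 < (v y - v x) * (v (σ y) - v x) * (v y - v (σ x)) * (v (σ y) - v (σ x)) *
        (g x (σ x) y * g x (σ x) (σ y) * g y (σ y) x * g y (σ y) (σ x))) :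
    0 < ((Equiv.Perm.sign σ : ℤ) : ℝ) * ∏ x, (s x (σ x) * ∏ q, g x (σ x) q) := by
  obtain ⟨B, hB⟩ := colour σ he
  let m := B.card
  let e : Fin m ≃ B := B.equivFin.symm
  let f : Fin (2 * m) → ι := fun i => if i.1 % 2 = 0 then (e ⟨i.1 / 2, by omega⟩ : ι) else σ (e ⟨i.1 / 2, by omega⟩ : ι)
  have fev : ∀ k, f (ev k) = e k := by
    intro k
    simp only [f, ev]
    rw [if_pos (by omega)]
    congr 2; apply Fin.ext; simp
  have fod : ∀ k, f (od k) = σ (e k) := by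
    intro k
    simp only [f, od]
    rw [if_neg (by omega)]
    congr 3; apply Fin.ext; simp; omega
  have eB : ∀ k, (e k : ι) ∈ B := fun k => (e k).2
  have eB' : ∀ k, σ (e k : ι) ∉ B := fun k => (hB _).1 (eB k)
  have hsurj : ∀ x ∈ B, ∃ k, (e k : ι) = x := by
    intro x hx
    refine ⟨e.symm ⟨x, hx⟩, by simp⟩
  have fbij : Function.Bijective f := by
    constructor
    · intro i j hij
      rcases ev_od i with ⟨k, rfl⟩ | ⟨k, rfl⟩ <;> rcases ev_od j with ⟨l, rfl⟩ | ⟨l, rfl⟩ <;>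
        simp only [fev, fod] at hij
      · rw [e.injective (Subtype.ext hij)]
      · exact absurd (hij ▸ eB k) (eB' l)
      · exact absurd (hij ▸ eB l) (eB' k)
      · rw [e.injective (Subtype.ext (σ.injective hij))]
    · intro x
      by_cases hx : x ∈ B
      · obtain ⟨k, hk⟩ := hsurj x hx
        exact ⟨ev k, by rw [fev, hk]⟩
      · have : σ⁻¹ x ∈ B := by rw [hB]; simpa using hx
        obtain ⟨k, hk⟩ := hsurj _ this
        exact ⟨od k, by rw [fod, hk]; simp⟩
  let π : Fin (2 * m) ≃ ι := Equiv.ofBijective f fbij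
  have πf : ∀ i, π i = f i := fun i => rfl
  -- pair claim
  have claim : ∀ ρ : Fin (2 * m) ≃ ι, (∀ k, ρ (od k) = σ (ρ (ev k))) →
      0 < (∏ i, ∏ j ∈ Finset.Ioi i, (v (ρ j) - v (ρ i))) *
        ((∏ k : Fin m, s (ρ (ev k)) (ρ (od k))) * ∏ k : Fin m, ∏ q, g (ρ (ev k)) (ρ (od k)) q) := by
    intro ρ hρ
    have hne : ∀ k l : Fin m, ev k ≠ od l := by
      intro k l h; have := congrArg Fin.val h; simp only [ev, od] at this; omega
    have hne2 : ∀ k l : Fin m, k ≠ l → ev k ≠ ev l := by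
      intro k l h h'; have := congrArg Fin.val h'; simp only [ev] at this; apply h; apply Fin.ext; omega
    have := pos_fin m (fun i j => v (ρ j) - v (ρ i)) (fun k q => g (ρ (ev k)) (ρ (od k)) (ρ q))
      (fun k => s (ρ (ev k)) (ρ (od k)))
      (fun k => by simp only [hρ]; exact h1 _) (fun k => by simp only [hρ]; exact h2 _)
      (fun k => by simp only [hρ]; exact h3 _)
      (fun k l hkl => by
        have := h4 (ρ (ev k)) (ρ (ev l)) (fun h => hne2 _ _ hkl.ne (ρ.injective h))
          (fun h => hne k l (ρ.injective (by rw [hρ, h])))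
          (fun h => hne l k (ρ.injective (by rw [hρ, h])))
        simp only [hρ]
        exact this)
    have e2 : ∀ k : Fin m, ∏ q : Fin (2 * m), g (ρ (ev k)) (ρ (od k)) (ρ q) = ∏ q, g (ρ (ev k)) (ρ (od k)) q :=
      fun k => ρ.prod_comp (fun q => g (ρ (ev k)) (ρ (od k)) q)
    simp only [e2] at this
    exact this
  have c1 := claim π (fun k => by rw [πf, πf, fev, fod])
  have c2 := claim (π.trans σ) (fun k => by simp only [Equiv.trans_apply]; rw [πf, πf, fev, fod])
  have hV := vand_perm (2 * m) (fun i => v (π i)) (π.symm.permCongr σ)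
  have hs : Equiv.Perm.sign (π.symm.permCongr σ) = Equiv.Perm.sign σ := by
    exact Equiv.Perm.sign_permCongr _ _
  have hV2 : (∏ i, ∏ j ∈ Finset.Ioi i, (v ((π.trans σ) j) - v ((π.trans σ) i))) =
      ((Equiv.Perm.sign σ : ℤ) : ℝ) * ∏ i, ∏ j ∈ Finset.Ioi i, (v (π j) - v (π i)) := by
    rw [← hs, ← hV]
    simp [Equiv.permCongr_apply]
  have hprod : ∏ x, (s x (σ x) * ∏ q, g x (σ x) q) =
      ((∏ k : Fin m, s (π (ev k)) (π (od k))) * ∏ k : Fin m, ∏ q, g (π (ev k)) (π (od k)) q) *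
      ((∏ k : Fin m, s ((π.trans σ) (ev k)) ((π.trans σ) (od k))) * ∏ k : Fin m, ∏ q, g ((π.trans σ) (ev k)) ((π.trans σ) (od k)) q) := by
    rw [← π.prod_comp, prod_pairs]
    simp only [← Finset.prod_mul_distrib]
    refine Finset.prod_congr rfl fun k _ => ?_
    simp only [Equiv.trans_apply]
    rw [πf, πf, fev, fod]
  rw [hprod]
  rw [hV2] at c2
  have hpos := mul_pos c1 c2
  set V := ∏ i, ∏ j ∈ Finset.Ioi i, (v (π j) - v (π i))
  have hV0 : 0 ≤ V * V := mul_self_nonneg V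
  refine pos_of_mul_pos_right (a := V * V) ?_ hV0
  refine lt_of_lt_of_eq hpos ?_
  ring
end

end SC

namespace SC

/-! ### The signed matrix -/

def lam (d x : Pt) : ℝ := d.1 * x.2 - d.2 * x.1

theorem lam_pl (d q x y z : Pt) :
    (lam d x - lam d q) * o q y z + (lam d y - lam d q) * o q z x + (lam d z - lam d q) * o q x y = 0 := by
  unfold lam o; ring

def bel (d a b q : Pt) : ℝ :=
  if (lam d q - lam d a) * (lam d q - lam d b) < 0 ∧ o a b q * (lam d b - lam d a) < 0 then -1 else 1

theorem bel_symm (d a b q : Pt) : bel d b a q = bel d a b q := by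
  unfold bel
  rw [o_swap a b q]
  have e1 : (lam d q - lam d b) * (lam d q - lam d a) = (lam d q - lam d a) * (lam d q - lam d b) := by ring
  have e2 : -o a b q * (lam d a - lam d b) = o a b q * (lam d b - lam d a) := by ring
  rw [e1, e2]

theorem bel_left (d a b : Pt) : bel d a b a = 1 := by
  unfold bel; rw [if_neg]; simp

theorem bel_right (d a b : Pt) : bel d a b b = 1 := by
  unfold bel; rw [if_neg]; simp

theorem bel_abs (d a b q : Pt) : |bel d a b q| = 1 := by
  unfold bel; split_ifs <;> simp

theorem bel_out {d a b q : Pt} (h : 0 ≤ (lam d q - lam d a) * (lam d q - lam d b)) : bel d a b q = 1 := by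
  unfold bel; rw [if_neg]; exact fun h' => absurd h'.1 (not_lt.2 h)

theorem bel_pos {d a b q : Pt} (hab : lam d a < lam d b) (h : 0 < o a b q) : bel d a b q = 1 := by
  unfold bel; rw [if_neg]
  exact fun h' => absurd h'.2 (not_lt.2 (mul_pos h (sub_pos.2 hab)).le)

theorem bel_neg {d a b q : Pt} (h1 : lam d a < lam d q) (h2 : lam d q < lam d b) (h : o a b q < 0) :
    bel d a b q = -1 := by
  unfold bel; rw [if_pos]
  exact ⟨mul_neg_of_pos_of_neg (sub_pos.2 h1) (sub_neg.2 h2),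
    mul_neg_of_neg_of_pos h (by linarith)⟩

def four (d a b c e : Pt) : ℝ :=
  (lam d c - lam d a) * (lam d e - lam d a) * (lam d c - lam d b) * (lam d e - lam d b) *
    (bel d a b c * bel d a b e * bel d c e a * bel d c e b)

theorem mnn {x y : ℝ} (hx : x ≤ 0) (hy : y ≤ 0) : 0 ≤ x * y := by nlinarith

theorem four_core {d a b c e : Pt} (hX : ¬ X a b c e) (h1 : o a b c ≠ 0) (h2 : o a b e ≠ 0)
    (h3 : o c e a ≠ 0) (h4 : o c e b ≠ 0) (hab : lam d a < lam d b) (hce : lam d c < lam d e)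
    (hac : lam d a < lam d c) (hbc : lam d b ≠ lam d c) (hbe : lam d b ≠ lam d e) :
    0 < four d a b c e := by
  unfold four
  rw [bel_out (a := c) (b := e) (q := a) (mnn (by linarith) (by linarith))]
  have i1 := lam_pl d b a c e
  have i2 := lam_pl d c a b e
  have i3 := lam_pl d e a b c
  have r1 : o b c e = o c e b := o_rot' c e b
  have r2 : o b e a = o a b e := by unfold o; ring
  have r3 : o b a c = - o a b c := o_swap a b c
  have r4 : o c b e = - o c e b := by unfold o; ring
  have r5 : o c a b = o a b c := by unfold o; ring
  have r6 : o e b c = o c e b := by unfold o; ring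
  have r7 : o e c a = - o c e a := by unfold o; ring
  have r8 : o e a b = o a b e := by unfold o; ring
  rw [r1, r2, r3] at i1
  rw [r4, r5] at i2
  rw [r6, r7, r8] at i3
  rcases lt_or_gt_of_ne hbc with hbc | hbc
  · -- disjoint
    rw [bel_out (a := a) (b := b) (q := c) (mul_nonneg (by linarith) (by linarith)), bel_out (a := a) (b := b) (q := e) (mul_nonneg (by linarith) (by linarith)),
      bel_out (a := c) (b := e) (q := b) (mnn (by linarith) (by linarith))]
    have := sub_pos.2 hbc
    have := sub_pos.2 hac
    have : 0 < lam d e - lam d a := by linarith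
    have : 0 < lam d e - lam d b := by linarith
    positivity
  have p1 : 0 < lam d c - lam d a := by linarith
  have p2 : 0 < lam d e - lam d a := by linarith
  have p3 : 0 < lam d b - lam d c := by linarith
  have p4 : 0 < lam d b - lam d a := by linarith
  have p5 : 0 < lam d e - lam d c := by linarith
  rcases lt_or_gt_of_ne hbe with hbe | hbe
  · -- interleaved
    rw [bel_out (a := a) (b := b) (q := e) (mul_nonneg (by linarith) (by linarith))]
    have p6 : 0 < lam d e - lam d b := by linarith
    have hp : 0 < (lam d c - lam d a) * (lam d e - lam d a) * (lam d b - lam d c) * (lam d e - lam d b) := by positivity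
    rcases lt_or_gt_of_ne h1 with g1 | g1 <;> rcases lt_or_gt_of_ne h4 with g4 | g4
    · exfalso; apply hX
      have q1 : 0 < o a b e := by
        by_contra hc; push Not at hc
        linarith [mul_pos_of_neg_of_neg g1 (neg_lt_zero.2 p6), mul_pos_of_neg_of_neg g4 (neg_lt_zero.2 p4), mnn hc (neg_nonpos.2 p3.le)]
      have q2 : 0 < o c e a := by
        by_contra hc; push Not at hc
        linarith [mul_pos_of_neg_of_neg g1 (neg_lt_zero.2 p5), mul_pos_of_neg_of_neg g4 (neg_lt_zero.2 p1), mnn hc (neg_nonpos.2 p3.le)]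
      exact ⟨mul_neg_of_neg_of_pos g1 q1, mul_neg_of_pos_of_neg q2 g4⟩
    · rw [bel_neg hac hbc g1, bel_pos hce g4]; linarith
    · rw [bel_pos hab g1, bel_neg hbc hbe g4]; linarith
    · exfalso; apply hX
      have q1 : o a b e < 0 := by
        by_contra hc; push Not at hc
        linarith [mul_pos g1 p6, mul_pos g4 p4, mul_nonneg hc p3.le]
      have q2 : o c e a < 0 := by
        by_contra hc; push Not at hc
        linarith [mul_pos g1 p5, mul_pos g4 p1, mul_nonneg hc p3.le]
      exact ⟨mul_neg_of_pos_of_neg g1 q1, mul_neg_of_neg_of_pos q2 g4⟩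
  · -- nested
    rw [bel_out (a := c) (b := e) (q := b) (mul_nonneg (by linarith) (by linarith))]
    have p6 : 0 < lam d b - lam d e := by linarith
    have hp : 0 < (lam d c - lam d a) * (lam d e - lam d a) * (lam d b - lam d c) * (lam d b - lam d e) := by positivity
    rcases lt_or_gt_of_ne h1 with g1 | g1 <;> rcases lt_or_gt_of_ne h2 with g2 | g2
    · rw [bel_neg hac hbc g1, bel_neg (by linarith) hbe g2]; linarith
    · exfalso; apply hX
      refine ⟨mul_neg_of_neg_of_pos g1 g2, ?_⟩
      rcases lt_or_gt_of_ne h3 with g3 | g3 <;> rcases lt_or_gt_of_ne h4 with g4 | g4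
      · exfalso
        linarith [mul_pos_of_neg_of_neg g1 (neg_lt_zero.2 p5), mul_pos_of_neg_of_neg g4 (neg_lt_zero.2 p1), mul_pos_of_neg_of_neg g3 (neg_lt_zero.2 p3)]
      · exact mul_neg_of_neg_of_pos g3 g4
      · exact mul_neg_of_pos_of_neg g3 g4
      · exfalso
        linarith [mul_pos g2 p5, mul_pos g4 p2, mul_pos g3 p6]
    · exfalso; apply hX
      refine ⟨mul_neg_of_pos_of_neg g1 g2, ?_⟩
      rcases lt_or_gt_of_ne h3 with g3 | g3 <;> rcases lt_or_gt_of_ne h4 with g4 | g4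
      · exfalso
        linarith [mul_pos_of_neg_of_neg g2 (neg_lt_zero.2 p5), mul_pos_of_neg_of_neg g4 (neg_lt_zero.2 p2), mul_pos_of_neg_of_neg g3 (neg_lt_zero.2 p6)]
      · exact mul_neg_of_neg_of_pos g3 g4
      · exact mul_neg_of_pos_of_neg g3 g4
      · exfalso
        linarith [mul_pos g1 p5, mul_pos g4 p1, mul_pos g3 p3]
    · rw [bel_pos hab g1, bel_pos hab g2]; linarith

theorem four_s1 (d a b c e : Pt) : four d b a c e = four d a b c e := by
  unfold four; rw [bel_symm d a b c, bel_symm d a b e]; ring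
theorem four_s2 (d a b c e : Pt) : four d a b e c = four d a b c e := by
  unfold four; rw [bel_symm d c e a, bel_symm d c e b]; ring
theorem four_s3 (d a b c e : Pt) : four d c e a b = four d a b c e := by
  unfold four; ring

theorem four_pos {d a b c e : Pt} (hX : ¬ X a b c e) (h1 : o a b c ≠ 0) (h2 : o a b e ≠ 0)
    (h3 : o c e a ≠ 0) (h4 : o c e b ≠ 0) (hab : lam d a ≠ lam d b) (hce : lam d c ≠ lam d e)
    (hac : lam d a ≠ lam d c) (hae : lam d a ≠ lam d e) (hbc : lam d b ≠ lam d c) (hbe : lam d b ≠ lam d e) :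
    0 < four d a b c e := by
  have key : ∀ a b c e : Pt, ¬ X a b c e → o a b c ≠ 0 → o a b e ≠ 0 →
      o c e a ≠ 0 → o c e b ≠ 0 → lam d a < lam d b → lam d c < lam d e →
      lam d a ≠ lam d c → lam d a ≠ lam d e → lam d b ≠ lam d c → lam d b ≠ lam d e → 0 < four d a b c e := by
    intro a b c e hX h1 h2 h3 h4 hab hce hac hae hbc hbe
    rcases lt_or_gt_of_ne hac with h | h
    · exact four_core hX h1 h2 h3 h4 hab hce h hbc hbe
    · rw [← four_s3]
      exact four_core (fun h => hX ⟨h.2, h.1⟩) h3 h4 h1 h2 hce hab h hae.symm hbe.symm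
  have n1 : ∀ {x y z : Pt}, o x y z ≠ 0 → o y x z ≠ 0 := by
    intro x y z h; rw [o_swap]; exact neg_ne_zero.2 h
  have x1 : ∀ {a b c e : Pt}, X b a c e → X a b c e := by
    intro a b c e h; unfold X at *
    rw [o_swap a b c, o_swap a b e] at h
    exact ⟨by linarith [h.1], by linarith [h.2]⟩
  have x2 : ∀ {a b c e : Pt}, X a b e c → X a b c e := by
    intro a b c e h; unfold X at *
    rw [o_swap c e a, o_swap c e b] at h
    exact ⟨by linarith [h.1], by linarith [h.2]⟩
  rcases lt_or_gt_of_ne hab with h | h <;> rcases lt_or_gt_of_ne hce with h' | h'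
  · exact key a b c e hX h1 h2 h3 h4 h h' hac hae hbc hbe
  · rw [← four_s2]
    exact key a b e c (fun h => hX (x2 h)) h2 h1 (n1 h3) (n1 h4) h h' hae hac hbe hbc
  · rw [← four_s1]
    exact key b a c e (fun h => hX (x1 h)) (n1 h1) (n1 h2) h4 h3 h h' hbc hbe hac hae
  · rw [← four_s1, ← four_s2]
    exact key b a e c (fun h => hX (x1 (x2 h))) (n1 h2) (n1 h1) (n1 h4) (n1 h3) h h' hbe hbc hae hac

theorem perm_sum (S : Finset Pt) (hgp : ∀ a ∈ S, ∀ b ∈ S, ∀ c ∈ S, a ≠ b → a ≠ c → b ≠ c → o a b c ≠ 0)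
    (w : Pt → Pt → ℝ) (w0 : ∀ a b, 0 ≤ w a b) (ws : ∀ a b, w b a = w a b) (wd : ∀ a, w a a = 0)
    (wX : ∀ a b c e, 0 < w a b → 0 < w c e → ¬ X a b c e)
    (F : Finset (Equiv.Perm S))
    (hF : ∀ σ ∈ F, ∀ i, Even (Finset.univ.filter (fun x => σ.SameCycle i x)).card) :
    ∑ σ ∈ F, ∏ x : S, w x (σ x) ≤ ∏ i : S, √(∑ j : S, w i j ^ 2) := by
  obtain ⟨d, hd0, hd⟩ := exists_dir S
  have hl : ∀ a ∈ S, ∀ b ∈ S, a ≠ b → lam d a ≠ lam d b := by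
    intro a ha b hb hab h
    apply hd a ha b hb hab
    unfold lam at h; unfold sd; linarith
  let K : Matrix S S ℝ := fun i j => w i j * (Real.sign (lam d j - lam d i) * ∏ q : S, bel d i j q)
  have hK : ∀ i j, K j i = - K i j := by
    intro i j
    simp only [K]
    rw [ws, ← neg_sub (lam d j) (lam d i), Real.sign_neg]
    simp only [bel_symm d i j]
    ring
  have hterm : ∀ σ : Equiv.Perm S, (∀ i, Even (Finset.univ.filter (fun x => σ.SameCycle i x)).card) →
      ((Equiv.Perm.sign σ : ℤ) : ℝ) * ∏ x, K x (σ x) = ∏ x : S, w x (σ x) := by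
    intro σ hσ
    simp only [K]
    rw [Finset.prod_mul_distrib]
    by_cases hz : ∃ x : S, w x (σ x) = 0
    · obtain ⟨x, hx⟩ := hz
      rw [Finset.prod_eq_zero (Finset.mem_univ x) hx]; simp
    push Not at hz
    have hp : ∀ x : S, 0 < w x (σ x) := fun x => lt_of_le_of_ne (w0 _ _) (Ne.symm (hz x))
    have hne : ∀ x : S, (x : Pt) ≠ (σ x : Pt) := by
      intro x h; apply hz x; rw [← h, wd]
    have hpos := sign_pos σ hσ (fun x : S => lam d x) (fun x y : S => Real.sign (lam d y - lam d x))
      (fun x y q : S => bel d x y q)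
      (fun x => by
        rcases lt_or_gt_of_ne (hl _ x.2 _ (σ x).2 (hne x)) with h | h
        · rw [Real.sign_of_pos (by linarith)]; linarith
        · rw [Real.sign_of_neg (by linarith)]; linarith)
      (fun x => by simp only [bel_left]; norm_num) (fun x => by simp only [bel_right]; norm_num)
      (fun x y h1 h2 h3 => by
        have e1 : (x : Pt) ≠ y := fun h => h1 (Subtype.ext h)
        have e2 : (x : Pt) ≠ σ y := fun h => h2 (Subtype.ext h)
        have e3 : (σ x : Pt) ≠ y := fun h => h3 (Subtype.ext h)
        have e4 : (σ x : Pt) ≠ σ y := fun h => h1 (σ.injective (Subtype.ext h))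
        have := four_pos (d := d) (wX _ _ _ _ (hp x) (hp y))
          (hgp _ x.2 _ (σ x).2 _ y.2 (hne x) e1 e3)
          (hgp _ x.2 _ (σ x).2 _ (σ y).2 (hne x) e2 e4)
          (hgp _ y.2 _ (σ y).2 _ x.2 (hne y) e1.symm e2.symm)
          (hgp _ y.2 _ (σ y).2 _ (σ x).2 (hne y) e3.symm e4.symm)
          (hl _ x.2 _ (σ x).2 (hne x)) (hl _ y.2 _ (σ y).2 (hne y))
          (hl _ x.2 _ y.2 e1) (hl _ x.2 _ (σ y).2 e2) (hl _ (σ x).2 _ y.2 e3) (hl _ (σ x).2 _ (σ y).2 e4)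
        exact this)
    set Q := ∏ x : S, (Real.sign (lam d (σ x) - lam d x) * ∏ q : S, bel d x (σ x) q) with hQ
    have habs : |((Equiv.Perm.sign σ : ℤ) : ℝ) * Q| = 1 := by
      rw [abs_mul, hQ, Finset.abs_prod]
      have h1 : |((Equiv.Perm.sign σ : ℤ) : ℝ)| = 1 := by
        rcases Int.units_eq_one_or (Equiv.Perm.sign σ) with h | h <;> rw [h] <;> simp
      rw [h1, one_mul]
      apply Finset.prod_eq_one
      intro x _
      rw [abs_mul, Finset.abs_prod, Finset.prod_eq_one (fun q _ => bel_abs _ _ _ _), mul_one]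
      rcases lt_or_gt_of_ne (hl _ x.2 _ (σ x).2 (hne x)) with h | h
      · rw [Real.sign_of_pos (by linarith)]; simp
      · rw [Real.sign_of_neg (by linarith)]; simp
    rw [abs_of_pos hpos] at habs
    rw [mul_left_comm, habs, mul_one]
  calc ∑ σ ∈ F, ∏ x : S, w x (σ x) ≤ K.det := by
        rw [det_even K hK]
        rw [Finset.sum_congr rfl (fun σ hσ => hterm σ (Finset.mem_filter.1 hσ).2)]
        refine Finset.sum_le_sum_of_subset_of_nonneg ?_ ?_
        · intro σ hσ
          exact Finset.mem_filter.2 ⟨Finset.mem_univ _, hF σ hσ⟩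
        · intros; exact Finset.prod_nonneg fun _ _ => w0 _ _
    _ ≤ _ := hadamard K
    _ ≤ _ := by
        refine Finset.prod_le_prod (fun _ _ => Real.sqrt_nonneg _) fun i _ => Real.sqrt_le_sqrt ?_
        refine Finset.sum_le_sum fun j _ => ?_
        simp only [K]
        rw [mul_pow]
        have : (Real.sign (lam d j - lam d i) * ∏ q : S, bel d i j q) ^ 2 ≤ 1 := by
          rw [sq_le_one_iff_abs_le_one, abs_mul, Finset.abs_prod, Finset.prod_eq_one (fun q _ => bel_abs _ _ _ _), mul_one]
          rcases Real.sign_apply_eq (lam d j - lam d i) with h | h | h <;> rw [h] <;> simp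
        nlinarith [sq_nonneg (w i j)]

end SC

namespace SC
variable {P : Finset Pt} {A B C : Pt} {T : Finset (Pt × Pt × Pt)} {p : Pt}

/-! ### Row sums -/

def gam : ℝ := 11 / 2 * Real.exp (-(5 / 11))

theorem exp_aux : Real.exp (13 / 22) ≤ 11 / 6 := by
  have h1 : Real.exp (13 / 22) ^ 22 ≤ (11 / 6 : ℝ) ^ 22 := by
    rw [← Real.exp_nat_mul]
    have : ((22 : ℕ) : ℝ) * (13 / 22) = (13 : ℕ) * 1 := by norm_num
    rw [this, Real.exp_nat_mul]
    calc Real.exp 1 ^ 13 ≤ (2.7182818286 : ℝ) ^ 13 := by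
          gcongr; exact Real.exp_one_lt_d9.le
      _ ≤ _ := by norm_num
  exact le_of_pow_le_pow_left₀ (by norm_num) (by norm_num) h1

theorem numerics {ι : Type*} [DecidableEq ι] (I J : Finset ι) (hJ : J ⊆ I) (R : ι → ℝ) (R0 : ∀ i ∈ I, 0 ≤ R i)
    (RJ : ∀ i ∈ J, R i ≤ 3) (D : ℕ) (hD : 2 * (I \ J).card ≤ D)
    (hs : ∑ i ∈ I \ J, R i ≤ 6 * (I \ J).card + 3 * J.card + 3 * D) :
    (1 / 2 : ℝ) ^ D * ∏ i ∈ I, R i ≤ gam ^ I.card := by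
  set s := (I \ J).card
  set t := J.card
  have hcard : I.card = s + t := by
    have := Finset.card_sdiff_add_card_eq_card hJ; omega
  have h1 : ∏ i ∈ J, R i ≤ 3 ^ t :=
    (Finset.prod_le_prod (fun i hi => R0 i (hJ hi)) (fun i hi => RJ i hi)).trans (by simp [t])
  have h2 : ∏ i ∈ I \ J, R i ≤ 22 ^ s * Real.exp ((6 * s + 3 * t + 3 * D) / 22 - s) := by
    calc ∏ i ∈ I \ J, R i ≤ ∏ i ∈ I \ J, (22 * Real.exp (R i / 22 - 1)) := by
          refine Finset.prod_le_prod (fun i hi => R0 i (Finset.sdiff_subset hi)) fun i _ => ?_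
          have := Real.add_one_le_exp (R i / 22 - 1)
          linarith
      _ = 22 ^ s * Real.exp (∑ i ∈ I \ J, (R i / 22 - 1)) := by
          rw [Finset.prod_mul_distrib, Finset.prod_const, Real.exp_sum]
      _ ≤ _ := by
          gcongr
          rw [Finset.sum_sub_distrib, ← Finset.sum_div, Finset.sum_const, nsmul_eq_mul, mul_one]
          have : (∑ i ∈ I \ J, R i) / 22 ≤ (6 * s + 3 * t + 3 * D) / 22 := by gcongr
          exact sub_le_sub_right this _
  have e13 := exp_aux
  have e3 : Real.exp (3 / 22) ≤ 11 / 6 := (Real.exp_le_exp.2 (by norm_num)).trans e13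
  have hb : Real.exp (3 / 22) / 2 ≤ 1 := by linarith
  have hb0 : 0 ≤ Real.exp (3 / 22) / 2 := by positivity
  rw [← Finset.prod_sdiff hJ]
  have hP0 : 0 ≤ ∏ i ∈ J, R i := Finset.prod_nonneg fun i hi => R0 i (hJ hi)
  calc (1 / 2 : ℝ) ^ D * ((∏ i ∈ I \ J, R i) * ∏ i ∈ J, R i)
      ≤ (1 / 2 : ℝ) ^ D * ((22 ^ s * Real.exp ((6 * s + 3 * t + 3 * D) / 22 - s)) * 3 ^ t) := by
        gcongr
    _ = (Real.exp (3 / 22) / 2) ^ D * ((22 * Real.exp (6 / 22 - 1)) ^ s * (3 * Real.exp (3 / 22)) ^ t) := by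
        rw [div_pow (Real.exp (3 / 22)) 2 D, mul_pow, mul_pow, ← Real.exp_nat_mul, ← Real.exp_nat_mul, ← Real.exp_nat_mul]
        have : ((6 * s + 3 * t + 3 * D) / 22 - s : ℝ) = D * (3 / 22) + (s * (6 / 22 - 1) + t * (3 / 22)) := by ring
        rw [this, Real.exp_add, Real.exp_add, div_pow, one_pow]
        ring
    _ ≤ (Real.exp (3 / 22) / 2) ^ (2 * s) * ((22 * Real.exp (6 / 22 - 1)) ^ s * (3 * Real.exp (3 / 22)) ^ t) := by
        refine mul_le_mul_of_nonneg_right (pow_le_pow_of_le_one hb0 hb hD) (by positivity)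
    _ = gam ^ s * (3 * Real.exp (3 / 22)) ^ t := by
        rw [pow_mul, ← mul_assoc, ← mul_pow]
        congr 2
        unfold gam
        rw [div_pow, ← Real.exp_nat_mul]
        have : (-(5 / 11) : ℝ) = ((2 : ℕ) : ℝ) * (3 / 22) + (6 / 22 - 1) := by norm_num
        rw [this, Real.exp_add]; ring
    _ ≤ gam ^ s * gam ^ t := by
        have hg : 0 ≤ gam := by unfold gam; positivity
        refine mul_le_mul_of_nonneg_left ?_ (pow_nonneg hg s)
        refine pow_le_pow_left₀ (by positivity) ?_ _
        unfold gam
        have : (3 / 22 : ℝ) = 13 / 22 + -(5 / 11) := by norm_num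
        rw [this, Real.exp_add]
        have hp := Real.exp_pos (-(5 / 11))
        nlinarith
    _ = _ := by rw [hcard, pow_add]

/-- wide directed edges -/
def Wd (P : Finset Pt) (T : Finset (Pt × Pt × Pt)) : Finset (Pt × Pt) :=
  (P ×ˢ P).filter (fun e => ∃ a b, (e.1, a, e.2) ∈ T ∧ (e.1, e.2, b) ∈ T ∧ o e.1 a b < 0)

theorem hull_not_wide (hP : Cfg P A B C) (h : Tri P A B C T) {x x' a y b : Pt} (hh : hullE A B C x x')
    (h1 : (x, a, y) ∈ T) (h2 : (x, y, b) ∈ T) : ¬ o x a b < 0 := by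
  intro hn
  have k1 := hP.hull_nonneg hh (h.mem2 h1)
  have k2 := hP.hull_nonneg hh (h.mem3 h1)
  have k3 := hP.hull_nonneg hh (h.mem3 h2)
  have p1 := h.pos _ _ _ h1
  have p2 := h.pos _ _ _ h2
  have hpl := o_pl x x' a y b
  have e : o x b a = - o x a b := o_swap' x a b
  rw [e] at hpl
  have z1 : o x x' a = 0 := by
    by_contra hc
    have : 0 < o x x' a := lt_of_le_of_ne k1 (Ne.symm hc)
    nlinarith [mul_pos this p2, mul_nonneg k2 (neg_nonneg.2 hn.le), mul_nonneg k3 p1.le]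
  have z2 : o x x' y = 0 := by
    by_contra hc
    have : 0 < o x x' y := lt_of_le_of_ne k2 (Ne.symm hc)
    nlinarith [mul_pos this (neg_pos.2 hn), mul_nonneg k1 p2.le, mul_nonneg k3 p1.le]
  obtain ⟨n1, n2, n3⟩ := ne_of_o_pos hP.abc
  have hx : x ∈ P ∧ x' ∈ P ∧ x ≠ x' := by
    rcases hh with ⟨rfl, rfl⟩ | ⟨rfl, rfl⟩ | ⟨rfl, rfl⟩
    · exact ⟨hP.hA, hP.hB, n1⟩
    · exact ⟨hP.hB, hP.hC, n3⟩
    · exact ⟨hP.hC, hP.hA, n2.symm⟩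
  obtain ⟨m1, m2, m3⟩ := ne_of_o_pos p1
  have a1 : a = x' := by
    by_contra hc
    exact hP.gp _ hx.1 _ hx.2.1 _ (h.mem2 h1) hx.2.2 m1 (Ne.symm hc) z1
  have a2 : y = x' := by
    by_contra hc
    exact hP.gp _ hx.1 _ hx.2.1 _ (h.mem3 h1) hx.2.2 m2 (Ne.symm hc) z2
  exact m3 (a1.trans a2.symm)

def T3 (P : Finset Pt) (A B C : Pt) (T : Finset (Pt × Pt × Pt)) : Finset Pt :=
  (inn P A B C).filter (fun v => ∃ a b c, root T v a b c)

theorem card_Wd (hP : Cfg P A B C) (h : Tri P A B C T) :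
    (Wd P T).card ≤ 2 * (inn P A B C).card + (T3 P A B C T).card := by
  have hm : ∀ e ∈ Wd P T, e.1 ∈ inn P A B C := by
    rintro ⟨x, y⟩ he
    obtain ⟨-, a, b, h1, h2, h3⟩ := Finset.mem_filter.1 he
    simp only at h1 h2 h3 ⊢
    rw [mem_inn]
    refine ⟨h.mem _ _ _ h1, ?_, ?_, ?_⟩
    · rintro rfl; exact hull_not_wide hP h (x' := B) (Or.inl ⟨rfl, rfl⟩) h1 h2 h3
    · rintro rfl; exact hull_not_wide hP h (x' := C) (Or.inr (Or.inl ⟨rfl, rfl⟩)) h1 h2 h3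
    · rintro rfl; exact hull_not_wide hP h (x' := A) (Or.inr (Or.inr ⟨rfl, rfl⟩)) h1 h2 h3
  rw [Finset.card_eq_sum_card_fiberwise (f := Prod.fst) (t := inn P A B C) hm]
  have hT3 : (T3 P A B C T).card = ∑ v ∈ inn P A B C, if (∃ a b c, root T v a b c) then 1 else 0 := by
    unfold T3; rw [Finset.card_filter]
  rw [hT3, mul_comm, ← smul_eq_mul, ← Finset.sum_const, ← Finset.sum_add_distrib]
  refine Finset.sum_le_sum fun v hv => ?_
  have hp := Inn_iff.2 hv
  split_ifs with hr
  · obtain ⟨a, b, c, hr⟩ := hr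
    have : (Wd P T).filter (fun e => e.1 = v) ⊆ {(v, a), (v, b), (v, c)} := by
      rintro ⟨x, y⟩ he
      obtain ⟨he', hxv⟩ := Finset.mem_filter.1 he
      change x = v at hxv
      subst hxv
      obtain ⟨a', b', hq⟩ := (Finset.mem_filter.1 he').2
      have h2 : (x, y, b') ∈ T := hq.2.1
      rcases hr.only hP h hp h2 with rfl | rfl | rfl <;> simp
    exact (Finset.card_le_card this).trans Finset.card_le_three
  · push Not at hr
    obtain ⟨a, b, hab, hw⟩ := h.wide_edge hP hp hr
    have : (Wd P T).filter (fun e => e.1 = v) ⊆ {(v, a), (v, b)} := by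
      rintro ⟨x, y⟩ he
      obtain ⟨he', hxv⟩ := Finset.mem_filter.1 he
      change x = v at hxv
      subst hxv
      obtain ⟨a', b', hq⟩ := (Finset.mem_filter.1 he').2
      have h1 : (x, a', y) ∈ T := hq.1
      have h2 : (x, y, b') ∈ T := hq.2.1
      have h3 : o x a' b' < 0 := hq.2.2
      by_contra hc
      simp only [Finset.mem_insert, Finset.mem_singleton, Prod.mk.injEq, true_and] at hc
      push Not at hc
      exact absurd (hw _ _ _ h1 h2 hc.1 hc.2) (not_lt.2 h3.le)
    exact (Finset.card_le_card this).trans Finset.card_le_two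

theorem card_Dfl_ge (hP : Cfg P A B C) (h : Tri P A B C T) :
    2 * (inn P A B C).card ≤ (Dfl P T).card + 2 * (T3 P A B C T).card := by
  let De : Finset (Pt × Pt) := T.image (fun t => (t.1, t.2.1))
  have hDe : De.card = 6 * (inn P A B C).card + 3 := by
    rw [← h.card_eq hP]
    apply Finset.card_image_of_injOn
    rintro ⟨a, b, c⟩ h1 ⟨a', b', c'⟩ h2 e
    simp only [Prod.mk.injEq] at e
    obtain ⟨rfl, rfl⟩ := e
    have := h.func hP h1 h2
    rw [this]
  have hsub : De ⊆ {(A, B), (B, C), (C, A)} ∪ (Dfl P T ∪ (Wd P T ∪ (Wd P T).image Prod.swap)) := by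
    intro e he
    obtain ⟨⟨u, v, w⟩, ht, rfl⟩ := Finset.mem_image.1 he
    simp only
    by_cases hh : hullE A B C u v
    · apply Finset.mem_union_left
      rcases hh with ⟨rfl, rfl⟩ | ⟨rfl, rfl⟩ | ⟨rfl, rfl⟩ <;> simp
    apply Finset.mem_union_right
    obtain ⟨z, hz⟩ := h.twin hP ht hh
    have p1 := h.pos _ _ _ ht
    have p2 := h.pos _ _ _ hz
    obtain ⟨n1, n2, n3⟩ := ne_of_o_pos p1
    obtain ⟨m1, m2, m3⟩ := ne_of_o_pos p2
    have hzw : z ≠ w := by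
      rintro rfl
      rw [o_swap] at p2; linarith
    by_cases c1 : 0 < o z v w
    · by_cases c2 : 0 < o w u z
      · apply Finset.mem_union_left
        exact (mem_Dfl h).2 ⟨w, z, ht, hz, c1, c2⟩
      · apply Finset.mem_union_right; apply Finset.mem_union_left
        refine Finset.mem_filter.2 ⟨Finset.mem_product.2 ⟨h.mem _ _ _ ht, h.mem2 ht⟩, z, w, h.rot _ _ _ hz, ht, ?_⟩
        have := hP.gp _ (h.mem3 ht) _ (h.mem _ _ _ ht) _ (h.mem3 hz) n2.symm hzw.symm m3
        have e : o u z w = o w u z := o_rot w u z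
        simp only [e]
        exact lt_of_le_of_ne (not_lt.1 c2) this
    · apply Finset.mem_union_right; apply Finset.mem_union_right
      refine Finset.mem_image.2 ⟨(v, u), ?_, rfl⟩
      refine Finset.mem_filter.2 ⟨Finset.mem_product.2 ⟨h.mem2 ht, h.mem _ _ _ ht⟩, w, z, h.rot _ _ _ ht, hz, ?_⟩
      have := hP.gp _ (h.mem3 hz) _ (h.mem2 ht) _ (h.mem3 ht) m2.symm hzw n3
      have e : o v w z = o z v w := o_rot z v w
      simp only [e]
      exact lt_of_le_of_ne (not_lt.1 c1) this
  have l1 := Finset.card_le_card hsub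
  have l2 := Finset.card_union_le ({(A, B), (B, C), (C, A)} : Finset (Pt × Pt)) (Dfl P T ∪ (Wd P T ∪ (Wd P T).image Prod.swap))
  have l3 := Finset.card_union_le (Dfl P T) (Wd P T ∪ (Wd P T).image Prod.swap)
  have l4 := Finset.card_union_le (Wd P T) ((Wd P T).image Prod.swap)
  have l5 : ((Wd P T).image Prod.swap).card ≤ (Wd P T).card := Finset.card_image_le
  have l6 : ({(A, B), (B, C), (C, A)} : Finset (Pt × Pt)).card ≤ 3 := Finset.card_le_three
  have l7 := card_Wd hP h
  omega

theorem Fl.not_root (hP : Cfg P A B C) (h : Tri P A B C T) (hp : Inn P A B C p) {a b c u : Pt}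
    (hr : root T p a b c) : (p, u) ∉ Dfl P T := by
  intro hu
  obtain ⟨w, z, hf⟩ := (mem_Dfl h).1 hu
  have key : ∀ a c : Pt, root T p a u c → False := by
    intro a c hr
    have e1 : w = c := h.func hP hf.h1 hr.2.1
    have e2 : z = a := h.prev_unique hP (h.rot _ _ _ hf.h2) hr.1
    subst e1 e2
    have := h.pos _ _ _ hr.2.2
    have c2 := hf.c2
    rw [o_swap] at c2; linarith
  rcases hr.only hP h hp hf.h1 with rfl | rfl | rfl
  · exact key _ _ hr.rot.rot
  · exact key _ _ hr
  · exact key _ _ hr.rot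

/-- edge weights -/
def wt (P : Finset Pt) (T : Finset (Pt × Pt × Pt)) (a b : Pt) : ℝ :=
  if (a, b) ∈ Dfl P T then 2 else if edg T a b ∧ edg T b a then 1 else 0

theorem wt_nonneg (a b : Pt) : 0 ≤ wt P T a b := by
  unfold wt; split_ifs <;> norm_num

theorem Dfl_symm (h : Tri P A B C T) {a b : Pt} : (a, b) ∈ Dfl P T → (b, a) ∈ Dfl P T := by
  rw [mem_Dfl h, mem_Dfl h]
  rintro ⟨w, z, hf⟩; exact ⟨z, w, hf.symm⟩

theorem wt_symm (h : Tri P A B C T) (a b : Pt) : wt P T b a = wt P T a b := by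
  unfold wt
  by_cases c : (a, b) ∈ Dfl P T
  · rw [if_pos c, if_pos (Dfl_symm h c)]
  · rw [if_neg c, if_neg (fun c' => c (Dfl_symm h c'))]
    simp only [and_comm]

theorem wt_edg (h : Tri P A B C T) {a b : Pt} (hw : 0 < wt P T a b) : edg T a b := by
  unfold wt at hw
  split_ifs at hw with h1 h2
  · obtain ⟨w, z, hf⟩ := (mem_Dfl h).1 h1
    exact ⟨w, hf.h1⟩
  · exact h2.1
  · exact absurd hw (lt_irrefl _)

theorem wt_self (h : Tri P A B C T) (a : Pt) : wt P T a a = 0 := by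
  by_contra hc
  obtain ⟨w, hw⟩ := wt_edg h (lt_of_le_of_ne (wt_nonneg a a) (Ne.symm hc))
  exact (ne_of_o_pos (h.pos _ _ _ hw)).1 rfl

theorem wt_noncross (hP : Cfg P A B C) (h : Tri P A B C T) (a b c e : Pt) (h1 : 0 < wt P T a b)
    (h2 : 0 < wt P T c e) : ¬ X a b c e := by
  obtain ⟨w, hw⟩ := wt_edg h h1
  obtain ⟨z, hz⟩ := wt_edg h h2
  exact h.noncross hP hw hz

theorem wt_row (h : Tri P A B C T) (v : Pt) (S : Finset Pt) :
    ∑ u : S, wt P T v u ^ 2 ≤ (link T v).card + 3 * ((Dfl P T).filter (fun e => e.1 = v)).card := by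
  rw [Finset.sum_coe_sort S (fun u => wt P T v u ^ 2)]
  let N := (link T v).image Prod.fst
  let M := ((Dfl P T).filter (fun e => e.1 = v)).image Prod.snd
  have h1 : ∀ u ∈ S, wt P T v u ^ 2 ≤ (if u ∈ N then 1 else 0) + 3 * (if u ∈ M then 1 else 0 : ℝ) := by
    intro u _
    have hN : edg T v u → u ∈ N := by
      rintro ⟨x, hx⟩; exact Finset.mem_image.2 ⟨(u, x), mem_link.2 hx, rfl⟩
    unfold wt
    by_cases a1 : (v, u) ∈ Dfl P T
    · have a2 : u ∈ N := by
        obtain ⟨w, z, hf⟩ := (mem_Dfl h).1 a1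
        exact hN ⟨w, hf.h1⟩
      have a3 : u ∈ M := Finset.mem_image.2 ⟨(v, u), Finset.mem_filter.2 ⟨a1, rfl⟩, rfl⟩
      rw [if_pos a1, if_pos a2, if_pos a3]; norm_num
    · rw [if_neg a1]
      have m0 : (0 : ℝ) ≤ 3 * (if u ∈ M then 1 else 0 : ℝ) := by split_ifs <;> norm_num
      by_cases a2 : edg T v u ∧ edg T u v
      · rw [if_pos a2, if_pos (hN a2.1)]; linarith
      · rw [if_neg a2]
        have m1 : (0 : ℝ) ≤ (if u ∈ N then 1 else 0 : ℝ) := by split_ifs <;> norm_num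
        linarith
  refine (Finset.sum_le_sum h1).trans ?_
  rw [Finset.sum_add_distrib, ← Finset.mul_sum]
  have e1 : ∑ u ∈ S, (if u ∈ N then 1 else 0 : ℝ) ≤ (link T v).card := by
    rw [Finset.sum_ite_mem, Finset.sum_const, nsmul_eq_mul, mul_one]
    exact_mod_cast (Finset.card_le_card Finset.inter_subset_right).trans Finset.card_image_le
  have e2 : ∑ u ∈ S, (if u ∈ M then 1 else 0 : ℝ) ≤ ((Dfl P T).filter (fun e => e.1 = v)).card := by
    rw [Finset.sum_ite_mem, Finset.sum_const, nsmul_eq_mul, mul_one]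
    exact_mod_cast (Finset.card_le_card Finset.inter_subset_right).trans Finset.card_image_le
  linarith

theorem sqrt_pow' (a : ℝ) (ha : 0 ≤ a) (n : ℕ) : √(a ^ n) = √a ^ n := by
  induction n with
  | zero => simp
  | succ k ih => rw [pow_succ, pow_succ, Real.sqrt_mul (by positivity), ih]

theorem weight_bound (hP : Cfg P A B C) (h : Tri P A B C T) :
    (√2)⁻¹ ^ (Dfl P T).card * ∏ v : inn P A B C, √(∑ u : inn P A B C, wt P T v u ^ 2)
      ≤ √gam ^ (inn P A B C).card := by
  set I := inn P A B C with hI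
  set R : Pt → ℝ := fun v => ∑ u : I, wt P T v u ^ 2 with hR
  have R0 : ∀ v, 0 ≤ R v := fun v => Finset.sum_nonneg fun _ _ => sq_nonneg _
  have hJ : T3 P A B C T ⊆ I := Finset.filter_subset _ _
  have hcard := Finset.card_sdiff_add_card_eq_card hJ
  have hnum : (1 / 2 : ℝ) ^ (Dfl P T).card * ∏ i ∈ I, R i ≤ gam ^ I.card := by
    have hdeg3 : ∀ v ∈ T3 P A B C T, (link T v).card = 3 ∧ ((Dfl P T).filter (fun e => e.1 = v)).card = 0 := by
      intro v hv
      obtain ⟨hv, a, b, c, hr⟩ := Finset.mem_filter.1 hv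
      have hp := Inn_iff.2 hv
      refine ⟨hr.card hP h hp, ?_⟩
      rw [Finset.card_eq_zero, Finset.filter_eq_empty_iff]
      rintro ⟨x, y⟩ he rfl
      exact Fl.not_root hP h hp hr he
    apply numerics I (T3 P A B C T) hJ R (fun i _ => R0 i)
    · intro v hv
      have h1 := wt_row h v I
      rw [(hdeg3 v hv).1, (hdeg3 v hv).2] at h1
      norm_num at h1
      exact h1
    · have := card_Dfl_ge hP h
      rw [← hI] at this
      omega
    · have h1 : ∑ v ∈ I \ T3 P A B C T, R v ≤
          ∑ v ∈ I \ T3 P A B C T, (((link T v).card : ℝ) + 3 * ((Dfl P T).filter (fun e => e.1 = v)).card) :=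
        Finset.sum_le_sum fun v _ => wt_row h v I
      rw [Finset.sum_add_distrib, ← Finset.mul_sum] at h1
      have h2 := h.sum_deg hP
      rw [← hI, ← Finset.sum_sdiff hJ, Finset.sum_congr rfl (fun v hv => (hdeg3 v hv).1), Finset.sum_const,
        smul_eq_mul] at h2
      have h3 : ∑ v ∈ I \ T3 P A B C T, ((Dfl P T).filter (fun e => e.1 = v)).card ≤ (Dfl P T).card := by
        rw [← Finset.card_biUnion]
        · refine Finset.card_le_card ?_
          intro e he
          obtain ⟨v, -, hv⟩ := Finset.mem_biUnion.1 he
          exact Finset.filter_subset _ _ hv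
        · intro v _ v' _ hne
          rw [Function.onFun, Finset.disjoint_left]
          intro e h1 h2
          exact hne ((Finset.mem_filter.1 h1).2.symm.trans (Finset.mem_filter.1 h2).2)
      have h2' : (∑ v ∈ I \ T3 P A B C T, ((link T v).card : ℝ)) + (T3 P A B C T).card * 3 ≤ 6 * I.card := by
        exact_mod_cast h2
      have h3' : (∑ v ∈ I \ T3 P A B C T, (((Dfl P T).filter (fun e => e.1 = v)).card : ℝ)) ≤ (Dfl P T).card := by
        exact_mod_cast h3
      have hc : ((I \ T3 P A B C T).card : ℝ) + (T3 P A B C T).card = I.card := by exact_mod_cast hcard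
      linarith
  have e1 : ∏ v : I, √(R v) = √(∏ v ∈ I, R v) := by
    rw [Finset.prod_coe_sort I (fun v => √(R v)), Real.sqrt_prod _ (fun v _ => R0 v)]
  have e2 : (√2)⁻¹ ^ (Dfl P T).card = √((1 / 2 : ℝ) ^ (Dfl P T).card) := by
    rw [← Real.sqrt_inv, ← sqrt_pow' _ (by norm_num)]
    norm_num
  have hg : 0 ≤ gam := by unfold gam; positivity
  change (√2)⁻¹ ^ (Dfl P T).card * ∏ v : I, √(R v) ≤ _
  rw [e1, e2, ← Real.sqrt_mul (by positivity), ← sqrt_pow' _ hg]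
  exact Real.sqrt_le_sqrt hnum

end SC

namespace SC
variable {P : Finset Pt} {A B C : Pt} {T : Finset (Pt × Pt × Pt)} {p : Pt}

/-! ### Counting even cycle covers -/

def CC (S : Finset Pt) : Finset (Equiv.Perm S) :=
  Finset.univ.filter (fun σ => (∀ i, σ i ≠ i) ∧ (∀ i j : S, ¬ X i (σ i) j (σ j)) ∧
    ∀ i, Even (Finset.univ.filter (fun x => σ.SameCycle i x)).card)

/-- directed edges of a permutation -/
def Lp {S : Finset Pt} (σ : Equiv.Perm S) : Finset (Pt × Pt) :=
  Finset.univ.image (fun i : S => ((i : Pt), (σ i : Pt)))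

theorem mem_Lp {S : Finset Pt} (σ : Equiv.Perm S) (e : Pt × Pt) :
    e ∈ Lp σ ↔ ∃ i : S, ((i : Pt), (σ i : Pt)) = e := by
  unfold Lp; simp

theorem inner_edg (hP : Cfg P A B C) (h : Tri P A B C T) {u v : Pt} (hu : u ∈ inn P A B C)
    (he : edg T u v) : edg T v u := by
  obtain ⟨w, hw⟩ := he
  obtain ⟨-, a, b, c⟩ := mem_inn.1 hu
  refine h.twin hP hw ?_
  rintro (⟨h1, -⟩ | ⟨h1, -⟩ | ⟨h1, -⟩)
  · exact a h1
  · exact b h1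
  · exact c h1

theorem term_le (hP : Cfg P A B C) (h : Tri P A B C T) (σ : Equiv.Perm (inn P A B C))
    (hE : ∀ e ∈ Lp σ, edg T e.1 e.2) :
    (√2)⁻¹ ^ ((Dfl P T).filter (fun e => e ∉ Lp σ ∧ (e.2, e.1) ∉ Lp σ)).card ≤
      (√2)⁻¹ ^ (Dfl P T).card * ∏ i : inn P A B C, wt P T i (σ i) := by
  set k := (Finset.univ.filter (fun i : inn P A B C => ((i : Pt), (σ i : Pt)) ∈ Dfl P T)).card with hk
  have e1 : ∏ i : inn P A B C, wt P T i (σ i) = 2 ^ k := by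
    rw [hk, ← Finset.prod_const, Finset.prod_filter]
    refine Finset.prod_congr rfl fun i _ => ?_
    have g1 : edg T i (σ i) := hE (i, σ i) ((mem_Lp σ _).2 ⟨i, rfl⟩)
    have g2 := inner_edg hP h i.2 g1
    unfold wt
    split_ifs with c1 c2
    · rfl
    · rfl
    · exact absurd ⟨g1, g2⟩ c2
  set D' := (Dfl P T).filter (fun e => e ∉ Lp σ ∧ (e.2, e.1) ∉ Lp σ)
  have hc : (Dfl P T).card ≤ D'.card + 2 * k := by
    let E1 := (Finset.univ.filter (fun i : inn P A B C => ((i : Pt), (σ i : Pt)) ∈ Dfl P T)).image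
      (fun i : inn P A B C => ((i : Pt), (σ i : Pt)))
    have hsub : Dfl P T ⊆ D' ∪ (E1 ∪ E1.image Prod.swap) := by
      rintro ⟨x, y⟩ he
      by_cases c1 : (x, y) ∈ Lp σ
      · obtain ⟨i, hi⟩ := (mem_Lp σ _).1 c1
        refine Finset.mem_union_right _ (Finset.mem_union_left _ (Finset.mem_image.2 ⟨i, ?_, hi⟩))
        rw [Finset.mem_filter, hi]; exact ⟨Finset.mem_univ _, he⟩
      by_cases c2 : (y, x) ∈ Lp σ
      · obtain ⟨i, hi⟩ := (mem_Lp σ _).1 c2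
        refine Finset.mem_union_right _ (Finset.mem_union_right _ (Finset.mem_image.2 ⟨(y, x), ?_, rfl⟩))
        refine Finset.mem_image.2 ⟨i, ?_, hi⟩
        rw [Finset.mem_filter, hi]; exact ⟨Finset.mem_univ _, Dfl_symm h he⟩
      · exact Finset.mem_union_left _ (Finset.mem_filter.2 ⟨he, c1, c2⟩)
    have l1 := Finset.card_le_card hsub
    have l2 := Finset.card_union_le D' (E1 ∪ E1.image Prod.swap)
    have l3 := Finset.card_union_le E1 (E1.image Prod.swap)
    have l4 : (E1.image Prod.swap).card ≤ E1.card := Finset.card_image_le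
    have l5 : E1.card ≤ k := Finset.card_image_le
    omega
  have s0 : (0 : ℝ) < (√2)⁻¹ := by positivity
  have s1 : (√2)⁻¹ ≤ (1 : ℝ) := by
    apply inv_le_one_of_one_le₀
    rw [Real.one_le_sqrt]; norm_num
  have s2 : ((√2)⁻¹ : ℝ) ^ 2 = 1 / 2 := by
    rw [inv_pow, Real.sq_sqrt (by norm_num)]; norm_num
  have key : (√2)⁻¹ ^ (D'.card + 2 * k) ≤ (√2)⁻¹ ^ (Dfl P T).card :=
    pow_le_pow_of_le_one s0.le s1 hc
  rw [pow_add, pow_mul, s2] at key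
  rw [e1]
  calc (√2)⁻¹ ^ D'.card = (√2)⁻¹ ^ D'.card * (1 / 2) ^ k * 2 ^ k := by
        rw [mul_assoc, ← mul_pow]; norm_num
    _ ≤ _ := mul_le_mul_of_nonneg_right key (by positivity)

theorem card_CC_le (hP : Cfg P A B C) :
    ((CC (inn P A B C)).card : ℝ) ≤ (TT P A B C).card * √gam ^ (inn P A B C).card := by
  have h1 : ((CC (inn P A B C)).card : ℝ) ≤ ∑ σ ∈ CC (inn P A B C), ∑ T ∈ TT P A B C,
      (√2)⁻¹ ^ (Dfl P T).card * ∏ i : inn P A B C, wt P T i (σ i) := by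
    rw [Finset.card_eq_sum_ones, Nat.cast_sum]
    refine Finset.sum_le_sum fun σ hσ => ?_
    obtain ⟨-, f1, f2, -⟩ := Finset.mem_filter.1 hσ
    have hL : ∀ e ∈ Lp σ, e.1 ∈ inn P A B C ∧ e.2 ∈ inn P A B C ∧ e.1 ≠ e.2 := by
      intro e he
      obtain ⟨i, rfl⟩ := (mem_Lp σ _).1 he
      exact ⟨i.2, (σ i).2, fun hc => f1 i (Subtype.ext hc.symm)⟩
    have hX : ∀ e ∈ Lp σ, ∀ f ∈ Lp σ, ¬ X e.1 e.2 f.1 f.2 := by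
      intro e he f hf
      obtain ⟨i, rfl⟩ := (mem_Lp σ _).1 he
      obtain ⟨j, rfl⟩ := (mem_Lp σ _).1 hf
      exact f2 i j
    have := swap_main hP (Lp σ) hL hX
    refine le_trans (le_of_eq_of_le Nat.cast_one this) ?_
    refine le_trans (Finset.sum_le_sum (g := fun T => (√2)⁻¹ ^ (Dfl P T).card * ∏ i : inn P A B C, wt P T i (σ i)) ?_)
      (Finset.sum_le_sum_of_subset_of_nonneg (Finset.filter_subset _ _) ?_)
    · intro T hT
      obtain ⟨hT1, hT2⟩ := Finset.mem_filter.1 hT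
      exact term_le hP (mem_TT.1 hT1) σ hT2
    · intro T _ _
      exact mul_nonneg (by positivity) (Finset.prod_nonneg fun i _ => wt_nonneg _ _)
  refine h1.trans ?_
  rw [Finset.sum_comm, ← nsmul_eq_mul]
  refine Finset.sum_le_card_nsmul _ _ _ fun T hT => ?_
  have h := mem_TT.1 hT
  rw [← Finset.mul_sum]
  refine le_trans (mul_le_mul_of_nonneg_left ?_ (by positivity)) (weight_bound hP h)
  refine perm_sum (inn P A B C) ?_ (wt P T) wt_nonneg (wt_symm h) (wt_self h) (wt_noncross hP h) _ ?_
  · intro a ha b hb c hc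
    exact hP.gp _ (mem_inn.1 ha).1 _ (mem_inn.1 hb).1 _ (mem_inn.1 hc).1
  · intro σ hσ
    exact (Finset.mem_filter.1 hσ).2.2.2

theorem card_TT0 : ((TT {A, B, C} A B C).card : ℝ) ≤ 2 ^ 27 := by
  have h3 : ({A, B, C} : Finset Pt).card ≤ 3 := Finset.card_le_three
  have h1 : (TT {A, B, C} A B C).card ≤ 2 ^ 27 := by
    unfold TT
    refine (Finset.card_filter_le _ _).trans ?_
    rw [Finset.card_powerset, Finset.card_product, Finset.card_product]
    refine Nat.pow_le_pow_right (by norm_num) ?_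
    calc _ ≤ 3 * (3 * 3) := by gcongr
      _ = 27 := by norm_num
  exact_mod_cast h1

theorem gam_num : 29 * √gam ≤ 54.5430 := by
  have h1 : (1.555 : ℝ) ≤ Real.exp (5 / 11) := by
    have := Real.quadratic_le_exp_of_nonneg (x := 5 / 11) (by norm_num)
    norm_num at this ⊢; linarith
  have h2 : Real.exp (-(5 / 11)) ≤ 1 / 1.555 := by
    rw [Real.exp_neg, ← one_div]
    exact one_div_le_one_div_of_le (by norm_num) h1
  have h3 : √gam ≤ 54.5430 / 29 := by
    apply Real.sqrt_le_iff.2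
    refine ⟨by norm_num, ?_⟩
    unfold gam
    calc _ ≤ 11 / 2 * (1 / 1.555 : ℝ) := by gcongr
      _ ≤ _ := by norm_num
  linarith

theorem card_CC_le' (hP : Cfg P A B C) :
    ((CC (inn P A B C)).card : ℝ) ≤ 2 ^ 27 * 54.5430 ^ (inn P A B C).card := by
  have h1 := card_CC_le hP
  have h2 := card_TT_le _ P hP rfl
  calc _ ≤ _ := h1
    _ ≤ (2 ^ 27 * 29 ^ (inn P A B C).card) * √gam ^ (inn P A B C).card := by
        refine mul_le_mul_of_nonneg_right (h2.trans ?_) (by positivity)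
        exact mul_le_mul_of_nonneg_right card_TT0 (by positivity)
    _ = 2 ^ 27 * (29 * √gam) ^ (inn P A B C).card := by rw [mul_pow]; ring
    _ ≤ _ := by gcongr; exact gam_num

end SC

namespace SC
variable {P : Finset Pt} {A B C : Pt} {T : Finset (Pt × Pt × Pt)} {p : Pt}

/-! ### The enclosing triangle -/

def gp (S : Finset Pt) : Prop :=
  ∀ a ∈ S, ∀ b ∈ S, ∀ c ∈ S, a ≠ b → a ≠ c → b ≠ c → o a b c ≠ 0

theorem gp.insert {S : Finset Pt} (h : gp S) {q : Pt} (hq : ∀ a ∈ S, ∀ b ∈ S, a ≠ b → o q a b ≠ 0) :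
    gp (insert q S) := by
  intro a ha b hb c hc n1 n2 n3
  rw [Finset.mem_insert] at ha hb hc
  rcases ha with rfl | ha
  · rcases hb with rfl | hb
    · exact absurd rfl n1
    rcases hc with rfl | hc
    · exact absurd rfl n2
    exact hq _ hb _ hc n3
  rcases hb with rfl | hb
  · rcases hc with rfl | hc
    · exact absurd rfl n3
    rw [← o_rot]
    exact hq _ hc _ ha n2.symm
  rcases hc with rfl | hc
  · rw [← o_rot']; exact hq _ ha _ hb n1
  exact h _ ha _ hb _ hc n1 n2 n3

theorem exists_frame (S : Finset Pt) (hS : gp S) :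
    ∃ (P : Finset Pt) (A B C : Pt), Cfg P A B C ∧ inn P A B C = S := by
  obtain ⟨R, hR0, hR⟩ : ∃ R : ℝ, 0 < R ∧ ∀ q ∈ S, |q.1| ≤ R ∧ |q.2| ≤ R := by
    refine ⟨1 + ∑ q ∈ S, (|q.1| + |q.2|), by positivity, fun q hq => ?_⟩
    have := Finset.single_le_sum (f := fun q : Pt => |q.1| + |q.2|) (fun i _ => by positivity) hq
    constructor <;> linarith [abs_nonneg q.1, abs_nonneg q.2]
  let A0 : Pt := (-4 * R, -4 * R)
  let B0 : Pt := (12 * R, -4 * R)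
  let C0 : Pt := (-4 * R, 12 * R)
  have hq0 : ∀ q ∈ S, inTri q A0 B0 C0 := by
    intro q hq
    obtain ⟨h1, h2⟩ := hR q hq
    rw [abs_le] at h1 h2
    refine ⟨?_, ?_, ?_⟩ <;> simp only [o, A0, B0, C0] <;> nlinarith
  have h0 : 0 < o A0 B0 C0 := by simp only [o, A0, B0, C0]; nlinarith [mul_pos hR0 hR0]
  have op : ∀ (f : Pt → Pt → ℝ), (∀ q, Continuous (f q)) → IsOpen {x | ∀ q ∈ S, 0 < f q x} := by
    intro f hf
    have : {x | ∀ q ∈ S, 0 < f q x} = ⋂ q ∈ S, {x | 0 < f q x} := by ext; simp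
    rw [this]
    exact isOpen_biInter_finset fun q _ => isOpen_lt continuous_const (hf q)
  -- choose A
  obtain ⟨A, ⟨⟨hA1, hA2⟩, hA3⟩, hAg⟩ := exists_generic'
    (U := ({x | ∀ q ∈ S, 0 < o q x B0} ∩ {x | ∀ q ∈ S, 0 < o q C0 x}) ∩ {x | 0 < o x B0 C0})
    (((op (fun q x => o q x B0) (fun q => by unfold o; fun_prop)).inter
      (op (fun q x => o q C0 x) (fun q => by unfold o; fun_prop))).inter
      (isOpen_lt continuous_const (by unfold o; fun_prop)))
    ⟨A0, ⟨fun q hq => (hq0 q hq).1, fun q hq => (hq0 q hq).2.2⟩, h0⟩ S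
  have hAS : gp (Insert.insert A S) := hS.insert hAg
  obtain ⟨B, ⟨⟨hB1, hB2⟩, hB3⟩, hBg⟩ := exists_generic'
    (U := ({x | ∀ q ∈ S, 0 < o q A x} ∩ {x | ∀ q ∈ S, 0 < o q x C0}) ∩ {x | 0 < o A x C0})
    (((op (fun q x => o q A x) (fun q => by unfold o; fun_prop)).inter
      (op (fun q x => o q x C0) (fun q => by unfold o; fun_prop))).inter
      (isOpen_lt continuous_const (by unfold o; fun_prop)))
    ⟨B0, ⟨hA1, fun q hq => (hq0 q hq).2.1⟩, hA3⟩ (Insert.insert A S)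
  have hBS : gp (Insert.insert B (Insert.insert A S)) := hAS.insert hBg
  obtain ⟨C, ⟨⟨hC1, hC2⟩, hC3⟩, hCg⟩ := exists_generic'
    (U := ({x | ∀ q ∈ S, 0 < o q B x} ∩ {x | ∀ q ∈ S, 0 < o q x A}) ∩ {x | 0 < o A B x})
    (((op (fun q x => o q B x) (fun q => by unfold o; fun_prop)).inter
      (op (fun q x => o q x A) (fun q => by unfold o; fun_prop))).inter
      (isOpen_lt continuous_const (by unfold o; fun_prop)))
    ⟨C0, ⟨hB2, hA2⟩, hB3⟩ (Insert.insert B (Insert.insert A S))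
  have hCS : gp (Insert.insert C (Insert.insert B (Insert.insert A S))) := hBS.insert hCg
  refine ⟨Insert.insert C (Insert.insert B (Insert.insert A S)), A, B, C, ⟨by simp, by simp, by simp, hC3, hCS, ?_⟩, ?_⟩
  · intro q hq n1 n2 n3
    simp only [Finset.mem_insert] at hq
    have hq : q ∈ S := by tauto
    exact ⟨hB1 q hq, hC1 q hq, hC2 q hq⟩
  · have nA : A ∉ S := fun hm => by have := hB1 A hm; rw [o_self] at this; exact lt_irrefl _ this
    have nB : B ∉ S := fun hm => by have := hC1 B hm; rw [o_self] at this; exact lt_irrefl _ this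
    have nC : C ∉ S := fun hm => by have := hC2 C hm; rw [o_self] at this; exact lt_irrefl _ this
    ext q
    rw [mem_inn]
    simp only [Finset.mem_insert]
    constructor
    · tauto
    · intro hq
      refine ⟨by tauto, ?_, ?_, ?_⟩ <;> rintro rfl <;> contradiction

theorem CC_bound (S : Finset Pt) (hS : gp S) : ((CC S).card : ℝ) ≤ 2 ^ 27 * 54.5430 ^ S.card := by
  obtain ⟨P, A, B, C, hP, rfl⟩ := exists_frame S hS
  exact card_CC_le' hP

end SC

namespace SC
variable {P : Finset Pt} {A B C : Pt} {T : Finset (Pt × Pt × Pt)} {p : Pt}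

/-! ### Hamiltonian cycles -/

def HC (S : Finset Pt) : Finset (Equiv.Perm S) :=
  Finset.univ.filter (fun σ => (∀ i, σ i ≠ i) ∧ (∀ i j : S, ¬ X i (σ i) j (σ j)) ∧
    ∀ i j, σ.SameCycle i j)

theorem mem_HC {S : Finset Pt} {σ : Equiv.Perm S} : σ ∈ HC S ↔
    (∀ i, σ i ≠ i) ∧ (∀ i j : S, ¬ X i (σ i) j (σ j)) ∧ ∀ i j, σ.SameCycle i j := by
  unfold HC; simp only [Finset.mem_filter, Finset.mem_univ, true_and]

theorem HC_even {S : Finset Pt} (h : Even S.card) : (HC S).card ≤ (CC S).card := by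
  refine Finset.card_le_card fun σ hσ => ?_
  obtain ⟨h1, h2, h3⟩ := mem_HC.1 hσ
  refine Finset.mem_filter.2 ⟨Finset.mem_univ _, h1, h2, fun i => ?_⟩
  have : Finset.univ.filter (fun x => σ.SameCycle i x) = Finset.univ :=
    Finset.filter_true_of_mem fun x _ => h3 i x
  rw [this, Finset.card_univ, Fintype.card_coe]; exact h

theorem X_ne {a b c d : Pt} (h : X a b c d) : a ≠ c ∧ a ≠ d ∧ b ≠ c ∧ b ≠ d := by
  obtain ⟨h1, h2⟩ := h
  refine ⟨?_, ?_, ?_, ?_⟩ <;> rintro rfl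
  · rw [o_self''] at h1; simp at h1
  · rw [o_self''] at h1; simp at h1
  · rw [o_self'] at h1; simp at h1
  · rw [o_self'] at h1; simp at h1

theorem sgn_tr {a b a' b' : ℝ} (h1 : 0 < a * a') (h2 : 0 < b * b') (h3 : a * b < 0) : a' * b' < 0 := by
  by_contra hc
  have := mul_pos h1 h2
  have h4 := mul_nonneg (neg_pos.2 h3).le (not_lt.1 hc)
  nlinarith

theorem exists_twin {S : Finset Pt} (hS : gp S) (h3 : 3 ≤ S.card) :
    ∃ p ∈ S, ∃ z, z ∉ S ∧ gp (insert z S) ∧ (∀ x ∈ S, x ≠ p → 0 < o p z x) ∧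
      ∀ x ∈ S, ∀ y ∈ S, x ≠ p → y ≠ p → x ≠ y → 0 < o z x y * o p x y := by
  obtain ⟨d, hd0, hd⟩ := exists_dir S
  have hne : S.Nonempty := Finset.card_pos.1 (by omega)
  obtain ⟨p, hp, hmin⟩ := Finset.exists_min_image S (fun x => d.1 * x.2 - d.2 * x.1) hne
  have hpos : ∀ x ∈ S, x ≠ p → 0 < sd d p x := by
    intro x hx hxp
    refine lt_of_le_of_ne ?_ (hd p hp x hx hxp.symm).symm
    have := hmin x hx
    unfold sd; linarith
  let zz : ℝ → Pt := fun e => (p.1 + e * d.1, p.2 + e * d.2)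
  have hz0 : zz 0 = p := by simp [zz]
  have hcont : Continuous zz := by fun_prop
  have hev : ∀ᶠ e in nhdsWithin (0 : ℝ) (Set.Ioi 0), ∀ t ∈ S ×ˢ S, t.1 ≠ p → t.2 ≠ p → t.1 ≠ t.2 →
      0 < o (zz e) t.1 t.2 * o p t.1 t.2 := by
    rw [Filter.eventually_all_finset]
    intro t ht
    obtain ⟨t1, t2⟩ := Finset.mem_product.1 ht
    by_cases hc : t.1 ≠ p ∧ t.2 ≠ p ∧ t.1 ≠ t.2
    · have hc1 : Continuous fun e => o (zz e) t.1 t.2 * o p t.1 t.2 :=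
        ((cont_o t.1 t.2).comp hcont).mul continuous_const
      have h0 : 0 < o (zz 0) t.1 t.2 * o p t.1 t.2 := by
        rw [hz0]
        exact mul_self_pos.2 (hS p hp _ t1 _ t2 hc.1.symm hc.2.1.symm hc.2.2)
      have := hc1.continuousAt.eventually (lt_mem_nhds h0)
      filter_upwards [nhdsWithin_le_nhds this] with e he _ _ _ using he
    · exact Filter.Eventually.of_forall fun e a b c => absurd ⟨a, b, c⟩ hc
  obtain ⟨e, he, he0⟩ := (hev.and self_mem_nhdsWithin).exists
  have he0 : 0 < e := he0
  have hop : ∀ x ∈ S, x ≠ p → 0 < o p (zz e) x := by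
    intro x hx hxp
    have : o p (zz e) x = e * sd d p x := by simp only [o, zz, sd]; ring
    rw [this]; exact mul_pos he0 (hpos x hx hxp)
  have hs : ∀ x ∈ S, ∀ y ∈ S, x ≠ p → y ≠ p → x ≠ y → 0 < o (zz e) x y * o p x y :=
    fun x hx y hy => he (x, y) (Finset.mem_product.2 ⟨hx, hy⟩)
  refine ⟨p, hp, zz e, ?_, ?_, hop, hs⟩
  · intro hz
    by_cases hzp : zz e = p
    · obtain ⟨x, hx, hxp⟩ := Finset.exists_mem_ne (s := S) (by omega) p
      have := hop x hx hxp
      rw [hzp, o_self] at this; exact lt_irrefl _ this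
    · have := hop _ hz hzp
      rw [o_self'] at this; exact lt_irrefl _ this
  · refine hS.insert fun a ha b hb hab => ?_
    by_cases c1 : a = p
    · subst c1
      have := hop b hb hab.symm
      rw [o_swap] at this
      intro h0; rw [h0] at this; simp at this
    by_cases c2 : b = p
    · subst c2
      have := hop a ha hab
      rw [← o_rot] at this
      exact this.ne'
    · intro h0
      have := hs a ha b hb c1 c2 hab
      rw [h0] at this; simp at this

/-- inclusion into the set with one more point -/
def incl (S : Finset Pt) (z : Pt) (x : S) : ↥(insert z S) := ⟨x, Finset.mem_insert_of_mem x.2⟩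

def emb (S : Finset Pt) (z : Pt) : S ≃ {x : ↥(insert z S) // x.1 ∈ S} where
  toFun x := ⟨incl S z x, x.2⟩
  invFun y := ⟨y.1.1, y.2⟩
  left_inv x := rfl
  right_inv y := rfl

def ext0 {S : Finset Pt} (z : Pt) (σ : Equiv.Perm S) : Equiv.Perm ↥(insert z S) :=
  σ.extendDomain (emb S z)

def zpt (S : Finset Pt) (z : Pt) : ↥(insert z S) := ⟨z, Finset.mem_insert_self _ _⟩

theorem ext0_incl {S : Finset Pt} (z : Pt) (σ : Equiv.Perm S) (x : S) :
    ext0 z σ (incl S z x) = incl S z (σ x) :=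
  Equiv.Perm.extendDomain_apply_image σ (emb S z) x

theorem ext0_z {S : Finset Pt} {z : Pt} (hz : z ∉ S) (σ : Equiv.Perm S) :
    ext0 z σ (zpt S z) = zpt S z :=
  Equiv.Perm.extendDomain_apply_not_subtype σ (emb S z) hz

def spl {S : Finset Pt} (z : Pt) (p : S) (σ : Equiv.Perm S) : Equiv.Perm ↥(insert z S) :=
  ext0 z σ * Equiv.swap (incl S z p) (zpt S z)

theorem incl_ne {S : Finset Pt} {z : Pt} (hz : z ∉ S) (x : S) : incl S z x ≠ zpt S z := by
  intro h
  have : (x : Pt) = z := congrArg Subtype.val h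
  exact hz (this ▸ x.2)

theorem incl_inj {S : Finset Pt} {z : Pt} : Function.Injective (incl S z) := by
  intro x y h
  have : (incl S z x).1 = (incl S z y).1 := congrArg Subtype.val h
  exact Subtype.ext this

theorem spl_p {S : Finset Pt} {z : Pt} (hz : z ∉ S) (p : S) (σ : Equiv.Perm S) :
    spl z p σ (incl S z p) = zpt S z := by
  unfold spl
  rw [Equiv.Perm.mul_apply, Equiv.swap_apply_left, ext0_z hz]

theorem spl_z {S : Finset Pt} {z : Pt} (p : S) (σ : Equiv.Perm S) :
    spl z p σ (zpt S z) = incl S z (σ p) := by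
  unfold spl
  rw [Equiv.Perm.mul_apply, Equiv.swap_apply_right, ext0_incl]

theorem spl_x {S : Finset Pt} {z : Pt} (hz : z ∉ S) (p : S) (σ : Equiv.Perm S) {x : S} (hx : x ≠ p) :
    spl z p σ (incl S z x) = incl S z (σ x) := by
  unfold spl
  rw [Equiv.Perm.mul_apply, Equiv.swap_apply_of_ne_of_ne (fun h => hx (incl_inj h)) (incl_ne hz x), ext0_incl]

theorem spl_inj {S : Finset Pt} {z : Pt} (p : S) : Function.Injective (spl z p) := by
  intro σ τ h
  unfold spl at h
  have h1 := mul_right_cancel h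
  refine Equiv.ext fun x => ?_
  have h2 : ext0 z σ (incl S z x) = ext0 z τ (incl S z x) := by rw [h1]
  rw [ext0_incl, ext0_incl] at h2
  exact incl_inj h2

theorem cases_insert {S : Finset Pt} {z : Pt} (p : S) (i : ↥(insert z S)) :
    i = zpt S z ∨ i = incl S z p ∨ ∃ x : S, x ≠ p ∧ i = incl S z x := by
  obtain ⟨i, hi⟩ := i
  rcases Finset.mem_insert.1 hi with rfl | h
  · exact Or.inl rfl
  · by_cases c : (⟨i, h⟩ : S) = p
    · right; left; rw [← c]; rfl
    · right; right; exact ⟨⟨i, h⟩, c, rfl⟩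

theorem spl_cycle {S : Finset Pt} {z : Pt} (hz : z ∉ S) (p : S) (σ : Equiv.Perm S)
    (h : ∀ i j, σ.SameCycle i j) : ∀ i j, (spl z p σ).SameCycle i j := by
  have step : ∀ x : S, (spl z p σ).SameCycle (incl S z x) (incl S z (σ x)) := by
    intro x
    by_cases c : x = p
    · subst c
      refine ⟨2, ?_⟩
      rw [zpow_two, Equiv.Perm.mul_apply, spl_p hz, spl_z]
    · refine ⟨1, ?_⟩
      rw [zpow_one, spl_x hz _ _ c]
  have pw : ∀ n : ℕ, ∀ x : S, (spl z p σ).SameCycle (incl S z x) (incl S z ((σ ^ n) x)) := by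
    intro n
    induction n with
    | zero => intro x; exact Equiv.Perm.SameCycle.refl _ _
    | succ k ih =>
      intro x
      rw [pow_succ', Equiv.Perm.mul_apply]
      exact (ih x).trans (step _)
  have hp : ∀ i, (spl z p σ).SameCycle (incl S z p) i := by
    intro i
    obtain ⟨i, hi⟩ := i
    rcases Finset.mem_insert.1 hi with rfl | h'
    · exact ⟨1, by rw [zpow_one]; exact spl_p hz p σ⟩
    · obtain ⟨n, -, hn⟩ := (h p ⟨i, h'⟩).exists_pow_eq'
      have := pw n p
      rw [hn] at this
      exact this
  exact fun i j => (hp i).symm.trans (hp j)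

theorem spl_HC {S : Finset Pt} {z : Pt} (hz : z ∉ S) (p : S)
    (h1 : ∀ x ∈ S, x ≠ p → 0 < o p z x)
    (h2 : ∀ x ∈ S, ∀ y ∈ S, x ≠ p → y ≠ p → x ≠ y → 0 < o z x y * o p x y)
    {σ : Equiv.Perm S} (hσ : σ ∈ HC S) (hq : 0 ≤ o (σ⁻¹ p : S) p (σ p)) :
    spl z p σ ∈ HC (insert z S) := by
  obtain ⟨f1, f2, f3⟩ := mem_HC.1 hσ
  have vne : ∀ {x y : S}, x ≠ y → (x : Pt) ≠ y := fun h h' => h (Subtype.ext h')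
  have L1 : ∀ x : S, x ≠ p → ¬ X p z x (σ x) := by
    intro x hx hX
    obtain ⟨n1, n2, n3, n4⟩ := X_ne hX
    have := mul_pos (h1 x x.2 n1.symm) (h1 (σ x) (σ x).2 n2.symm)
    exact absurd hX.1 (not_lt.2 this.le)
  have L2 : ∀ x : S, x ≠ p → ¬ X z (σ p) x (σ x) := by
    intro x hx hX
    obtain ⟨n1, n2, n3, n4⟩ := X_ne hX
    by_cases c : σ x = p
    · have hxq : σ⁻¹ p = x := by rw [← c]; simp
      rw [hxq] at hq
      have k1 := hX.2
      rw [c] at k1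
      have k2 := h1 x x.2 (vne hx)
      have e : o x p z = o p z x := (o_rot (x : Pt) p z).symm
      rw [e] at k1
      exact absurd k1 (not_lt.2 (mul_nonneg k2.le hq))
    · have hrp : (σ p : Pt) ≠ p := vne (f1 p)
      have hxp : (x : Pt) ≠ p := vne hx
      have hyp : (σ x : Pt) ≠ p := vne c
      have hxy : (x : Pt) ≠ σ x := vne (f1 x).symm
      refine f2 p x ⟨sgn_tr (h2 _ (σ p).2 _ x.2 hrp hxp n3) (h2 _ (σ p).2 _ (σ x).2 hrp hyp n4) hX.1, ?_⟩
      have k := h2 _ x.2 _ (σ x).2 hxp hyp hxy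
      have k2 := hX.2
      rw [← o_rot z, ] at k
      have e1 : o x (σ x) z = o z x (σ x) := o_rot z x (σ x)
      have e2 : o x (σ x) p = o p x (σ x) := o_rot (p : Pt) x (σ x)
      have hne : o x (σ x) (σ p) ≠ 0 := by
        intro h0; rw [h0, mul_zero] at k2; exact lt_irrefl _ k2
      rw [← e2] at k
      exact sgn_tr k (mul_self_pos.2 hne) k2
  refine mem_HC.2 ⟨?_, ?_, spl_cycle hz p σ f3⟩
  · intro i
    rcases cases_insert p i with rfl | rfl | ⟨x, hx, rfl⟩
    · rw [spl_z]; exact incl_ne hz _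
    · rw [spl_p hz]; exact (incl_ne hz _).symm
    · rw [spl_x hz _ _ hx]; exact fun h => f1 x (incl_inj h)
  · intro i j
    rcases cases_insert p i with rfl | rfl | ⟨x, hx, rfl⟩ <;>
    rcases cases_insert p j with rfl | rfl | ⟨y, hy, rfl⟩
    · intro h; exact (X_ne h).1 rfl
    · rw [spl_z, spl_p hz]; intro h; exact (X_ne h).2.1 rfl
    · rw [spl_z, spl_x hz _ _ hy]; exact L2 y hy
    · rw [spl_z, spl_p hz]; intro h; exact (X_ne h).2.2.1 rfl
    · intro h; exact (X_ne h).1 rfl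
    · rw [spl_p hz, spl_x hz _ _ hy]; exact L1 y hy
    · rw [spl_z, spl_x hz _ _ hx]; intro h; exact L2 x hx (X_symm h)
    · rw [spl_p hz, spl_x hz _ _ hx]; intro h; exact L1 x hx (X_symm h)
    · rw [spl_x hz _ _ hx, spl_x hz _ _ hy]; exact f2 x y

theorem HC_inv {S : Finset Pt} {σ : Equiv.Perm S} (hσ : σ ∈ HC S) : σ⁻¹ ∈ HC S := by
  obtain ⟨f1, f2, f3⟩ := mem_HC.1 hσ
  refine mem_HC.2 ⟨?_, ?_, fun i j => Equiv.Perm.sameCycle_inv.2 (f3 i j)⟩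
  · intro i h
    apply f1 i
    rw [Equiv.Perm.inv_eq_iff_eq] at h; exact h.symm
  · intro i j h
    have := f2 (σ⁻¹ i) (σ⁻¹ j)
    rw [show σ (σ⁻¹ i) = i from σ.apply_symm_apply i, show σ (σ⁻¹ j) = j from σ.apply_symm_apply j] at this
    exact this (X_swap1 (X_swap2 h))

theorem HC_odd {S : Finset Pt} (hS : gp S) (h3 : 3 ≤ S.card) :
    ∃ S' : Finset Pt, gp S' ∧ S'.card = S.card + 1 ∧ (HC S).card ≤ 2 * (HC S').card := by
  obtain ⟨p, hp, z, hz, hg, h1, h2⟩ := exists_twin hS h3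
  refine ⟨insert z S, hg, Finset.card_insert_of_notMem hz, ?_⟩
  let p' : S := ⟨p, hp⟩
  let H := (HC S).filter (fun σ => 0 ≤ o (σ⁻¹ p' : S) p' (σ p'))
  have hH : H.card ≤ (HC (insert z S)).card := by
    refine Finset.card_le_card_of_injOn (spl z p') ?_ (fun a _ b _ h => spl_inj p' h)
    intro σ hσ
    obtain ⟨a, b⟩ := Finset.mem_filter.1 hσ
    exact spl_HC hz p' h1 h2 a b
  have hsub : HC S ⊆ H ∪ H.image (fun σ => σ⁻¹) := by
    intro σ hσ
    by_cases c : 0 ≤ o (σ⁻¹ p' : S) p' (σ p')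
    · exact Finset.mem_union_left _ (Finset.mem_filter.2 ⟨hσ, c⟩)
    · refine Finset.mem_union_right _ (Finset.mem_image.2 ⟨σ⁻¹, Finset.mem_filter.2 ⟨HC_inv hσ, ?_⟩, inv_inv σ⟩)
      rw [inv_inv, o_swap'']
      linarith
  have l1 := Finset.card_le_card hsub
  have l2 := Finset.card_union_le H (H.image (fun σ => σ⁻¹))
  have l3 : (H.image (fun σ => σ⁻¹)).card ≤ H.card := Finset.card_image_le
  omega

theorem HC_bound {S : Finset Pt} (hS : gp S) (h3 : 3 ≤ S.card) :
    ((HC S).card : ℝ) ≤ 2 ^ 34 * 54.5430 ^ S.card := by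
  rcases Nat.even_or_odd S.card with he | ho
  · have h1 : ((HC S).card : ℝ) ≤ (CC S).card := by exact_mod_cast HC_even he
    have h2 := CC_bound S hS
    have : (0 : ℝ) ≤ 54.5430 ^ S.card := by positivity
    linarith
  · obtain ⟨S', hg, hc, hle⟩ := HC_odd hS h3
    have he : Even S'.card := by rw [hc]; exact ho.add_one
    have h1 : ((HC S').card : ℝ) ≤ (CC S').card := by exact_mod_cast HC_even he
    have h2 := CC_bound S' hg
    have h4 : ((HC S).card : ℝ) ≤ 2 * (HC S').card := by exact_mod_cast hle
    have : (0 : ℝ) ≤ 54.5430 ^ S.card := by positivity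
    rw [hc, pow_succ (54.5430 : ℝ)] at h2
    linarith

/-! ### Spanning cycles -/

theorem gp_of_GenPos {S : Finset Pt} (h : GenPos S) : gp S := by
  intro a ha b hb c hc n1 n2 n3 h0
  apply h a ha b hb c hc n1 n2 n3
  rw [collinear_iff_of_mem (p₀ := a) (by simp)]
  refine ⟨b - a, ?_⟩
  intro q hq
  simp only [Set.mem_insert_iff, Set.mem_singleton_iff] at hq
  rcases hq with rfl | rfl | rfl
  · exact ⟨0, by simp⟩
  · exact ⟨1, by simp⟩
  · unfold o at h0
    by_cases c1 : b.1 - a.1 = 0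
    · have c2 : b.2 - a.2 ≠ 0 := by
        intro c2; exact n1 (Prod.ext (by linarith) (by linarith))
      refine ⟨(q.2 - a.2) / (b.2 - a.2), ?_⟩
      rw [c1] at h0
      have : q.1 - a.1 = 0 := by
        have : (b.2 - a.2) * (q.1 - a.1) = 0 := by linarith
        exact (mul_eq_zero.1 this).resolve_left c2
      ext
      · simp [c1]; linarith
      · simp; field_simp; ring
    · refine ⟨(q.1 - a.1) / (b.1 - a.1), ?_⟩
      ext
      · simp; field_simp; ring
      · simp; field_simp; linarith

theorem plane_noX {S : Finset Pt} (G : PlaneGraph S) {a b c d : Pt} (h1 : s(a, b) ∈ G.edges)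
    (h2 : s(c, d) ∈ G.edges) : ¬ X a b c d := by
  intro hX
  obtain ⟨n1, n2, n3, n4⟩ := X_ne hX
  have hab : a ≠ b := by
    intro h; exact G.not_isDiag _ h1 (by rw [h]; simp)
  obtain ⟨t, s, t0, t1, s0, s1, e1, e2⟩ := cross_pt hX
  have hne : s(a, b) ≠ s(c, d) := by
    intro h
    rw [Sym2.eq_iff] at h
    rcases h with h | h
    · exact n1 h.1
    · exact n2 h.1
  let x : Pt := (a.1 + t * (b.1 - a.1), a.2 + t * (b.2 - a.2))
  have hx1 : x ∈ seg2 s(a, b) := by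
    show x ∈ segment ℝ a b
    refine ⟨1 - t, t, by linarith, t0.le, by ring, ?_⟩
    ext <;> simp [x] <;> ring
  have hx2 : x ∈ seg2 s(c, d) := by
    show x ∈ segment ℝ c d
    refine ⟨1 - s, s, by linarith, s0.le, by ring, ?_⟩
    ext
    · simp [x, e1]; ring
    · simp [x, e2]; ring
  obtain ⟨k, -⟩ := G.noncrossing _ h1 _ h2 hne x ⟨hx1, hx2⟩
  rcases Sym2.mem_iff.1 k with k | k
  · apply hab
    have k1 := congrArg Prod.fst k
    have k2 := congrArg Prod.snd k
    simp only [x] at k1 k2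
    have m1 : t * (b.1 - a.1) = 0 := by linarith
    have m2 : t * (b.2 - a.2) = 0 := by linarith
    have m1 := (mul_eq_zero.1 m1).resolve_left t0.ne'
    have m2 := (mul_eq_zero.1 m2).resolve_left t0.ne'
    exact Prod.ext (by linarith) (by linarith)
  · apply hab
    have k1 := congrArg Prod.fst k
    have k2 := congrArg Prod.snd k
    simp only [x] at k1 k2
    have m1 : (1 - t) * (b.1 - a.1) = 0 := by linarith
    have m2 : (1 - t) * (b.2 - a.2) = 0 := by linarith
    have m1 := (mul_eq_zero.1 m1).resolve_left (by linarith)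
    have m2 := (mul_eq_zero.1 m2).resolve_left (by linarith)
    exact Prod.ext (by linarith) (by linarith)

theorem span_perm {S : Finset Pt} (G : PlaneGraph S) (hG : IsSpanningCycle G) :
    ∃ σ : Equiv.Perm S, σ ∈ HC S ∧
      G.edges = Finset.univ.image (fun i : S => s((i : Pt), (σ i : Pt))) := by
  obtain ⟨h3, f, hf⟩ := hG
  let σ : Equiv.Perm S := f.permCongr (finRotate S.card)
  have hσ : ∀ k, σ (f k) = f (finRotate S.card k) := by
    intro k; simp [σ, Equiv.permCongr_apply]
  have hE : G.edges = Finset.univ.image (fun i : S => s((i : Pt), (σ i : Pt))) := by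
    rw [hf]
    ext e
    simp only [Finset.mem_image, Finset.mem_univ, true_and]
    constructor
    · rintro ⟨k, rfl⟩; exact ⟨f k, by rw [hσ]⟩
    · rintro ⟨i, rfl⟩
      refine ⟨f.symm i, ?_⟩
      rw [← hσ, Equiv.apply_symm_apply]
  have hm : ∀ i : S, s((i : Pt), (σ i : Pt)) ∈ G.edges := by
    intro i; rw [hE]; exact Finset.mem_image.2 ⟨i, Finset.mem_univ _, rfl⟩
  refine ⟨σ, mem_HC.2 ⟨?_, fun i j => plane_noX G (hm i) (hm j), ?_⟩, hE⟩
  · intro i hi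
    apply G.not_isDiag _ (hm i)
    rw [hi]; simp
  · have hcyc : (finRotate S.card).IsCycle := isCycle_finRotate_of_le (by omega)
    have hsupp : ∀ k, finRotate S.card k ≠ k := by
      intro k
      have := support_finRotate_of_le (n := S.card) (by omega)
      rw [← Equiv.Perm.mem_support, this]; exact Finset.mem_univ _
    intro i j
    obtain ⟨n, hn⟩ := hcyc.sameCycle (hsupp (f.symm i)) (hsupp (f.symm j))
    refine ⟨n, ?_⟩
    have : σ ^ n = f.permCongr (finRotate S.card ^ n) := by
      exact (map_zpow (f.permCongrHom) (finRotate S.card) n).symm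
    rw [this, Equiv.permCongr_apply, hn, Equiv.apply_symm_apply]

theorem sc_le_HC (S : Finset Pt) : scCount S ≤ (HC S).card := by
  unfold scCount
  choose σ hσ hE using fun G : {G : PlaneGraph S // IsSpanningCycle G} => span_perm G.1 G.2
  have : Nat.card (HC S) = (HC S).card := by simp
  rw [← this]
  refine Nat.card_le_card_of_injective (fun G => (⟨σ G, hσ G⟩ : HC S)) ?_
  intro G G' h
  have h' : σ G = σ G' := congrArg Subtype.val h
  have he : G.1.edges = G'.1.edges := by rw [hE G, hE G', h']
  apply Subtype.ext
  obtain ⟨⟨e, _, _, _⟩, _⟩ := G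
  obtain ⟨⟨e', _, _, _⟩, _⟩ := G'
  simp only at he
  subst he
  rfl

theorem final (S : Finset Pt) (hS : GenPos S) : (scCount S : ℝ) ≤ 2 ^ 34 * 54.5430 ^ S.card := by
  by_cases h3 : 3 ≤ S.card
  · have h1 : (scCount S : ℝ) ≤ (HC S).card := by exact_mod_cast sc_le_HC S
    exact h1.trans (HC_bound (gp_of_GenPos hS) h3)
  · have : scCount S = 0 := by
      unfold scCount
      have : IsEmpty {G : PlaneGraph S // IsSpanningCycle G} := ⟨fun G => h3 G.2.1⟩
      exact Nat.card_of_isEmpty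
    rw [this]; push_cast; positivity

end SC

/-- `sc(N) = O(54.5430^N)`. -/
theorem statement14 :
    ∃ c : ℝ, 0 < c ∧ ∀ S : Finset Pt, GenPos S →
      (scCount S : ℝ) ≤ c * (54.5430 : ℝ) ^ S.card := by
  exact ⟨2 ^ 34, by positivity, fun S hS => SC.final S hS⟩

end
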